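/- arXiv:1102.0805 — 5 statements merged into one kernel-verified Lean document; each statement's English description precedes it below -/
import Mathlib

section
/- Let G be a finite simple graph that is the line graph of a multigraph. Then χ(G) ≤ χ_f(G) + √((9/2)·χ_f(G)). -/
/-- A fractional `c`-colouring of `G`: a nonnegative real weight on each finset of
vertices, supported on stable (independent) sets, with total weight at most `c`,
such that for each vertex the total weight of sets containing it is exactly 1. -/
def IsFractionalColoring {V : Type*} [Fintype V] [DecidableEq V]
    (G : SimpleGraph V) (w : Finset V → ℝ) (c : ℝ) : Prop :=
  (∀ S : Finset V, 0 ≤ w S) ∧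
  (∀ S : Finset V, w S ≠ 0 → ∀ u ∈ S, ∀ v ∈ S, ¬ G.Adj u v) ∧
  (∑ S : Finset V, w S ≤ c) ∧
  (∀ v : V, ∑ S ∈ Finset.univ.filter (fun S : Finset V => v ∈ S), w S = 1)

/-- The fractional chromatic number: the least `c` admitting a fractional `c`-colouring. -/
noncomputable def fracChromatic {V : Type*} [Fintype V] [DecidableEq V]
    (G : SimpleGraph V) : ℝ :=
  sInf {c : ℝ | ∃ w : Finset V → ℝ, IsFractionalColoring G w c}

/-- `G` is the line graph of a multigraph: each vertex corresponds to an unordered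
pair of elements of some set `W` (the endpoints of an edge, possibly equal), and two
distinct vertices are adjacent iff their pairs share an element. -/
def IsLineGraphOfMultigraph {V : Type*} (G : SimpleGraph V) : Prop :=
  ∃ (W : Type) (f : V → Sym2 W), ∀ u v : V, u ≠ v →
    (G.Adj u v ↔ ∃ x : W, x ∈ f u ∧ x ∈ f v)


namespace LGC

/-- the flag walk -/
def gw {X : Type*} (a b : X → X) (s : X × Bool) : X × Bool :=
  if s.2 then (b s.1, false) else (a s.1, true)

/-- flip a flag -/
def fl {X : Type*} (s : X × Bool) : X × Bool := (s.1, !s.2)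

lemma gw_fl_gw {X : Type*} (a b : X → X) (ha : ∀ x, a (a x) = x) (hb : ∀ x, b (b x) = x)
    (s : X × Bool) : gw a b (fl (gw a b s)) = fl s := by
  rcases s with ⟨x, c⟩
  cases c <;> simp [gw, fl, ha, hb]

lemma fl_fl {X : Type*} (s : X × Bool) : fl (fl s) = s := by
  rcases s with ⟨x, c⟩; simp [fl]

/-- Alternating path lemma. -/
lemma invol_component {X : Type*} [Finite X] (a b : X → X) (ha : ∀ x, a (a x) = x)
    (hb : ∀ x, b (b x) = x) (x : X) (hx : b x = x) :
    ∃ D : Set X, x ∈ D ∧ (∀ y ∈ D, a y ∈ D) ∧ (∀ y ∈ D, b y ∈ D) ∧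
      (∀ D' : Set X, x ∈ D' → (∀ y ∈ D', a y ∈ D') → (∀ y ∈ D', b y ∈ D') → D ⊆ D') ∧
      (∀ y ∈ D, ∀ z ∈ D, (a y = y ∨ b y = y) → (a z = z ∨ b z = z) → y ≠ x → z ≠ x → y = z) := by
  set g := gw a b with hg
  have hinj : Function.Injective g := by
    intro s t hst
    have h1 := gw_fl_gw a b ha hb s
    have h2 := gw_fl_gw a b ha hb t
    rw [← hg] at h1 h2
    rw [hst, h2] at h1
    rw [← fl_fl s, ← h1, fl_fl]
  set s : X × Bool := (x, false) with hs
  have hper : s ∈ Function.periodicPts g := hinj.mem_periodicPts s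
  set n := Function.minimalPeriod g s with hn
  have hnpos : 0 < n := Function.minimalPeriod_pos_of_mem_periodicPts hper
  have hgn : g^[n] s = s := Function.iterate_minimalPeriod
  -- reflection
  have hfs : g (fl s) = s := by simp [hg, gw, fl, hs, hx]
  have hrefl : ∀ k, g^[k] (g (fl (g^[k] s))) = s := by
    intro k
    induction k with
    | zero => simpa using hfs
    | succ k ih =>
      have h1 : g (fl (g (g^[k] s))) = fl (g^[k] s) := gw_fl_gw a b ha hb _
      rw [Function.iterate_succ_apply' g k s, Function.iterate_succ_apply g k, h1]
      exact ih
  -- fixed flags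
  have hfix : ∀ k, g (fl (g^[k] s)) = g^[k] s → n ∣ 2 * k := by
    intro k hk
    have := hrefl k
    rw [hk, ← Function.iterate_add_apply] at this
    have : Function.IsPeriodicPt g (2 * k) s := by
      rw [two_mul]; exact this
    exact this.minimalPeriod_dvd
  have huniq : ∀ k l, g (fl (g^[k] s)) = g^[k] s → g (fl (g^[l] s)) = g^[l] s →
      g^[k] s ≠ s → g^[l] s ≠ s → g^[k] s = g^[l] s := by
    intro k l hk hl hk0 hl0
    obtain ⟨i, hi⟩ := hfix k hk
    obtain ⟨j, hj⟩ := hfix l hl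
    have key : ∀ k i, 2 * k = n * i → g^[k] s ≠ s → k % n * 2 = n := by
      intro k i hki hne
      have h1 : g^[k % n] s = g^[k] s := Function.iterate_mod_minimalPeriod_eq
      have h2 : k % n ≠ 0 := by
        intro h0
        rw [h0] at h1
        exact hne h1.symm
      have h3 : k % n < n := Nat.mod_lt _ hnpos
      have h4 : n ∣ 2 * (k % n) := by
        have := Nat.div_add_mod k n
        have h5 : 2 * k = n * (2 * (k / n)) + 2 * (k % n) := by
          conv_lhs => rw [← this]
          ring
        exact (Nat.dvd_add_right ⟨2 * (k / n), rfl⟩).1 (h5 ▸ ⟨i, hki⟩)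
      obtain ⟨m, hm⟩ := h4
      have : m = 1 := by
        rcases m with _ | _ | m
        · omega
        · rfl
        · exfalso; nlinarith
      subst this; omega
    have h1 := key k i hi hk0
    have h2 := key l j hj hl0
    have : k % n = l % n := by omega
    rw [← Function.iterate_mod_minimalPeriod_eq (f := g) (x := s) (n := k),
      ← Function.iterate_mod_minimalPeriod_eq (f := g) (x := s) (n := l), ← hn, this]
  -- orbit is closed under flip
  have hflip : ∀ k, ∃ l, g^[l] s = fl (g^[k] s) := by
    have hback : ∀ t, (∃ l, g^[l] s = g t) → ∃ l, g^[l] s = t := by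
      rintro t ⟨l, hl⟩
      refine ⟨l + n - 1, hinj ?_⟩
      rw [← Function.iterate_succ_apply' g, ← hl]
      have : (l + n - 1).succ = l + n := by omega
      rw [this, Function.iterate_add_apply, hgn]
    intro k
    induction k with
    | zero => exact hback _ ⟨0, by simpa using hfs.symm⟩
    | succ k ih =>
      apply hback
      rw [Function.iterate_succ_apply']
      obtain ⟨l, hl⟩ := ih
      exact ⟨l, by rw [hl, hg, gw_fl_gw a b ha hb]⟩
  have hflag : ∀ y, (∃ k, (g^[k] s).1 = y) → ∀ c, ∃ k, g^[k] s = (y, c) := by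
    rintro y ⟨k, hk⟩ c
    by_cases hc : (g^[k] s).2 = c
    · exact ⟨k, by ext <;> simp [hk, hc]⟩
    · obtain ⟨l, hl⟩ := hflip k
      refine ⟨l, ?_⟩
      rw [hl]
      ext
      · simp [fl, hk]
      · simp only [fl]
        cases h : (g^[k] s).2 <;> cases c <;> simp_all
  refine ⟨{y | ∃ k, (g^[k] s).1 = y}, ⟨0, rfl⟩, ?_, ?_, ?_, ?_⟩
  · intro y hy
    obtain ⟨k, hk⟩ := hflag y hy false
    exact ⟨k + 1, by rw [Function.iterate_succ_apply', hk]; simp [hg, gw]⟩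
  · intro y hy
    obtain ⟨k, hk⟩ := hflag y hy true
    exact ⟨k + 1, by rw [Function.iterate_succ_apply', hk]; simp [hg, gw]⟩
  · rintro D' hx' ha' hb' y ⟨k, rfl⟩
    induction k with
    | zero => exact hx'
    | succ k ih =>
      rw [Function.iterate_succ_apply']
      simp only [hg, gw]
      split_ifs
      · exact hb' _ ih
      · exact ha' _ ih
  · intro y hy z hz hfy hfz hyx hzx
    have key : ∀ y, (∃ k, (g^[k] s).1 = y) → (a y = y ∨ b y = y) →
        ∃ k, (g^[k] s).1 = y ∧ g (fl (g^[k] s)) = g^[k] s := by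
      intro y hy hfy
      rcases hfy with h | h
      · obtain ⟨k, hk⟩ := hflag y hy true
        exact ⟨k, by rw [hk], by rw [hk]; simp [hg, gw, fl, h]⟩
      · obtain ⟨k, hk⟩ := hflag y hy false
        exact ⟨k, by rw [hk], by rw [hk]; simp [hg, gw, fl, h]⟩
    obtain ⟨k, hk, hk'⟩ := key y hy hfy
    obtain ⟨l, hl, hl'⟩ := key z hz hfz
    have := huniq k l hk' hl' (by intro h; rw [h] at hk; exact hyx hk.symm)
      (by intro h; rw [h] at hl; exact hzx hl.symm)
    rw [← hk, ← hl, this]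

end LGC

namespace LGC

variable {E N C : Type*}

/-- incidence -/
def Inc (p r : E → N) (x : N) (e : E) : Prop := p e = x ∨ r e = x

/-- proper partial colouring -/
def Proper (p r : E → N) (φ : E → Option C) : Prop :=
  ∀ e e' x, Inc p r x e → Inc p r x e' → φ e = φ e' → φ e ≠ none → e = e'

/-- colour c is missing at x -/
def Miss (p r : E → N) (φ : E → Option C) (x : N) (c : C) : Prop :=
  ∀ e, Inc p r x e → φ e ≠ some c

open Classical in
/-- the other end -/
noncomputable def oth (p r : E → N) (e : E) (x : N) : N := if p e = x then r e else p e

open Classical in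
/-- the involution of a colour -/
noncomputable def sig (p r : E → N) (φ : E → Option C) (c : C) (x : N) : N :=
  if h : ∃ e, Inc p r x e ∧ φ e = some c then oth p r h.choose x else x

lemma sig_eq {p r : E → N} {φ : E → Option C} (hφ : Proper p r φ) {x : N} {e : E} {c : C}
    (hx : Inc p r x e) (hc : φ e = some c) : sig p r φ c x = oth p r e x := by
  have h : ∃ e, Inc p r x e ∧ φ e = some c := ⟨e, hx, hc⟩
  have : h.choose = e := hφ _ _ x h.choose_spec.1 hx (by rw [h.choose_spec.2, hc])
    (by rw [h.choose_spec.2]; simp)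
  rw [sig, dif_pos h, this]

lemma sig_miss {p r : E → N} {φ : E → Option C} {x : N} {c : C}
    (h : Miss p r φ x c) : sig p r φ c x = x := by
  rw [sig, dif_neg]
  rintro ⟨e, he, hc⟩
  exact h e he hc

lemma not_miss {p r : E → N} {φ : E → Option C} {x : N} {c : C} :
    ¬ Miss p r φ x c ↔ ∃ e, Inc p r x e ∧ φ e = some c := by
  simp [Miss]

lemma oth_inc {p r : E → N} {e : E} {x : N} (_hx : Inc p r x e) :
    Inc p r (oth p r e x) e := by
  unfold oth Inc at *; split_ifs <;> simp

lemma oth_oth {p r : E → N} {e : E} {x : N} (hx : Inc p r x e) :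
    oth p r e (oth p r e x) = x := by
  unfold oth Inc at *; grind

lemma oth_ne {p r : E → N} (hpr : ∀ e, p e ≠ r e) {e : E} {x : N} (hx : Inc p r x e) :
    oth p r e x ≠ x := by
  have := hpr e
  unfold oth Inc at *; grind

/-- the two ends of an edge -/
lemma inc_oth {p r : E → N} {e : E} {x y : N} (hx : Inc p r x e) (hy : Inc p r y e)
    (hxy : x ≠ y) : y = oth p r e x := by
  unfold oth Inc at *; grind

lemma sig_sig {p r : E → N} {φ : E → Option C} (hφ : Proper p r φ) (c : C) (x : N) :
    sig p r φ c (sig p r φ c x) = x := by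
  by_cases h : Miss p r φ x c
  · rw [sig_miss h, sig_miss h]
  · obtain ⟨e, he, hc⟩ := not_miss.1 h
    rw [sig_eq hφ he hc, sig_eq hφ (oth_inc he) hc, oth_oth he]

lemma sig_ne {p r : E → N} (hpr : ∀ e, p e ≠ r e) {φ : E → Option C} (hφ : Proper p r φ) {c : C}
    {x : N} (h : ¬ Miss p r φ x c) : sig p r φ c x ≠ x := by
  obtain ⟨e, he, hc⟩ := not_miss.1 h
  rw [sig_eq hφ he hc]
  exact oth_ne hpr he

/-- a set closed for two colours -/
def Clo (p r : E → N) (φ : E → Option C) (α β : C) (D : Set N) : Prop :=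
  ∀ e, φ e = some α ∨ φ e = some β → (p e ∈ D ↔ r e ∈ D)

open Classical in
/-- Kempe exchange -/
noncomputable def sw [DecidableEq C] (p : E → N) (φ : E → Option C) (α β : C) (D : Set N) (e : E) : Option C :=
  if p e ∈ D then (φ e).map (Equiv.swap α β) else φ e

lemma sw_in [DecidableEq C] {p r : E → N} {φ : E → Option C} {α β : C} {D : Set N} (hD : Clo p r φ α β D)
    {x : N} {e : E} (hx : Inc p r x e) (hxD : x ∈ D) {c : C} :
    sw p φ α β D e = some c ↔ φ e = some (Equiv.swap α β c) := by
  classical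
  have key : sw p φ α β D e = (φ e).map (Equiv.swap α β) := by
    unfold sw
    split_ifs with h
    · rfl
    · have : ¬ (φ e = some α ∨ φ e = some β) := by
        intro h'
        have := hD e h'
        rcases hx with rfl | rfl <;> tauto
      rcases h1 : φ e with _ | d
      · rfl
      · simp only [h1, Option.some.injEq] at this
        push Not at this
        simp [Equiv.swap_apply_of_ne_of_ne this.1 this.2]
  rw [key]
  rcases h1 : φ e with _ | d
  · simp
  · simp only [Option.map_some, Option.some.injEq]
    constructor
    · rintro rfl; simp
    · rintro rfl; simp

lemma sw_out [DecidableEq C] {p r : E → N} {φ : E → Option C} {α β : C} {D : Set N} (hD : Clo p r φ α β D)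
    {x : N} {e : E} (hx : Inc p r x e) (hxD : x ∉ D) :
    sw p φ α β D e = φ e := by
  classical
  unfold sw
  split_ifs with h
  · have : ¬ (φ e = some α ∨ φ e = some β) := by
      intro h'
      have := hD e h'
      rcases hx with rfl | rfl <;> tauto
    rcases h1 : φ e with _ | d
    · rfl
    · simp only [h1, Option.some.injEq] at this
      push Not at this
      simp [Equiv.swap_apply_of_ne_of_ne this.1 this.2]
  · rfl

lemma sw_none [DecidableEq C] {p : E → N} {φ : E → Option C} {α β : C} {D : Set N} {e : E} :
    sw p φ α β D e = none ↔ φ e = none := by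
  unfold sw; split_ifs <;> simp

lemma sw_other [DecidableEq C] {p : E → N} {φ : E → Option C} {α β : C} {D : Set N} {c : C} (h1 : c ≠ α)
    (h2 : c ≠ β) {e : E} : sw p φ α β D e = some c ↔ φ e = some c := by
  classical
  unfold sw; split_ifs
  · rcases h : φ e with _ | d
    · simp
    · simp only [Option.map_some, Option.some.injEq]
      rw [Equiv.swap_apply_eq_iff, Equiv.swap_apply_of_ne_of_ne h1 h2]
  · rfl

lemma sw_proper [DecidableEq C] {p r : E → N} {φ : E → Option C} (hφ : Proper p r φ) {α β : C} {D : Set N}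
    (hD : Clo p r φ α β D) : Proper p r (sw p φ α β D) := by
  intro e e' x hx hx' h hn
  obtain ⟨c, hc⟩ := Option.ne_none_iff_exists'.1 hn
  rw [hc] at h
  by_cases hxD : x ∈ D
  · have h1 := (sw_in hD hx hxD).1 hc
    have h2 := (sw_in hD hx' hxD).1 h.symm
    exact hφ e e' x hx hx' (by rw [h1, h2]) (by rw [h1]; simp)
  · rw [sw_out hD hx hxD] at hc
    rw [sw_out hD hx' hxD] at h
    exact hφ e e' x hx hx' (by rw [hc, h]) (by rw [hc]; simp)

lemma sw_miss_in [DecidableEq C] {p r : E → N} {φ : E → Option C} {α β : C} {D : Set N}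
    (hD : Clo p r φ α β D) {x : N} (hxD : x ∈ D) {c : C} :
    Miss p r (sw p φ α β D) x c ↔ Miss p r φ x (Equiv.swap α β c) := by
  unfold Miss
  refine forall_congr' fun e => forall_congr' fun he => ?_
  exact not_congr (sw_in hD he hxD)

lemma sw_miss_out [DecidableEq C] {p r : E → N} {φ : E → Option C} {α β : C} {D : Set N}
    (hD : Clo p r φ α β D) {x : N} (hxD : x ∉ D) {c : C} :
    Miss p r (sw p φ α β D) x c ↔ Miss p r φ x c := by
  unfold Miss
  refine forall_congr' fun e => forall_congr' fun he => ?_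
  rw [sw_out hD he hxD]

/-- closedness from involutions -/
lemma clo_of_sig {p r : E → N} {φ : E → Option C} (hφ : Proper p r φ) {α β : C} {D : Set N}
    (h1 : ∀ y ∈ D, sig p r φ α y ∈ D) (h2 : ∀ y ∈ D, sig p r φ β y ∈ D) : Clo p r φ α β D := by
  have key : ∀ e x, Inc p r x e → (φ e = some α ∨ φ e = some β) → x ∈ D → oth p r e x ∈ D := by
    intro e x hx h hxD
    rcases h with h | h
    · rw [← sig_eq hφ hx h]; exact h1 x hxD
    · rw [← sig_eq hφ hx h]; exact h2 x hxD
  intro e he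
  constructor
  · intro h
    have := key e (p e) (Or.inl rfl) he h
    simpa [oth] using this
  · intro h
    have := key e (r e) (Or.inr rfl) he h
    unfold oth at this
    split_ifs at this with h'
    · rwa [h']
    · exact this

/-- Rainbow Tashkinov trees -/
inductive Tr [DecidableEq N] [DecidableEq C] (p r : E → N) (φ : E → Option C) (e₀ : E) :
    Finset N → Finset C → Prop
  | base : φ e₀ = none → Tr p r φ e₀ {p e₀, r e₀} ∅
  | step (T : Finset N) (U : Finset C) (e : E) (c : C) (u v w : N) : Tr p r φ e₀ T U →
      φ e = some c → c ∉ U → v ∈ T → Miss p r φ v c → u ∈ T → w ∉ T → Inc p r u e → Inc p r w e →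
      Tr p r φ e₀ (insert w T) (insert c U)

lemma Tr.congr [DecidableEq N] [DecidableEq C] {p r : E → N} {φ ψ : E → Option C} {e₀ : E}
    {T : Finset N} {U : Finset C} (h : Tr p r φ e₀ T U) (h0 : ψ e₀ = none)
    (hc : ∀ c ∈ U, ∀ e, φ e = some c ↔ ψ e = some c) : Tr p r ψ e₀ T U := by
  induction h with
  | base _ => exact Tr.base h0
  | step T U e c u v w hT he hcU hv hm hu hw hue hwe ih =>
    refine Tr.step T U e c u v w (ih fun c hc' => hc c (Finset.mem_insert_of_mem hc'))
      ((hc c (Finset.mem_insert_self _ _) e).1 he) hcU hv ?_ hu hw hue hwe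
    intro e' he' h
    exact hm e' he' ((hc c (Finset.mem_insert_self _ _) e').2 h)

lemma Tr.card [DecidableEq N] [DecidableEq C] {p r : E → N} (hpr : ∀ e, p e ≠ r e)
    {φ : E → Option C} {e₀ : E}
    {T : Finset N} {U : Finset C} (h : Tr p r φ e₀ T U) : T.card = U.card + 2 := by
  induction h with
  | base _ => simp [Finset.card_pair (hpr e₀)]
  | step T U e c u v w hT he hcU hv hm hu hw hue hwe ih =>
    rw [Finset.card_insert_of_notMem hw, Finset.card_insert_of_notMem hcU, ih]

lemma Tr.ends [DecidableEq N] [DecidableEq C] {p r : E → N}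
    {φ : E → Option C} {e₀ : E}
    {T : Finset N} {U : Finset C} (h : Tr p r φ e₀ T U) : p e₀ ∈ T ∧ r e₀ ∈ T ∧ φ e₀ = none := by
  induction h with
  | base _ => simpa
  | step T U e c u v w hT he hcU hv hm hu hw hue hwe ih =>
    simp [ih]

/-- elementarity -/
lemma elementary [DecidableEq N] [DecidableEq C] [Finite N] [DecidableEq E] {p r : E → N}
    (hpr : ∀ e, p e ≠ r e) (S : Set E) (e₀ : E)
    (hno : ¬ ∃ ψ : E → Option C, Proper p r ψ ∧ ∀ e, ψ e = none ↔ (e ∈ S ∧ e ≠ e₀))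
    (s : ℕ)
    (hs : ∀ φ : E → Option C, Proper p r φ → ∀ x, ∀ U : Finset C, U.card < s →
      ∃ c ∉ U, Miss p r φ x c)
    (T : Finset N) (U : Finset C) (hU : U.card < s) (φ : E → Option C) (hφ : Proper p r φ)
    (hS : ∀ e, φ e = none ↔ e ∈ S) (h : Tr p r φ e₀ T U) :
    ∀ x ∈ T, ∀ y ∈ T, x ≠ y → ∀ c ∉ U, ¬ (Miss p r φ x c ∧ Miss p r φ y c) := by
  -- recolouring one edge
  have hupd : ∀ (φ : E → Option C) (e : E) (α : C) (u w : N), Proper p r φ → u ≠ w →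
      Inc p r u e → Inc p r w e →
      Miss p r φ u α → Miss p r φ w α → Proper p r (Function.update φ e (some α)) := by
    intro φ e α u w hφ huw hu hw hmu hmw
    have hm : ∀ e' x, Inc p r x e → Inc p r x e' → φ e' ≠ some α := by
      intro e' x hx hx'
      by_cases hxu : x = u
      · subst hxu; exact hmu e' hx'
      · have h1 := inc_oth hu hx (Ne.symm hxu)
        have h2 := inc_oth hu hw huw
        rw [h1, ← h2] at hx'
        exact hmw e' hx'
    intro e1 e2 x h1 h2 he hn
    by_cases h1e : e1 = e <;> by_cases h2e : e2 = e
    · rw [h1e, h2e]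
    · subst h1e
      rw [Function.update_self, Function.update_of_ne h2e] at he
      exact absurd he.symm (hm e2 x h1 h2)
    · subst h2e
      rw [Function.update_self, Function.update_of_ne h1e] at he
      exact absurd he (hm e1 x h2 h1)
    · rw [Function.update_of_ne h1e] at he hn
      rw [Function.update_of_ne h2e] at he
      exact hφ e1 e2 x h1 h2 he hn
  generalize hk : U.card = k
  induction k generalizing T U φ with
  | zero =>
    rw [Finset.card_eq_zero] at hk
    subst hk
    have h0 := h.ends
    have hT : T = {p e₀, r e₀} := by
      have := h.card hpr
      refine (Finset.eq_of_subset_of_card_le ?_ ?_).symm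
      · intro x; simp only [Finset.mem_insert, Finset.mem_singleton]
        rintro (rfl | rfl)
        · exact h0.1
        · exact h0.2.1
      · rw [this, Finset.card_pair (hpr e₀)]; simp
    subst hT
    intro x hx y hy hxy c _ ⟨hmx, hmy⟩
    have hx' : Inc p r x e₀ := by
      simp only [Finset.mem_insert, Finset.mem_singleton] at hx; unfold Inc; tauto
    have hy' : Inc p r y e₀ := by
      simp only [Finset.mem_insert, Finset.mem_singleton] at hy; unfold Inc; tauto
    refine hno ⟨_, hupd φ e₀ c x y hφ hxy hx' hy' hmx hmy, ?_⟩
    intro e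
    by_cases he : e = e₀
    · subst he; simp
    · rw [Function.update_of_ne he, hS e]; simp [he]
  | succ k ih =>
    cases h with
    | base h0 => simp at hk
    | step T U e c u v w hT he hcU hv hm hu hw hue hwe =>
    have hkU : U.card = k := by
      rw [Finset.card_insert_of_notMem hcU] at hk; omega
    have hUs : U.card < s := by omega
    have huw : u ≠ w := by rintro rfl; exact hw hu
    have huv : u ≠ v := by rintro rfl; exact hm e hue he
    have h0 := hT.ends
    -- final step
    have hfin : ∀ φ₁ : E → Option C, Proper p r φ₁ → (∀ e, φ₁ e = none ↔ e ∈ S) →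
        Tr p r φ₁ e₀ T U → φ₁ e = some c → Miss p r φ₁ v c → ∀ α, α ∉ insert c U →
        Miss p r φ₁ u α → Miss p r φ₁ w α → False := by
      intro φ₁ h1 hS1 hT1 he1 hm1 α hα hmu hmw
      have hαc : α ≠ c := by rintro rfl; simp at hα
      have hαU : α ∉ U := by intro h; exact hα (Finset.mem_insert_of_mem h)
      have he0 : e₀ ≠ e := by
        rintro rfl; rw [hT1.ends.2.2] at he1; simp at he1
      refine ih T U hUs (Function.update φ₁ e (some α)) (hupd φ₁ e α u w h1 huw hue hwe hmu hmw)
        ?_ ?_ hkU u hu v hv huv c hcU ⟨?_, ?_⟩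
      · intro e'
        by_cases he' : e' = e
        · subst he'
          have := hS1 e'
          rw [he1] at this
          simp at this
          simp [this]
        · rw [Function.update_of_ne he', hS1]
      · refine hT1.congr ?_ ?_
        · rw [Function.update_of_ne he0]; exact hT1.ends.2.2
        · intro d hd e'
          by_cases he' : e' = e
          · subst he'
            rw [Function.update_self, he1]
            have h2 : c ≠ d := by rintro rfl; exact hcU hd
            have h3 : α ≠ d := by rintro rfl; exact hαU hd
            simp [h2, h3]
          · rw [Function.update_of_ne he']
      · intro e' he' h
        by_cases hee : e' = e
        · subst hee
          rw [Function.update_self] at h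
          exact hαc (Option.some.inj h)
        · rw [Function.update_of_ne hee] at h
          exact hee (h1 e' e u he' hue (by rw [h, he1]) (by rw [h]; simp))
      · intro e' he' h
        by_cases hee : e' = e
        · subst hee
          rw [Function.update_self] at h
          exact hαc (Option.some.inj h)
        · rw [Function.update_of_ne hee] at h
          exact hm1 e' he' h
    -- main step
    have hmain : ∀ y ∈ T, ∀ α, α ∉ insert c U → Miss p r φ w α → Miss p r φ y α → False := by
      intro y hy α hα hwα hyα
      have hαU : α ∉ U := by intro h; exact hα (Finset.mem_insert_of_mem h)
      have hαc : α ≠ c := by rintro rfl; simp at hα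
      by_cases hyu : y = u
      · subst hyu
        exact hfin φ hφ hS hT he hm α hα hyα hwα
      obtain ⟨β, hβ, huβ⟩ := hs φ hφ u (insert c U) hU
      have hβU : β ∉ U := by intro h; exact hβ (Finset.mem_insert_of_mem h)
      have hβc : β ≠ c := by rintro rfl; simp at hβ
      obtain ⟨D, huD, hD1, hD2, -, hD3⟩ := invol_component (sig p r φ α) (sig p r φ β)
        (sig_sig hφ α) (sig_sig hφ β) u (sig_miss huβ)
      have hyw : y ≠ w := by rintro rfl; exact hw hy
      have hcl := clo_of_sig hφ hD1 hD2
      have hTr : Tr p r (sw p φ α β D) e₀ T U := by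
        refine hT.congr (sw_none.2 h0.2.2) ?_
        intro d hd e'
        exact (sw_other (by rintro rfl; exact hαU hd) (by rintro rfl; exact hβU hd)).symm
      have hSS : ∀ e, sw p φ α β D e = none ↔ e ∈ S := fun e => sw_none.trans (hS e)
      have huα : Miss p r (sw p φ α β D) u α := by
        rw [sw_miss_in hcl huD]; simpa using huβ
      by_cases hyD : y ∈ D
      · have hwD : w ∉ D := by
          intro hwD
          exact hyw (hD3 y hyD w hwD (Or.inl (sig_miss hyα)) (Or.inl (sig_miss hwα)) hyu huw.symm)
        refine hfin (sw p φ α β D) (sw_proper hφ hcl) hSS hTr ((sw_other hαc.symm hβc.symm).2 he) ?_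
          α hα huα ?_
        · intro e' he' h
          exact hm e' he' ((sw_other hαc.symm hβc.symm).1 h)
        · rw [sw_miss_out hcl hwD]; exact hwα
      · refine ih T U hUs (sw p φ α β D) (sw_proper hφ hcl) hSS hTr hkU y hy u hu hyu α hαU
          ⟨?_, huα⟩
        rw [sw_miss_out hcl hyD]; exact hyα
    intro x hx y hy hxy α hα ⟨hmx, hmy⟩
    rcases Finset.mem_insert.1 hx with hx1 | hx1
    · rcases Finset.mem_insert.1 hy with hy1 | hy1
      · exact hxy (hx1.trans hy1.symm)
      · subst hx1; exact hmain y hy1 α hα hmx hmy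
    · rcases Finset.mem_insert.1 hy with hy1 | hy1
      · subst hy1; exact hmain x hx1 α hα hmy hmx
      · exact ih T U hUs φ hφ hS hT hkU x hx1 y hy1 hxy α
          (fun h => hα (Finset.mem_insert_of_mem h)) ⟨hmx, hmy⟩

end LGC

namespace LGC

lemma even_of_invol {X : Type*} [DecidableEq X] (s : Finset X) (g : X → X) (h1 : ∀ x ∈ s, g x ∈ s)
    (h2 : ∀ x ∈ s, g x ≠ x) (h3 : ∀ x ∈ s, g (g x) = x) : Even s.card := by
  have : ∑ x ∈ s, (1 : ZMod 2) = 0 := by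
    refine Finset.sum_involution (fun x _ => g x) ?_ ?_ ?_ ?_
    · intro a ha; decide
    · intro a ha _; exact h2 a ha
    · intro a ha; exact h1 a ha
    · intro a ha; exact h3 a ha
  simp only [Finset.sum_const, nsmul_eq_mul, mul_one] at this
  rw [ZMod.natCast_eq_zero_iff] at this
  exact even_iff_two_dvd.2 this

lemma exit_lemma {X : Type*} [Fintype X] [DecidableEq X] (σ τ : X → X) (hσ : ∀ x, σ (σ x) = x)
    (hτ : ∀ x, τ (τ x) = x) (T : Finset X)
    (hodd : Odd (Finset.univ.filter (fun z => z ∉ T ∧ σ z ∈ T)).card) :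
    ∃ z, z ∉ T ∧ σ z ∈ T ∧ ∃ D : Set X, z ∈ D ∧ (∀ y ∈ D, y ∉ T) ∧ (∀ y ∈ D, σ y ∉ T → σ y ∈ D) ∧
      (∀ y ∈ D, τ y ∉ T → τ y ∈ D) ∧ ∀ y ∈ D, σ y ∈ T → y = z := by
  set B := Finset.univ.filter (fun z => z ∉ T ∧ σ z ∈ T) with hB
  have hBm : ∀ z, z ∈ B ↔ z ∉ T ∧ σ z ∈ T := by intro z; simp [hB]
  -- restricted involutions
  set a : X → X := fun z => if z ∉ T ∧ τ z ∉ T then τ z else z with ha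
  set b : X → X := fun z => if z ∉ T ∧ σ z ∉ T then σ z else z with hb
  have haa : ∀ x, a (a x) = x := by
    intro x
    by_cases h : x ∉ T ∧ τ x ∉ T
    · have h1 : a x = τ x := if_pos h
      have h2 : a (τ x) = τ (τ x) := if_pos ⟨h.2, by rw [hτ]; exact h.1⟩
      rw [h1, h2, hτ]
    · have h1 : a x = x := if_neg h
      rw [h1, h1]
  have hbb : ∀ x, b (b x) = x := by
    intro x
    by_cases h : x ∉ T ∧ σ x ∉ T
    · have h1 : b x = σ x := if_pos h
      have h2 : b (σ x) = σ (σ x) := if_pos ⟨h.2, by rw [hσ]; exact h.1⟩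
      rw [h1, h2, hσ]
    · have h1 : b x = x := if_neg h
      rw [h1, h1]
  have hbB : ∀ z ∈ B, b z = z := by
    intro z hz
    have := (hBm z).1 hz
    exact if_neg (by tauto)
  have hcomp := fun z (hz : z ∈ B) => invol_component a b haa hbb z (hbB z hz)
  choose! D hD1 hD2 hD3 hD4 hD5 using hcomp
  have hDT : ∀ z ∈ B, ∀ y ∈ D z, y ∉ T := by
    intro z hz y hy
    have := hD4 z hz {y | y ∉ T} ((hBm z).1 hz).1 ?_ ?_ hy
    · exact this
    · intro y hy
      simp only [Set.mem_ofPred_eq, ha] at hy ⊢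
      split_ifs with h
      · exact h.2
      · exact hy
    · intro y hy
      simp only [Set.mem_ofPred_eq, hb] at hy ⊢
      split_ifs with h
      · exact h.2
      · exact hy
  have hsymm : ∀ z ∈ B, ∀ z' ∈ B, z' ∈ D z → z ∈ D z' := by
    intro z hz z' hz' h
    by_contra hcon
    refine hD4 z hz (D z')ᶜ hcon ?_ ?_ h (hD1 z' hz')
    · intro y hy hy'
      apply hy
      rw [← haa y]
      exact hD2 z' hz' _ hy'
    · intro y hy hy'
      apply hy
      rw [← hbb y]
      exact hD3 z' hz' _ hy'
  by_contra hcon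
  have hpart : ∀ z ∈ B, ∃ z', z' ∈ B ∧ z' ∈ D z ∧ z' ≠ z := by
    intro z hz
    by_contra hno
    push Not at hno
    apply hcon
    refine ⟨z, ((hBm z).1 hz).1, ((hBm z).1 hz).2, D z, hD1 z hz, hDT z hz, ?_, ?_, ?_⟩
    · intro y hy h
      have := hD3 z hz y hy
      have h1 : b y = σ y := if_pos ⟨hDT z hz y hy, h⟩
      rwa [h1] at this
    · intro y hy h
      have := hD2 z hz y hy
      have h1 : a y = τ y := if_pos ⟨hDT z hz y hy, h⟩
      rwa [h1] at this
    · intro y hy h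
      exact hno y ((hBm y).2 ⟨hDT z hz y hy, h⟩) hy
  choose! g hg1 hg2 hg3 using hpart
  have : Even B.card := by
    refine even_of_invol B g hg1 hg3 ?_
    intro z hz
    have h1 := hg1 z hz
    have h2 := hsymm z hz (g z) h1 (hg2 z hz)
    exact hD5 (g z) h1 _ (hg2 _ h1) _ h2 (Or.inr (hbB _ (hg1 _ h1))) (Or.inr (hbB _ hz))
      (hg3 _ h1) (hg3 z hz).symm
  exact (Nat.not_even_iff_odd.2 hodd) this

lemma extend {E N C : Type*} [DecidableEq N] [DecidableEq C] [Fintype N] [Fintype C]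
    [DecidableEq E] [Fintype E] {p r : E → N}
    (hpr : ∀ e, p e ≠ r e) (S : Set E) (e₀ : E)
    (hno : ¬ ∃ ψ : E → Option C, Proper p r ψ ∧ ∀ e, ψ e = none ↔ (e ∈ S ∧ e ≠ e₀))
    (s : ℕ)
    (hs : ∀ φ : E → Option C, Proper p r φ → ∀ x, ∀ U : Finset C, U.card < s →
      ∃ c ∉ U, Miss p r φ x c)
    (hden : ∀ T : Finset N, Odd T.card →
      2 * (Finset.univ.filter (fun e => p e ∈ T ∧ r e ∈ T)).card + (s - 1) * (T.card - 1)
        ≤ Fintype.card C * (T.card - 1))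
    (T : Finset N) (U : Finset C) (hU : U.card < s) (φ : E → Option C) (hφ : Proper p r φ)
    (hS : ∀ e, φ e = none ↔ e ∈ S) (h : Tr p r φ e₀ T U) :
    ∃ (T' : Finset N) (U' : Finset C) (φ' : E → Option C), Proper p r φ' ∧
      (∀ e, φ' e = none ↔ e ∈ S) ∧ Tr p r φ' e₀ T' U' ∧ T'.card = T.card + 1 := by
  classical
  by_contra hcon
  have hel := elementary hpr S e₀ hno s hs T U hU
  have hends := h.ends
  have hcard := h.card hpr
  -- no extension
  have hne : ∀ ψ : E → Option C, Proper p r ψ → (∀ e, ψ e = none ↔ e ∈ S) → Tr p r ψ e₀ T U →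
      ∀ c ∉ U, ∀ v ∈ T, Miss p r ψ v c → ∀ e, ψ e = some c → ∀ u ∈ T, ∀ w, Inc p r u e →
      Inc p r w e → w ∈ T := by
    intro ψ hψ hSψ hT c hc v hv hm e he u hu w hue hwe
    by_contra hw
    exact hcon ⟨_, _, ψ, hψ, hSψ, Tr.step T U e c u v w hT he hc hv hm hu hw hue hwe,
      Finset.card_insert_of_notMem hw⟩
  have hsigT : ∀ c ∉ U, ∀ v ∈ T, Miss p r φ v c → ∀ x ∈ T, sig p r φ c x ∈ T := by
    intro c hc v hv hm x hx
    by_cases hmx : Miss p r φ x c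
    · rw [sig_miss hmx]; exact hx
    · obtain ⟨e, he, hec⟩ := not_miss.1 hmx
      rw [sig_eq hφ he hec]
      exact hne φ hφ hS h c hc v hv hm e hec x hx _ he (oth_inc he)
  set I : C → Finset N := fun c => T.filter (fun x => sig p r φ c x ∈ T ∧ sig p r φ c x ≠ x) with hI
  have hIeven : ∀ c, Even (I c).card := by
    intro c
    refine even_of_invol (I c) (sig p r φ c) ?_ ?_ ?_
    · intro x hx
      simp only [hI, Finset.mem_filter] at hx ⊢
      rw [sig_sig hφ]
      exact ⟨hx.2.1, hx.1, hx.2.2.symm⟩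
    · intro x hx
      simp only [hI, Finset.mem_filter] at hx
      exact hx.2.2
    · intro x _; exact sig_sig hφ c x
  have hImiss : ∀ c ∉ U, ∀ v ∈ T, Miss p r φ v c → I c = T.erase v := by
    intro c hc v hv hm
    ext x
    simp only [hI, Finset.mem_filter, Finset.mem_erase]
    constructor
    · rintro ⟨hx, h1, h2⟩
      refine ⟨?_, hx⟩
      rintro rfl
      exact h2 (sig_miss hm)
    · rintro ⟨hxv, hx⟩
      refine ⟨hx, hsigT c hc v hv hm x hx, ?_⟩
      apply sig_ne hpr hφ
      intro hmx
      exact hel φ hφ hS h x hx v hv hxv c hc ⟨hmx, hm⟩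
  obtain ⟨γ, hγU, hvγ⟩ := hs φ hφ (p e₀) U hU
  set v₀ := p e₀ with hv₀
  have hv₀T : v₀ ∈ T := hends.1
  have hTodd : Odd T.card := by
    have h1 := hIeven γ
    rw [hImiss γ hγU v₀ hv₀T hvγ, Finset.card_erase_of_mem hv₀T] at h1
    have : T.card = (T.card - 1) + 1 := by omega
    rw [this]
    exact h1.add_one
  -- the key bound
  have hIbound : ∀ c ∉ U, T.card - 1 ≤ (I c).card := by
    intro α hα
    by_cases hmiss : ∃ v ∈ T, Miss p r φ v α
    · obtain ⟨v, hv, hm⟩ := hmiss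
      rw [hImiss α hα v hv hm, Finset.card_erase_of_mem hv]
    push Not at hmiss
    have hαγ : γ ≠ α := by
      rintro rfl; exact hmiss v₀ hv₀T hvγ
    set σ := sig p r φ α with hσ
    set B := Finset.univ.filter (fun z => z ∉ T ∧ σ z ∈ T) with hB
    have hBcard : T.card = (I α).card + B.card := by
      have h1 : (T.filter (fun x => ¬ (σ x ∈ T ∧ σ x ≠ x))).card = B.card := by
        refine Finset.card_bij (fun x _ => σ x) ?_ ?_ ?_
        · intro x hx
          simp only [Finset.mem_filter] at hx
          have := sig_ne hpr hφ (hmiss x hx.1)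
          simp only [hB, Finset.mem_filter, Finset.mem_univ, true_and]
          rw [hσ, sig_sig hφ]
          exact ⟨fun h => hx.2 ⟨h, this⟩, hx.1⟩
        · intro x _ y _ hxy
          rw [← sig_sig hφ α x, ← sig_sig hφ α y]
          exact congrArg _ hxy
        · intro z hz
          simp only [hB, Finset.mem_filter, Finset.mem_univ, true_and] at hz
          refine ⟨σ z, ?_, sig_sig hφ α z⟩
          simp only [Finset.mem_filter]
          rw [hσ, sig_sig hφ]
          exact ⟨hz.2, fun h => hz.1 h.1⟩
      rw [← h1]
      exact (Finset.card_filter_add_card_filter_not _).symm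
    have hBodd : Odd B.card := by
      have h1 := hIeven α
      rw [hBcard] at hTodd
      rw [Nat.odd_iff] at hTodd ⊢
      rw [Nat.even_iff] at h1
      omega
    by_contra hlt
    have hB2 : 1 < B.card := by omega
    obtain ⟨z, hzT, hzσ, D, hzD, hDT, hDσ, hDτ, hDz⟩ := exit_lemma σ (sig p r φ γ) (sig_sig hφ α)
      (sig_sig hφ γ) T hBodd
    obtain ⟨z2, hz2B, hz2z⟩ := Finset.exists_mem_ne hB2 z
    have hz2 : z2 ∉ T ∧ σ z2 ∈ T := by simpa [hB] using hz2B
    set u := σ z with hu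
    -- recolour inside T so that u misses γ
    have hψ : ∃ ψ : E → Option C, Proper p r ψ ∧ (∀ e, ψ e = none ↔ e ∈ S) ∧ Tr p r ψ e₀ T U ∧
        Miss p r ψ u γ ∧ (∀ e, ψ e = some α ↔ φ e = some α) ∧
        (∀ e x, x ∉ T → Inc p r x e → ψ e = φ e) := by
      by_cases huv : u = v₀
      · exact ⟨φ, hφ, hS, h, by rw [huv]; exact hvγ, fun _ => Iff.rfl, fun _ _ _ _ => rfl⟩
      obtain ⟨γ', hγ'U, huγ'⟩ := hs φ hφ u U hU
      have hcl : Clo p r φ γ γ' (T : Set N) :=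
        clo_of_sig hφ (hsigT γ hγU v₀ hv₀T hvγ) (hsigT γ' hγ'U u hzσ huγ')
      have hαγ' : γ' ≠ α := by
        rintro rfl; exact hmiss u hzσ huγ'
      refine ⟨sw p φ γ γ' T, sw_proper hφ hcl, fun e => sw_none.trans (hS e),
        h.congr (sw_none.2 hends.2.2) ?_, ?_, fun e => sw_other hαγ.symm hαγ'.symm, ?_⟩
      · intro d hd e'
        exact (sw_other (by rintro rfl; exact hγU hd) (by rintro rfl; exact hγ'U hd)).symm
      · rw [sw_miss_in hcl (Finset.mem_coe.2 hzσ)]; simpa using huγ'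
      · intro e x hx hxe
        exact sw_out hcl hxe (by simpa using hx)
    obtain ⟨ψ, hψ, hSψ, hTψ, huγ, hψα, hψout⟩ := hψ
    have hσu : σ u = z := sig_sig hφ α z
    -- the final exchange
    have hkey : ∀ e x, Inc p r x e → (ψ e = some α ∨ ψ e = some γ) → (x ∈ D ∨ x = u) →
        (oth p r e x ∈ D ∨ oth p r e x = u) := by
      rintro e x hxe hc (hx | rfl)
      · rcases hc with hc | hc
        · have h1 := (hψα e).1 hc
          have h2 : σ x = oth p r e x := sig_eq hφ hxe h1
          by_cases h3 : σ x ∈ T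
          · right
            rw [← h2, hDz x hx h3]
          · left
            rw [← h2]; exact hDσ x hx h3
        · have h1 : φ e = some γ := by rw [← hψout e x (hDT x hx) hxe]; exact hc
          have h2 : sig p r φ γ x = oth p r e x := sig_eq hφ hxe h1
          have h3 : sig p r φ γ x ∉ T := by
            intro h3
            have := hsigT γ hγU v₀ hv₀T hvγ _ h3
            rw [sig_sig hφ] at this
            exact hDT x hx this
          left
          rw [← h2]; exact hDτ x hx h3
      · rcases hc with hc | hc
        · have h1 := (hψα e).1 hc
          have h2 : σ u = oth p r e u := sig_eq hφ hxe h1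
          left
          rw [← h2, hσu]; exact hzD
        · exact absurd hc (huγ e hxe)
    have hcl : Clo p r ψ α γ {x | x ∈ D ∨ x = u}ᶜ := by
      intro e he
      simp only [Set.mem_compl_iff, Set.mem_ofPred_eq]
      apply not_congr
      constructor
      · intro h
        have := hkey e (p e) (Or.inl rfl) he h
        simpa [oth] using this
      · intro h
        have := hkey e (r e) (Or.inr rfl) he h
        simpa [oth, hpr e] using this
    have hz2D : z2 ∈ {x | x ∈ D ∨ x = u}ᶜ := by
      rintro (h1 | h1)
      · exact hz2z (hDz z2 h1 hz2.2)
      · rw [h1] at hz2; exact hz2.1 hzσ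
    have hnm : ¬ Miss p r φ z2 α := by
      intro hm
      have h1 : σ z2 = z2 := sig_miss hm
      have := hz2.2
      rw [h1] at this
      exact hz2.1 this
    obtain ⟨e, hze, hec⟩ := not_miss.1 hnm
    have h2 : σ z2 = oth p r e z2 := sig_eq hφ hze hec
    refine hz2.1 (hne (sw p ψ α γ {x | x ∈ D ∨ x = u}ᶜ) (sw_proper hψ hcl)
      (fun e => sw_none.trans (hSψ e)) (hTψ.congr (sw_none.2 hTψ.ends.2.2) ?_) γ hγU u hzσ ?_ e ?_
      (σ z2) hz2.2 z2 (by rw [h2]; exact oth_inc hze) hze)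
    · intro d hd e'
      exact (sw_other (by rintro rfl; exact hα hd) (by rintro rfl; exact hγU hd)).symm
    · rw [sw_miss_out hcl (by simp)]; exact huγ
    · rw [sw_in hcl hze hz2D]
      simpa using (hψα e).2 hec
  -- counting
  have hcount : ∑ c, (I c).card + 2 ≤ 2 * (Finset.univ.filter (fun e => p e ∈ T ∧ r e ∈ T)).card := by
    set F := Finset.univ.filter (fun e => p e ∈ T ∧ r e ∈ T) with hF
    have h1 : ∀ c, (I c).card ≤ 2 * (F.filter (fun e => φ e = some c)).card := by
      intro c
      have hsub : I c ⊆ (F.filter (fun e => φ e = some c)).biUnion (fun e => {p e, r e}) := by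
        intro x hx
        simp only [hI, Finset.mem_filter] at hx
        have hnm : ¬ Miss p r φ x c := fun hm => hx.2.2 (sig_miss hm)
        obtain ⟨e, he, hec⟩ := not_miss.1 hnm
        have h2 := hx.2.1
        rw [sig_eq hφ he hec] at h2
        simp only [Finset.mem_biUnion, Finset.mem_filter, hF, Finset.mem_univ, true_and,
          Finset.mem_insert, Finset.mem_singleton]
        refine ⟨e, ⟨?_, hec⟩, ?_⟩
        · have := hpr e
          unfold oth at h2
          rcases he with rfl | rfl
          · simp at h2; exact ⟨hx.1, h2⟩
          · simp [this] at h2; exact ⟨h2, hx.1⟩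
        · rcases he with h | h <;> simp [h]
      calc (I c).card ≤ _ := Finset.card_le_card hsub
        _ ≤ ∑ e ∈ F.filter (fun e => φ e = some c), ({p e, r e} : Finset N).card :=
          Finset.card_biUnion_le
        _ ≤ ∑ e ∈ F.filter (fun e => φ e = some c), 2 := Finset.sum_le_sum fun e _ =>
          Finset.card_le_two
        _ = _ := by simp [mul_comm]
    have h2 : ∑ c, (F.filter (fun e => φ e = some c)).card ≤ (F.erase e₀).card := by
      rw [← Finset.card_biUnion]
      · apply Finset.card_le_card
        intro e he
        simp only [Finset.mem_biUnion, Finset.mem_filter, Finset.mem_univ, true_and] at he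
        obtain ⟨c, heF, hec⟩ := he
        rw [Finset.mem_erase]
        refine ⟨?_, heF⟩
        rintro rfl
        rw [hends.2.2] at hec; simp at hec
      · intro c _ d _ hcd
        rw [Function.onFun, Finset.disjoint_left]
        intro e he he'
        simp only [Finset.mem_filter] at he he'
        rw [he.2] at he'
        exact hcd (Option.some.inj he'.2)
    have h0F : e₀ ∈ F := by simp [hF, hends.1, hends.2.1, ← hv₀]
    have h3 := Finset.card_erase_add_one h0F
    have h4 : ∑ c, (I c).card ≤ 2 * ∑ c, (F.filter (fun e => φ e = some c)).card := by
      rw [Finset.mul_sum]; exact Finset.sum_le_sum fun c _ => h1 c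
    omega
  have hlow : (Fintype.card C - U.card) * (T.card - 1) ≤ ∑ c, (I c).card := by
    calc (Fintype.card C - U.card) * (T.card - 1) = ∑ c ∈ Uᶜ, (T.card - 1) := by
          rw [Finset.sum_const, Finset.card_compl, smul_eq_mul]
      _ ≤ ∑ c ∈ Uᶜ, (I c).card := Finset.sum_le_sum fun c hc => hIbound c (by simpa using hc)
      _ ≤ _ := Finset.sum_le_sum_of_subset (Finset.subset_univ _)
  have hd := hden T hTodd
  have hUC : U.card ≤ Fintype.card C := Finset.card_le_univ U
  obtain ⟨d, hdq⟩ := Nat.exists_eq_add_of_le hUC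
  have h5 : U.card ≤ s - 1 := by omega
  have h6 : U.card * (T.card - 1) ≤ (s - 1) * (T.card - 1) := Nat.mul_le_mul_right _ h5
  rw [hdq, Nat.add_sub_cancel_left] at hlow
  rw [hdq, add_mul] at hd
  omega

end LGC

namespace LGC

universe u

lemma core {E N : Type*} [DecidableEq N] [Fintype N] [DecidableEq E] [Fintype E] (p r : E → N)
    (hpr : ∀ e, p e ≠ r e) (q s M : ℕ)
    (hdeg : ∀ x, (Finset.univ.filter (fun e => p e = x ∨ r e = x)).card + s ≤ q)
    (hden : ∀ T : Finset N, Odd T.card →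
      2 * (Finset.univ.filter (fun e => p e ∈ T ∧ r e ∈ T)).card + (s - 1) * (T.card - 1)
        ≤ q * (T.card - 1))
    (hM2 : 2 ≤ M) (hMs : M ≤ s + 1) (hM : q + 2 + M ^ 2 < M * (s + 3)) :
    ∃ φ : E → Fin q, ∀ e e' x, e ≠ e' → Inc p r x e → Inc p r x e' → φ e ≠ φ e' := by
  classical
  have hfree : ∀ φ : E → Option (Fin q), Proper p r φ → ∀ x, ∀ U : Finset (Fin q),
      s ≤ (Uᶜ.filter (fun c => Miss p r φ x c)).card + U.card := by
    intro φ hφ x U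
    have h1 : (Uᶜ.filter (fun c => ¬ Miss p r φ x c)).card ≤
        (Finset.univ.filter (fun e => p e = x ∨ r e = x)).card := by
      rw [← Finset.card_map Function.Embedding.some]
      refine (Finset.card_le_card ?_).trans (Finset.card_image_le (f := φ))
      intro o ho
      simp only [Finset.mem_map, Function.Embedding.some_apply] at ho
      obtain ⟨c, hc, rfl⟩ := ho
      obtain ⟨e, he, hec⟩ := not_miss.1 (Finset.mem_filter.1 hc).2
      exact Finset.mem_image.2 ⟨e, by simpa [Inc] using he, hec⟩
    have h2 := Finset.card_filter_add_card_filter_not (s := Uᶜ) (fun c => Miss p r φ x c)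
    have h3 : Uᶜ.card + U.card = q := by
      rw [Finset.card_compl_add_card, Fintype.card_fin]
    have := hdeg x
    omega
  have hs : ∀ φ : E → Option (Fin q), Proper p r φ → ∀ x, ∀ U : Finset (Fin q), U.card < s →
      ∃ c ∉ U, Miss p r φ x c := by
    intro φ hφ x U hU
    have := hfree φ hφ x U
    have hpos : 0 < (Uᶜ.filter (fun c => Miss p r φ x c)).card := by omega
    obtain ⟨c, hc⟩ := Finset.card_pos.1 hpos
    simp only [Finset.mem_filter, Finset.mem_compl] at hc
    exact ⟨c, hc⟩
  have main : ∀ A : Finset E, ∃ φ : E → Option (Fin q), Proper p r φ ∧ ∀ e, φ e = none ↔ e ∉ A := by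
    intro A
    induction A using Finset.induction_on with
    | empty => exact ⟨fun _ => none, fun e e' x _ _ _ h => absurd rfl h, by simp⟩
    | insert e₀ A he₀ ih =>
      by_contra hcon
      obtain ⟨φ, hφ, hφA⟩ := ih
      set S : Set E := {e | e ∉ A} with hS
      have hno : ¬ ∃ ψ : E → Option (Fin q), Proper p r ψ ∧ ∀ e, ψ e = none ↔ (e ∈ S ∧ e ≠ e₀) := by
        rintro ⟨ψ, hψ, h⟩
        refine hcon ⟨ψ, hψ, fun e => (h e).trans ?_⟩
        simp only [hS, Set.mem_ofPred_eq, Finset.mem_insert]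
        tauto
      have hgrow : ∀ m, 2 ≤ m → m ≤ M → ∃ (T : Finset N) (U : Finset (Fin q))
          (φ : E → Option (Fin q)), Proper p r φ ∧ (∀ e, φ e = none ↔ e ∈ S) ∧
          Tr p r φ e₀ T U ∧ T.card = m := by
        intro m hm
        induction m, hm using Nat.le_induction with
        | base =>
          intro _
          exact ⟨_, _, φ, hφ, hφA, Tr.base ((hφA e₀).2 he₀), Finset.card_pair (hpr e₀)⟩
        | succ m hm ihm =>
          intro hmM
          obtain ⟨T, U, φ, hφ, hφS, hT, hTm⟩ := ihm (by omega)
          have := hT.card hpr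
          obtain ⟨T', U', φ', h1, h2, h3, h4⟩ := extend hpr S e₀ hno s hs (by simpa using hden) T U
            (by omega) φ hφ hφS hT
          exact ⟨T', U', φ', h1, h2, h3, by omega⟩
      obtain ⟨T, U, φ, hφ, hφS, hT, hTm⟩ := hgrow M hM2 le_rfl
      have hcard := hT.card hpr
      have hU : U.card < s := by omega
      have hel := elementary hpr S e₀ hno s hs T U hU φ hφ hφS hT
      have hsum : ∑ v ∈ T, (Uᶜ.filter (fun c => Miss p r φ v c)).card ≤ Uᶜ.card := by
        rw [← Finset.card_biUnion]
        · apply Finset.card_le_card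
          intro c hc
          simp only [Finset.mem_biUnion, Finset.mem_filter] at hc
          obtain ⟨v, _, hc, _⟩ := hc
          exact hc
        · intro x hx y hy hxy
          rw [Function.onFun, Finset.disjoint_left]
          intro c hc hc'
          simp only [Finset.mem_filter, Finset.mem_compl] at hc hc'
          exact hel x hx y hy hxy c hc.1 ⟨hc.2, hc'.2⟩
      have hlow : T.card * (s - U.card) ≤ ∑ v ∈ T, (Uᶜ.filter (fun c => Miss p r φ v c)).card := by
        rw [← smul_eq_mul, ← Finset.sum_const]
        refine Finset.sum_le_sum fun v _ => ?_
        have := hfree φ hφ v U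
        omega
      have h3 : Uᶜ.card + U.card = q := by
        rw [Finset.card_compl_add_card, Fintype.card_fin]
      obtain ⟨k, hk⟩ := Nat.exists_eq_add_of_lt hU
      have hsk : s - U.card = k + 1 := by omega
      rw [hsk] at hlow
      have hMU : M = U.card + 2 := by omega
      rw [hMU, hk] at hM
      rw [hcard] at hlow
      nlinarith
  obtain ⟨φ, hφ, hA⟩ := main Finset.univ
  have hsome : ∀ e, ∃ c, φ e = some c := by
    intro e
    apply Option.ne_none_iff_exists'.1
    intro h
    exact (hA e).1 h (Finset.mem_univ _)
  choose g hg using hsome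
  refine ⟨g, fun e e' x hne h1 h2 h => hne (hφ e e' x h1 h2 (by rw [hg, hg, h]) (by rw [hg]; simp))⟩

lemma frac_nonempty {V : Type*} [Fintype V] [DecidableEq V] (G : SimpleGraph V) :
    {c : ℝ | ∃ w : Finset V → ℝ, IsFractionalColoring G w c}.Nonempty := by
  refine ⟨_, fun S => if S.card = 1 then 1 else 0, ?_, ?_, le_rfl, ?_⟩
  · intro S; dsimp only; split_ifs <;> norm_num
  · intro S hS u hu v hv
    have h1 : S.card = 1 := by
      by_contra h; simp [h] at hS
    obtain ⟨a, rfl⟩ := Finset.card_eq_one.1 h1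
    simp only [Finset.mem_singleton] at hu hv
    subst hu; subst hv
    exact G.loopless.irrefl _
  · intro v
    rw [Finset.sum_eq_single {v}]
    · simp
    · intro S hS hne
      rw [if_neg]
      intro h1
      obtain ⟨a, rfl⟩ := Finset.card_eq_one.1 h1
      simp only [Finset.mem_filter, Finset.mem_singleton, Finset.mem_univ, true_and] at hS
      subst hS; exact hne rfl
    · simp

lemma frac_bound {V : Type*} [Fintype V] [DecidableEq V] (G : SimpleGraph V) (F : Finset V) (k : ℕ)
    (hF : ∀ S : Finset V, (∀ u ∈ S, ∀ v ∈ S, ¬ G.Adj u v) → (F ∩ S).card ≤ k) :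
    (F.card : ℝ) ≤ k * fracChromatic G := by
  have key : ∀ c ∈ {c : ℝ | ∃ w : Finset V → ℝ, IsFractionalColoring G w c}, (F.card : ℝ) ≤ k * c := by
    rintro c ⟨w, h0, h1, h2, h3⟩
    calc (F.card : ℝ) = ∑ v ∈ F, ∑ S ∈ Finset.univ.filter (fun S : Finset V => v ∈ S), w S := by
          rw [Finset.sum_congr rfl fun v _ => h3 v]; simp
      _ = ∑ v ∈ F, ∑ S : Finset V, if v ∈ S then w S else 0 := by
          simp_rw [Finset.sum_filter]
      _ = ∑ S : Finset V, ((F ∩ S).card : ℝ) * w S := by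
          rw [Finset.sum_comm]
          refine Finset.sum_congr rfl fun S _ => ?_
          rw [← Finset.sum_filter, Finset.sum_const, nsmul_eq_mul, Finset.filter_mem_eq_inter]
      _ ≤ ∑ S : Finset V, (k : ℝ) * w S := by
          refine Finset.sum_le_sum fun S _ => ?_
          by_cases hS : w S = 0
          · simp [hS]
          · exact mul_le_mul_of_nonneg_right (by exact_mod_cast hF S (h1 S hS)) (h0 S)
      _ = k * ∑ S : Finset V, w S := by rw [Finset.mul_sum]
      _ ≤ k * c := mul_le_mul_of_nonneg_left h2 (Nat.cast_nonneg k)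
  rcases Nat.eq_zero_or_pos k with rfl | hk
  · obtain ⟨c, hc⟩ := frac_nonempty G
    simpa using key c hc
  · have hk' : (0 : ℝ) < k := by exact_mod_cast hk
    have : (F.card : ℝ) / k ≤ fracChromatic G := by
      refine le_csInf (frac_nonempty G) fun c hc => ?_
      rw [div_le_iff₀ hk']
      linarith [key c hc]
    rw [div_le_iff₀ hk'] at this
    linarith

lemma frac_nonneg {V : Type*} [Fintype V] [DecidableEq V] (G : SimpleGraph V) :
    0 ≤ fracChromatic G := by
  refine le_csInf (frac_nonempty G) ?_
  rintro c ⟨w, h0, h1, h2, h3⟩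
  exact (Finset.sum_nonneg fun S _ => h0 S).trans h2

lemma repr {V : Type u} [Fintype V] (G : SimpleGraph V) (hG : IsLineGraphOfMultigraph G) :
    ∃ (N : Type u) (_ : Fintype N) (p r : V → N), (∀ e, p e ≠ r e) ∧
      ∀ u v, u ≠ v → (G.Adj u v ↔ ∃ x, Inc p r x u ∧ Inc p r x v) := by
  classical
  obtain ⟨W, f, hf⟩ := hG
  have hxy : ∀ e, ∃ x y, f e = s(x, y) := by
    intro e
    induction f e using Sym2.ind with
    | _ x y => exact ⟨x, y, rfl⟩
  choose x y hxy using hxy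
  let P : V → W ⊕ V := fun e => Sum.inl (x e)
  let R : V → W ⊕ V := fun e => if x e = y e then Sum.inr e else Sum.inl (y e)
  have hfin : Finite (↥(Set.range P ∪ Set.range R)) := by
    exact ((Set.finite_range P).union (Set.finite_range R)).to_subtype
  refine ⟨↥(Set.range P ∪ Set.range R), Fintype.ofFinite _, fun e => ⟨P e, Or.inl ⟨e, rfl⟩⟩,
    fun e => ⟨R e, Or.inr ⟨e, rfl⟩⟩, ?_, ?_⟩
  · intro e h
    have h' : P e = R e := congrArg Subtype.val h
    simp only [P, R] at h'
    split_ifs at h' with h1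
    exact h1 (Sum.inl_injective h')
  · intro u v huv
    rw [hf u v huv, hxy, hxy]
    have h1 : ∀ (n : ↥(Set.range P ∪ Set.range R)) (e : V),
        Inc (fun e => (⟨P e, Or.inl ⟨e, rfl⟩⟩ : ↥(Set.range P ∪ Set.range R)))
          (fun e => ⟨R e, Or.inr ⟨e, rfl⟩⟩) n e ↔ (P e = n.1 ∨ R e = n.1) := by
      intro n e
      simp only [Inc, Subtype.ext_iff]
    simp only [h1]
    constructor
    · rintro ⟨z, hzu, hzv⟩
      have key : ∀ e, z ∈ s(x e, y e) → (P e = Sum.inl z ∨ R e = Sum.inl z) := by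
        intro e he
        rw [Sym2.mem_iff] at he
        simp only [P, R]
        rcases he with rfl | rfl
        · simp
        · by_cases h : x e = y e <;> simp [h]
      have hm : (Sum.inl z : W ⊕ V) ∈ Set.range P ∪ Set.range R := by
        rcases key u hzu with h | h
        · exact Or.inl ⟨u, h⟩
        · exact Or.inr ⟨u, h⟩
      exact ⟨⟨_, hm⟩, key u hzu, key v hzv⟩
    · rintro ⟨⟨n, hn⟩, hu, hv⟩
      simp only at hu hv
      rcases n with z | e
      · have key : ∀ e, (P e = Sum.inl z ∨ R e = Sum.inl z) → z ∈ s(x e, y e) := by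
          intro e he
          rw [Sym2.mem_iff]
          simp only [P, R] at he
          rcases he with h | h
          · left; exact (Sum.inl_injective h).symm
          · split_ifs at h
            right; exact (Sum.inl_injective h).symm
        exact ⟨z, key u hu, key v hv⟩
      · exfalso
        have key : ∀ e', (P e' = Sum.inr e ∨ R e' = Sum.inr e) → e' = e := by
          intro e' he
          simp only [P, R] at he
          rcases he with h | h
          · simp at h
          · split_ifs at h
            exact Sum.inr_injective h
        exact huv ((key u hu).trans (key v hv).symm)

end LGC

/-- Any finite line graph `G` of a multigraph satisfies
`χ(G) ≤ χ_f(G) + √((9/2)·χ_f(G))`. -/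
theorem lineGraph_chromatic_le {V : Type*} [Fintype V] [DecidableEq V]
    (G : SimpleGraph V) (hG : IsLineGraphOfMultigraph G) :
    ∃ n : ℕ, G.Colorable n ∧
      (n : ℝ) ≤ fracChromatic G + Real.sqrt ((9 / 2) * fracChromatic G) := by
  classical
  have hc0 := LGC.frac_nonneg G
  set c := fracChromatic G with hc
  set R := Real.sqrt ((9 / 2) * c) with hR
  have hR0 : 0 ≤ R := Real.sqrt_nonneg _
  have hRR : R * R = 9 / 2 * c := Real.mul_self_sqrt (by positivity)
  set q := ⌊c + R⌋₊ with hq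
  have hqle : (q : ℝ) ≤ c + R := Nat.floor_le (by positivity)
  have hqlt : c + R < q + 1 := Nat.lt_floor_add_one _
  refine ⟨q, ?_, hqle⟩
  rcases isEmpty_or_nonempty V with hV | ⟨⟨a⟩⟩
  · exact ⟨SimpleGraph.Coloring.mk (fun v => isEmptyElim v) (fun {v} => isEmptyElim v)⟩
  have hc1 : 1 ≤ c := by
    have := LGC.frac_bound G {a} 1 (fun S _ => (Finset.card_le_card Finset.inter_subset_left).trans
      (by simp))
    simpa using this
  have hR2 : 2 < R := by nlinarith
  obtain ⟨N, _, p, r, hpr, hadj⟩ := LGC.repr G hG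
  set s := ⌈(q : ℝ) - c⌉₊ with hs
  have hs1 : (q : ℝ) - c ≤ s := Nat.le_ceil _
  have hs2 : (s : ℝ) < q - c + 1 := Nat.ceil_lt_add_one (by linarith)
  have hs3 : 2 ≤ s := by
    have : (1 : ℝ) < s := by linarith
    exact_mod_cast this
  have hmeet : ∀ S : Finset V, (∀ u ∈ S, ∀ v ∈ S, ¬ G.Adj u v) → ∀ u ∈ S, ∀ v ∈ S, ∀ x,
      LGC.Inc p r x u → LGC.Inc p r x v → u = v := by
    intro S hS u hu v hv x hxu hxv
    by_contra hne
    exact hS u hu v hv ((hadj u v hne).2 ⟨x, hxu, hxv⟩)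
  suffices hcore : ∃ φ : V → Fin q, ∀ e e' x, e ≠ e' → LGC.Inc p r x e → LGC.Inc p r x e' →
      φ e ≠ φ e' by
    obtain ⟨φ, hφ⟩ := hcore
    refine ⟨SimpleGraph.Coloring.mk φ ?_⟩
    intro u v huv
    obtain ⟨x, h1, h2⟩ := (hadj u v huv.ne).1 huv
    exact hφ u v x huv.ne h1 h2
  refine LGC.core p r hpr q s ((s + 3) / 2) ?_ ?_ (by omega) (by omega) ?_
  · intro x
    have h1 := LGC.frac_bound G (Finset.univ.filter (fun e => p e = x ∨ r e = x)) 1 ?_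
    · set d := (Finset.univ.filter (fun e => p e = x ∨ r e = x)).card
      rw [Nat.cast_one, one_mul, ← hc] at h1
      have h2 : ((d + s : ℕ) : ℝ) < (q : ℝ) + 1 := by push_cast; linarith
      have h3 : d + s < q + 1 := by exact_mod_cast h2
      omega
    · intro S hS
      rw [Finset.card_le_one]
      intro u hu v hv
      simp only [Finset.mem_inter, Finset.mem_filter, Finset.mem_univ, true_and] at hu hv
      exact hmeet S hS u hu.2 v hv.2 x hu.1 hv.1
  · intro T hT
    obtain ⟨k, hk⟩ := hT
    have h1 := LGC.frac_bound G (Finset.univ.filter (fun e => p e ∈ T ∧ r e ∈ T)) k ?_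
    · set d := (Finset.univ.filter (fun e => p e ∈ T ∧ r e ∈ T)).card
      rw [← hc] at h1
      have h2 : T.card - 1 = 2 * k := by omega
      rw [h2]
      obtain ⟨s', hs'⟩ : ∃ s', s = s' + 1 := ⟨s - 1, by omega⟩
      rw [hs'] at hs2 ⊢
      rw [Nat.add_sub_cancel]
      push_cast at hs2
      have hk0 : (0 : ℝ) ≤ k := Nat.cast_nonneg k
      have h3 : ((2 * d + s' * (2 * k) : ℕ) : ℝ) ≤ ((q * (2 * k) : ℕ) : ℝ) := by
        push_cast
        nlinarith
      exact_mod_cast h3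
    · intro S hS
      set F := Finset.univ.filter (fun e => p e ∈ T ∧ r e ∈ T) with hF
      have h2 : ((F ∩ S).biUnion (fun e => ({p e, r e} : Finset N))).card ≤ T.card := by
        apply Finset.card_le_card
        intro x hx
        simp only [Finset.mem_biUnion, Finset.mem_inter, hF, Finset.mem_filter, Finset.mem_univ,
          true_and, Finset.mem_insert, Finset.mem_singleton] at hx
        obtain ⟨e, ⟨⟨h1, h2⟩, _⟩, rfl | rfl⟩ := hx
        · exact h1
        · exact h2
      rw [Finset.card_biUnion, Finset.sum_congr rfl (fun e _ => Finset.card_pair (hpr e)),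
        Finset.sum_const, smul_eq_mul] at h2
      · omega
      · intro u hu v hv huv
        rw [Function.onFun, Finset.disjoint_left]
        intro x hx hx'
        simp only [Finset.mem_insert, Finset.mem_singleton] at hx hx'
        have hu' := (Finset.mem_inter.1 hu).2
        have hv' := (Finset.mem_inter.1 hv).2
        refine huv (hmeet S hS u hu' v hv' x ?_ ?_)
        · unfold LGC.Inc; tauto
        · unfold LGC.Inc; tauto
  · have hs4 : R < s + 1 := by linarith
    have h1 : 4 * c < (s : ℝ) ^ 2 + 2 * s := by
      have hs5 : (2 : ℝ) ≤ s := by exact_mod_cast hs3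
      by_cases h2 : c < 2
      · nlinarith
      · push Not at h2
        nlinarith
    have h2 : ((4 * q : ℕ) : ℝ) < ((s ^ 2 + 6 * s : ℕ) : ℝ) := by
      push_cast
      linarith
    have h3 : 4 * q < s ^ 2 + 6 * s := by exact_mod_cast h2
    set M := (s + 3) / 2 with hM
    have h4 : s + 3 = 2 * M ∨ s + 3 = 2 * M + 1 := by omega
    rcases h4 with h4 | h4
    · have : (s + 3) ^ 2 = s ^ 2 + 6 * s + 9 := by ring
      rw [h4] at this ⊢
      nlinarith
    · have : (s + 3) ^ 2 = s ^ 2 + 6 * s + 9 := by ring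
      rw [h4] at this ⊢
      nlinarith
end

section
/- Let (S, X, Y) be a linear interval strip in which the end-cliques X and Y are disjoint, and let k and r be nonnegative integers. If S has a fractional k-colouring in which the total weight of the stable sets intersecting both X and Y equals r, then S has a proper colouring using at most k colours in which exactly r colours appear on both X and Y; that is, the vertex set of S can be partitioned into at most k stable sets of which exactly r intersect both X and Y. -/
/-- `p` and `𝓘` form a linear interval representation of `S`: `p` is an injective
placement of the vertices on the real line, `𝓘` is a collection of closed intervals,
and two distinct vertices are adjacent iff some interval contains both their points. -/
def IsLinearIntervalRep {V : Type*} (S : SimpleGraph V) (p : V → ℝ)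
    (𝓘 : Set (Set ℝ)) : Prop :=
  Function.Injective p ∧
  (∀ I ∈ 𝓘, ∃ a b : ℝ, I = Set.Icc a b) ∧
  (∀ u v : V, u ≠ v → (S.Adj u v ↔ ∃ I ∈ 𝓘, p u ∈ I ∧ p v ∈ I))

lemma sic_fl {x y : ℝ} {z : ℤ} (h : x ≤ y + z) : ⌊x⌋ ≤ ⌊y⌋ + z := by
  have := Int.floor_le_floor h
  rwa [Int.floor_add_intCast] at this

lemma sic_clique_sum {V : Type*} [Fintype V] [DecidableEq V] (G : SimpleGraph V)
    (g : Finset V → ℝ)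
    (hs : ∀ T : Finset V, g T ≠ 0 → ∀ u ∈ T, ∀ v ∈ T, ¬ G.Adj u v)
    (Q : Finset V) (hQ : G.IsClique (↑Q : Set V)) :
    ∑ q ∈ Q, ∑ T ∈ Finset.univ.filter (fun T : Finset V => q ∈ T), g T
      = ∑ T ∈ Finset.univ.filter (fun T : Finset V => (T ∩ Q).Nonempty), g T := by
  simp only [Finset.sum_filter]
  rw [Finset.sum_comm]
  refine Finset.sum_congr rfl fun T _ => ?_
  rw [← Finset.sum_filter, Finset.sum_const, nsmul_eq_mul]
  by_cases h0 : g T = 0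
  · simp [h0]
  have e : Q.filter (fun q => q ∈ T) = T ∩ Q := by ext; simp [and_comm]
  rw [e]
  split_ifs with h
  · obtain ⟨x, hx⟩ := h
    have : T ∩ Q = {x} := by
      ext y
      simp only [Finset.mem_singleton]
      constructor
      · intro hy
        by_contra hne
        rw [Finset.mem_inter] at hx hy
        exact hs T h0 y hy.1 x hx.1 (hQ (by exact_mod_cast hy.2) (by exact_mod_cast hx.2) hne)
      · rintro rfl; exact hx
    simp [this]
  · rw [Finset.not_nonempty_iff_eq_empty] at h
    simp [h]

lemma sic_window {V : Type*} [Fintype V] [DecidableEq V] (p : V → ℝ)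
    (hp : Function.Injective p) (f : V → ℝ) (u v : V) (huv : p u ≤ p v) :
    ∑ x ∈ Finset.univ.filter (fun x => p u ≤ p x ∧ p x ≤ p v), f x
      + ∑ x ∈ Finset.univ.filter (fun x => p x < p u), f x
      = ∑ x ∈ Finset.univ.filter (fun x => p x < p v), f x + f v := by
  rw [← Finset.sum_union, add_comm _ (f v), ← Finset.sum_insert (by simp)]
  · refine Finset.sum_congr ?_ fun _ _ => rfl
    ext x
    simp only [Finset.mem_union, Finset.mem_filter, Finset.mem_univ, true_and, Finset.mem_insert]
    constructor
    · rintro (⟨h1, h2⟩ | h)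
      · rcases h2.eq_or_lt with h | h
        · exact Or.inl (hp h)
        · exact Or.inr h
      · right; linarith
    · rintro (rfl | h)
      · left; exact ⟨huv, le_rfl⟩
      · by_cases h' : p u ≤ p x
        · left; exact ⟨h', h.le⟩
        · right; linarith
  · rw [Finset.disjoint_left]
    intro x hx hx'
    simp only [Finset.mem_filter, Finset.mem_univ, true_and] at hx hx'
    linarith [hx.1]

lemma sic_tele {V : Type*} [Fintype V] [DecidableEq V] (p : V → ℝ)
    (hp : Function.Injective p) (c : V → ℝ) (D : Finset V)
    (hD : ∀ x ∈ D, ∀ y, p y < p x → y ∈ D) :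
    ∑ v ∈ D, (⌊∑ x ∈ Finset.univ.filter (fun x => p x < p v), c x + c v⌋
      - ⌊∑ x ∈ Finset.univ.filter (fun x => p x < p v), c x⌋) = ⌊∑ v ∈ D, c v⌋ := by
  induction D using Finset.induction_on_max_value p with
  | empty => simp
  | insert m s hm hmax ih =>
    have hs : Finset.univ.filter (fun x => p x < p m) = s := by
      ext x
      simp only [Finset.mem_filter, Finset.mem_univ, true_and]
      constructor
      · intro h
        have := hD m (Finset.mem_insert_self _ _) x h
        rcases Finset.mem_insert.1 this with rfl | h'
        · exact absurd h (lt_irrefl _)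
        · exact h'
      · intro h
        refine lt_of_le_of_ne (hmax x h) fun e => hm (hp e ▸ h)
    rw [Finset.sum_insert hm, Finset.sum_insert hm, ih, hs, add_comm (c m)]
    · ring
    · intro x hx y hy
      rcases Finset.mem_insert.1 (hD x (Finset.mem_insert_of_mem hx) y hy) with rfl | h'
      · exact absurd (hmax x hx) (not_le.2 hy)
      · exact h'

lemma sic_mod {m x y : ℤ} (h1 : x < y) (h2 : y < x + m) : x % m ≠ y % m := by
  intro h
  have h3 : m ∣ y - x := Int.dvd_of_emod_eq_zero (Int.emod_eq_emod_iff_emod_sub_eq_zero.1 h.symm)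
  have := Int.le_of_dvd (by linarith) h3
  linarith

lemma sic_core {V : Type*} [Fintype V] [DecidableEq V]
    (S : SimpleGraph V) (p : V → ℝ) (hp : Function.Injective p)
    (hwin : ∀ u v, S.Adj u v → p u < p v →
      S.IsClique (↑(Finset.univ.filter (fun x => p u ≤ p x ∧ p x ≤ p v)) : Set V))
    (X Y : Finset V)
    (hXclique : S.IsClique (↑X : Set V)) (hYclique : S.IsClique (↑Y : Set V))
    (hYright : ∀ y ∈ Y, ∀ v ∉ Y, p v < p y)
    (k r : ℕ) (hk : X.card ≤ k) (c : V → ℝ) (hc0 : ∀ v, 0 ≤ c v) (hc1 : ∀ v, c v ≤ 1)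
    (h1 : ∀ Q : Finset V, S.IsClique (↑Q : Set V) → ∑ q ∈ Q, c q ≤ X.card)
    (h2 : ∀ Q : Finset V, S.IsClique (↑Q : Set V) → Q.card - ∑ q ∈ Q, c q ≤ k - X.card)
    (hX : ∀ x ∈ X, c x = 1) (hY : ∑ y ∈ Y, c y = r) :
    ∃ C : V → Fin k,
      (∀ u v : V, S.Adj u v → C u ≠ C v) ∧
      (Finset.univ.filter
        (fun i : Fin k => (∃ x ∈ X, C x = i) ∧ ∃ y ∈ Y, C y = i)).card = r := by
  classical
  set P : V → ℝ := fun v => ∑ x ∈ Finset.univ.filter (fun x => p x < p v), c x with hP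
  set R : V → ℤ := fun v => ((Finset.univ.filter (fun x => p x < p v)).card : ℤ) with hR
  set N : V → ℤ := fun v => ⌊P v⌋ with hN
  set N' : V → ℤ := fun v => ⌊P v + c v⌋ with hN'
  set a : ℤ := (X.card : ℤ) with ha
  set b : ℤ := (k : ℤ) - a with hb
  have hcase : ∀ v, N' v = N v ∨ N' v = N v + 1 := by
    intro v
    have e1 : N v ≤ N' v := Int.floor_le_floor (by linarith [hc0 v])
    have e2 : N' v ≤ N v + 1 := sic_fl (by push_cast; linarith [hc1 v])
    omega
  -- window identities
  have wc : ∀ u v, p u ≤ p v →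
      ∑ x ∈ Finset.univ.filter (fun x => p u ≤ p x ∧ p x ≤ p v), c x + P u = P v + c v :=
    fun u v h => sic_window p hp c u v h
  have wr : ∀ u v, p u ≤ p v →
      ((Finset.univ.filter (fun x => p u ≤ p x ∧ p x ≤ p v)).card : ℝ) + R u = R v + 1 := by
    intro u v h
    have := sic_window p hp (fun _ => 1) u v h
    simpa [hR] using this
  have wcl : ∀ u v, p u ≤ p v → (u = v ∨ S.Adj u v) →
      S.IsClique (↑(Finset.univ.filter (fun x => p u ≤ p x ∧ p x ≤ p v)) : Set V) := by
    intro u v h h'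
    rcases h' with rfl | h'
    · intro x hx y hy hxy
      simp only [Finset.coe_filter, Finset.mem_univ, true_and, Set.mem_ofPred_eq] at hx hy
      exact absurd (hp (by linarith [hx.1, hx.2, hy.1, hy.2])) hxy
    · exact hwin u v h' (lt_of_le_of_ne h fun e => h'.ne (hp e))
  have up1 : ∀ u v, p u ≤ p v → (u = v ∨ S.Adj u v) → N' v ≤ N u + a := by
    intro u v h h'
    refine sic_fl ?_
    have := h1 _ (wcl u v h h')
    have := wc u v h
    simp only [ha]; push_cast; linarith
  have up0 : ∀ u v, p u ≤ p v → (u = v ∨ S.Adj u v) → N u ≤ N' v + (b - (R v + 1 - R u)) := by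
    intro u v h h'
    refine sic_fl ?_
    have := h2 _ (wcl u v h h')
    have := wc u v h
    have := wr u v h
    simp only [hb, ha]; push_cast; linarith
  have lo1 : ∀ u v, p u < p v → N' u ≤ N v := by
    intro u v h
    refine Int.floor_le_floor ?_
    have := wc u v h.le
    have h3 : c u + c v ≤ ∑ x ∈ Finset.univ.filter (fun x => p u ≤ p x ∧ p x ≤ p v), c x := by
      have huv : u ≠ v := by rintro rfl; exact lt_irrefl _ h
      rw [← Finset.sum_pair huv]
      refine Finset.sum_le_sum_of_subset_of_nonneg ?_ fun i _ _ => hc0 i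
      intro x hx
      simp only [Finset.mem_insert, Finset.mem_singleton] at hx
      rcases hx with rfl | rfl <;> simp [h.le]
    linarith
  have lo0 : ∀ u v, p u < p v → N v ≤ N' u + (R v - R u - 1) := by
    intro u v h
    refine sic_fl ?_
    have := wc u v h.le
    have := wr u v h.le
    have h3 : (1 - c u) + (1 - c v) ≤
        ∑ x ∈ Finset.univ.filter (fun x => p u ≤ p x ∧ p x ≤ p v), (1 - c x) := by
      have huv : u ≠ v := by rintro rfl; exact lt_irrefl _ h
      rw [← Finset.sum_pair (f := fun x => 1 - c x) huv]
      refine Finset.sum_le_sum_of_subset_of_nonneg ?_ fun i _ _ => by linarith [hc1 i]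
      intro x hx
      simp only [Finset.mem_insert, Finset.mem_singleton] at hx
      rcases hx with rfl | rfl <;> simp [h.le]
    rw [Finset.sum_sub_distrib] at h3
    simp only [Finset.sum_const, nsmul_eq_mul, mul_one] at h3
    push_cast; linarith
  have ha0 : 0 ≤ a := by simp [ha]
  have hb0 : 0 ≤ b := by simp only [hb, ha]; omega
  set col : V → ℤ := fun v => if N' v = N v + 1 then N v % a else a + (R v - N v) % b with hcol
  have colA : ∀ v, N' v = N v + 1 → 0 ≤ col v ∧ col v < a := by
    intro v hv
    have := up1 v v le_rfl (Or.inl rfl)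
    have hpos : 0 < a := by omega
    simp only [hcol, if_pos hv]
    exact ⟨Int.emod_nonneg _ hpos.ne', Int.emod_lt_of_pos _ hpos⟩
  have colB : ∀ v, ¬ N' v = N v + 1 → a ≤ col v ∧ col v < k := by
    intro v hv
    have := up0 v v le_rfl (Or.inl rfl)
    have := hcase v
    have hpos : 0 < b := by omega
    simp only [hcol, if_neg hv]
    have e1 := Int.emod_nonneg (R v - N v) hpos.ne'
    have e2 := Int.emod_lt_of_pos (R v - N v) hpos
    constructor <;> omega
  have colr : ∀ v, 0 ≤ col v ∧ col v < k := by
    intro v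
    by_cases h : N' v = N v + 1
    · have := colA v h; omega
    · have := colB v h; omega
  have key : ∀ u v, S.Adj u v → p u < p v → col u ≠ col v := by
    intro u v huv hlt
    have q1 := up1 u v hlt.le (Or.inr huv)
    have q2 := up0 u v hlt.le (Or.inr huv)
    have q3 := lo1 u v hlt
    have q4 := lo0 u v hlt
    have cu := hcase u
    have cv := hcase v
    by_cases hu : N' u = N u + 1 <;> by_cases hv : N' v = N v + 1
    · simp only [hcol, if_pos hu, if_pos hv]
      exact sic_mod (by omega) (by omega)
    · have := colA u hu; have := colB v hv; omega
    · have := colB u hu; have := colA v hv; omega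
    · simp only [hcol, if_neg hu, if_neg hv]
      intro h
      exact sic_mod (m := b) (x := R u - N u) (y := R v - N v) (by omega) (by omega) (by omega)
  have prop : ∀ u v, S.Adj u v → col u ≠ col v := by
    intro u v huv
    rcases lt_trichotomy (p u) (p v) with h | h | h
    · exact key u v huv h
    · exact absurd (hp h) huv.ne
    · exact (key v u huv.symm h).symm
  have hXone : ∀ x ∈ X, N' x = N x + 1 := by
    intro x hx
    simp only [hN', hN, hX x hx, Int.floor_add_one]
  have Ximg : X.image col = Finset.Ico 0 a := by
    refine Finset.eq_of_subset_of_card_le ?_ ?_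
    · intro i hi
      obtain ⟨x, hx, rfl⟩ := Finset.mem_image.1 hi
      have := colA x (hXone x hx)
      simp; omega
    · rw [Finset.card_image_of_injOn]
      · simp [ha]
      · intro x hx y hy hxy
        by_contra hne
        exact prop x y (hXclique hx hy hne) hxy
  have hYcount : ((Y.filter (fun y => N' y = N y + 1)).card : ℤ) = r := by
    have t1 := sic_tele p hp c Finset.univ (by simp)
    have t2 := sic_tele p hp c Yᶜ (by
      intro x hx y hy
      rw [Finset.mem_compl] at hx ⊢
      intro hyY
      exact absurd (hYright y hyY x hx) (not_lt.2 hy.le))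
    have s1 := Finset.sum_add_sum_compl Y c
    have s2 := Finset.sum_add_sum_compl Y (fun v => N' v - N v)
    change ∑ v, (N' v - N v) = _ at t1
    change ∑ v ∈ Yᶜ, (N' v - N v) = _ at t2
    have t3 : ⌊∑ v, c v⌋ = ⌊∑ v ∈ Yᶜ, c v⌋ + r := by
      rw [← s1, hY, add_comm, Int.floor_add_natCast]
    have t4 : ((Y.filter (fun y => N' y = N y + 1)).card : ℤ) = ∑ v ∈ Y, (N' v - N v) := by
      rw [Finset.card_filter]
      push_cast
      refine Finset.sum_congr rfl fun v _ => ?_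
      have := hcase v
      split_ifs <;> omega
    rw [t4]; linarith
  refine ⟨fun v => ⟨(col v).toNat, by have := colr v; omega⟩, ?_, ?_⟩
  · intro u v huv h
    have := prop u v huv
    have h' := congrArg Fin.val h
    simp only at h'
    have := colr u; have := colr v
    omega
  · have hinj : ∀ u v, (col u).toNat = (col v).toNat → col u = col v := by
      intro u v h
      have := colr u; have := colr v
      omega
    have : Finset.univ.filter (fun i : Fin k =>
        (∃ x ∈ X, (⟨(col x).toNat, by have := colr x; omega⟩ : Fin k) = i) ∧
        ∃ y ∈ Y, (⟨(col y).toNat, by have := colr y; omega⟩ : Fin k) = i)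
        = (Y.filter (fun y => N' y = N y + 1)).image
          (fun v => (⟨(col v).toNat, by have := colr v; omega⟩ : Fin k)) := by
      ext i
      simp only [Finset.mem_filter, Finset.mem_univ, true_and, Finset.mem_image]
      constructor
      · rintro ⟨⟨x, hx, rfl⟩, y, hy, hxy⟩
        refine ⟨y, ⟨hy, ?_⟩, hxy⟩
        by_contra hn
        have e := hinj _ _ (congrArg Fin.val hxy)
        have := colB y hn
        have := colA x (hXone x hx)
        omega
      · rintro ⟨y, ⟨hy, hy1⟩, rfl⟩
        refine ⟨?_, y, hy, rfl⟩
        have : col y ∈ X.image col := by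
          rw [Ximg]; have := colA y hy1; simp; omega
        obtain ⟨x, hx, e⟩ := Finset.mem_image.1 this
        exact ⟨x, hx, by simp [e]⟩
    rw [this, Finset.card_image_of_injOn]
    · exact_mod_cast hYcount
    · intro u hu v hv h
      by_contra hne
      simp only [Finset.coe_filter, Set.mem_ofPred_eq] at hu hv
      exact prop u v (hYclique hu.1 hv.1 hne) (hinj _ _ (congrArg Fin.val h))

/-- If a linear interval strip `(S, X, Y)` with disjoint end-cliques `X` and `Y` has a
fractional `k`-colouring in which the total weight of stable sets meeting both `X` and
`Y` equals the integer `r`, then `S` has a proper colouring with at most `k` colours in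
which exactly `r` colours appear on both `X` and `Y`. -/
theorem strip_integral_coloring {V : Type*} [Fintype V] [DecidableEq V]
    (S : SimpleGraph V) (p : V → ℝ) (𝓘 : Set (Set ℝ))
    (hrep : IsLinearIntervalRep S p 𝓘)
    (X Y : Finset V)
    (hXclique : S.IsClique ↑X) (hYclique : S.IsClique ↑Y)
    (hXleft : ∀ x ∈ X, ∀ v ∉ X, p x < p v)
    (hYright : ∀ y ∈ Y, ∀ v ∉ Y, p v < p y)
    (hXY : Disjoint X Y)
    (k r : ℕ) (w : Finset V → ℝ)
    (hw : IsFractionalColoring S w (k : ℝ))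
    (hoverlap :
      ∑ T ∈ Finset.univ.filter
        (fun T : Finset V => (T ∩ X).Nonempty ∧ (T ∩ Y).Nonempty), w T = (r : ℝ)) :
    ∃ C : V → Fin k,
      (∀ u v : V, S.Adj u v → C u ≠ C v) ∧
      (Finset.univ.filter
        (fun i : Fin k => (∃ x ∈ X, C x = i) ∧ ∃ y ∈ Y, C y = i)).card = r := by
  obtain ⟨hp, hI, hadj⟩ := hrep
  obtain ⟨hw0, hws, hwk, hw1⟩ := hw
  set g : Finset V → ℝ := fun T => if (T ∩ X).Nonempty then w T else 0 with hg
  have hg0 : ∀ T, 0 ≤ g T := by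
    intro T; simp only [hg]; split_ifs; exacts [hw0 T, le_rfl]
  have hgw : ∀ T, g T ≤ w T := by
    intro T; simp only [hg]; split_ifs; exacts [le_rfl, hw0 T]
  have hgs : ∀ T : Finset V, g T ≠ 0 → ∀ u ∈ T, ∀ v ∈ T, ¬ S.Adj u v := by
    intro T hT
    refine hws T fun h => hT (le_antisymm (h ▸ hgw T) (hg0 T))
  have hgX : ∑ T, g T = X.card := by
    have := sic_clique_sum S w hws X hXclique
    rw [Finset.sum_congr rfl (fun x _ => hw1 x)] at this
    simp only [hg]
    rw [← Finset.sum_filter, ← this]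
    simp
  refine sic_core S p hp ?_ X Y hXclique hYclique hYright k r ?_
    (fun v => ∑ T ∈ Finset.univ.filter (fun T : Finset V => v ∈ T), g T) ?_ ?_ ?_ ?_ ?_ ?_
  · intro u v huv _ x hx y hy hxy
    simp only [Finset.coe_filter, Finset.mem_univ, true_and, Set.mem_ofPred_eq] at hx hy
    obtain ⟨I, hI1, hu, hv⟩ := (hadj u v huv.ne).1 huv
    obtain ⟨s, t, rfl⟩ := hI I hI1
    refine (hadj x y hxy).2 ⟨_, hI1, ?_, ?_⟩
    · exact ⟨hu.1.trans hx.1, hx.2.trans hv.2⟩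
    · exact ⟨hu.1.trans hy.1, hy.2.trans hv.2⟩
  · have h : (X.card : ℝ) ≤ k := by
      rw [← hgX]; exact (Finset.sum_le_sum fun T _ => hgw T).trans hwk
    exact_mod_cast h
  · intro v; exact Finset.sum_nonneg fun T _ => hg0 T
  · intro v
    rw [← hw1 v]
    exact Finset.sum_le_sum fun T _ => hgw T
  · intro Q hQ
    rw [sic_clique_sum S g hgs Q hQ, ← hgX]
    exact Finset.sum_le_sum_of_subset_of_nonneg (Finset.filter_subset _ _) fun T _ _ => hg0 T
  · intro Q hQ
    have e := sic_clique_sum S w hws Q hQ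
    rw [Finset.sum_congr rfl (fun x _ => hw1 x)] at e
    simp only [Finset.sum_const, nsmul_eq_mul, mul_one] at e
    rw [sic_clique_sum S g hgs Q hQ, e, ← Finset.sum_sub_distrib, ← hgX]
    have : ∑ T ∈ Finset.univ.filter (fun T : Finset V => (T ∩ Q).Nonempty), (w T - g T)
        ≤ ∑ T, (w T - g T) :=
      Finset.sum_le_sum_of_subset_of_nonneg (Finset.filter_subset _ _)
        fun T _ _ => sub_nonneg.2 (hgw T)
    rw [Finset.sum_sub_distrib (s := Finset.univ)] at this
    linarith
  · intro x hx
    rw [← hw1 x]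
    refine Finset.sum_congr rfl fun T hT => ?_
    rw [Finset.mem_filter] at hT
    simp only [hg]
    rw [if_pos ⟨x, Finset.mem_inter.2 ⟨hT.2, hx⟩⟩]
  · rw [sic_clique_sum S g hgs Y hYclique, ← hoverlap]
    simp only [hg]
    rw [← Finset.sum_filter, Finset.filter_filter]
    refine Finset.sum_congr ?_ fun _ _ => rfl
    ext T; simp [and_comm]
end

section
/- Let G be a finite circular interval graph. Then χ(G) = ⌈χ_f(G)⌉. -/
/-- `G` is a circular interval graph: its vertices can be placed injectively on the
unit circle (here `ℝ/ℤ`), together with a collection of closed arcs, so that two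
distinct vertices are adjacent iff some arc contains both their points. -/
def IsCircularIntervalGraph {V : Type*} (G : SimpleGraph V) : Prop :=
  ∃ (p : V → AddCircle (1 : ℝ)) (𝓘 : Set (Set (AddCircle (1 : ℝ)))),
    Function.Injective p ∧
    (∀ I ∈ 𝓘, ∃ a b : ℝ, I = (fun x : ℝ => (x : AddCircle (1 : ℝ))) '' Set.Icc a b) ∧
    (∀ u v : V, u ≠ v → (G.Adj u v ↔ ∃ I ∈ 𝓘, p u ∈ I ∧ p v ∈ I))

/-- inner interval -/
def inr {V : Type*} [Fintype V] (e : V → ℕ) (u v : V) : Finset V :=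
  Finset.univ.filter (fun w => e u ≤ e w ∧ e w ≤ e v)

/-- outer interval -/
def otr {V : Type*} [Fintype V] (e : V → ℕ) (u v : V) : Finset V :=
  Finset.univ.filter (fun w => e w ≤ e u ∨ e v ≤ e w)

/-- prefix sum -/
def pre {V : Type*} [Fintype V] {R : Type*} [AddCommMonoid R] (e : V → ℕ) (x : V → R) (T : ℕ) : R :=
  ∑ w ∈ Finset.univ.filter (fun w => e w < T), x w

theorem pre_inr {V : Type*} [Fintype V] {R : Type*} [AddCommGroup R] (e : V → ℕ)
    (x : V → R) (u v : V) (h : e u ≤ e v) :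
    ∑ w ∈ inr e u v, x w = pre e x (e v + 1) - pre e x (e u) := by
  classical
  unfold pre inr
  rw [eq_sub_iff_add_eq, ← Finset.sum_union]
  · congr 1
    ext w; simp; omega
  · rw [Finset.disjoint_left]
    intro w; simp; omega

theorem pre_otr {V : Type*} [Fintype V] {R : Type*} [AddCommGroup R] (e : V → ℕ)
    (x : V → R) (u v : V) (h : e u < e v) :
    ∑ w ∈ otr e u v, x w = ∑ w, x w - (pre e x (e v) - pre e x (e u + 1)) := by
  classical
  have h1 : pre e x (e v) - pre e x (e u + 1) =
      ∑ w ∈ Finset.univ.filter (fun w => ¬ (e w ≤ e u ∨ e v ≤ e w)), x w := by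
    unfold pre
    rw [sub_eq_iff_eq_add, ← Finset.sum_union]
    · congr 1
      ext w; simp; omega
    · rw [Finset.disjoint_left]
      intro w; simp; omega
  rw [h1, eq_sub_iff_add_eq]
  exact Finset.sum_filter_add_sum_filter_not _ _ _

theorem pre_succ {V : Type*} [Fintype V] {R : Type*} [AddCommMonoid R] (e : V → ℕ)
    (he : Function.Injective e) (x : V → R) (v : V) :
    pre e x (e v + 1) = pre e x (e v) + x v := by
  classical
  unfold pre
  have : Finset.univ.filter (fun w => e w < e v + 1) =
      insert v (Finset.univ.filter (fun w => e w < e v)) := by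
    ext w; simp only [Finset.mem_filter, Finset.mem_univ, true_and, Finset.mem_insert]
    constructor
    · intro h
      by_cases h2 : e w = e v
      · left; exact he h2
      · right; omega
    · rintro (rfl | h) <;> omega
  rw [this, Finset.sum_insert (by simp), add_comm]

theorem pre_round {V : Type*} [Fintype V] (e : V → ℕ)
    (he : Function.Injective e) (x : V → ℝ) :
    ∃ x' : V → ℤ, ∀ T, pre e x' T = ⌊pre e x T⌋ := by
  classical
  refine ⟨fun v => ⌊pre e x (e v + 1)⌋ - ⌊pre e x (e v)⌋, fun T => ?_⟩
  induction T with
  | zero => simp [pre]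
  | succ T ih =>
    by_cases h : ∃ v, e v = T
    · obtain ⟨v, rfl⟩ := h
      rw [pre_succ e he, ih]; ring
    · have : ∀ {R : Type} [AddCommMonoid R] (y : V → R), pre e y (T+1) = pre e y T := by
        intro R _ y
        unfold pre
        congr 1
        ext w
        have : e w ≠ T := fun h' => h ⟨w, h'⟩
        simp; omega
      rw [this, this, ih]

theorem pre_big {V : Type*} [Fintype V] {R : Type*} [AddCommMonoid R] (e : V → ℕ) (x : V → R) :
    pre e x (∑ v, e v + 1) = ∑ v, x v := by
  classical
  unfold pre
  rw [Finset.filter_true_of_mem]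
  intro w _
  have := Finset.single_le_sum (f := e) (fun i _ => Nat.zero_le _) (Finset.mem_univ w)
  omega

theorem floor_diff (a b : ℝ) (c : ℤ) :
    (a - b ≤ c → ⌊a⌋ - ⌊b⌋ ≤ c) ∧ ((c : ℝ) ≤ a - b → c ≤ ⌊a⌋ - ⌊b⌋) := by
  constructor
  · intro h
    have : ⌊a⌋ ≤ ⌊b + c⌋ := Int.floor_le_floor (by linarith)
    rw [Int.floor_add_intCast] at this; linarith
  · intro h
    have : ⌊b + c⌋ ≤ ⌊a⌋ := Int.floor_le_floor (by linarith)
    rw [Int.floor_add_intCast] at this; linarith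

theorem rounding {V : Type*} [Fintype V] (e : V → ℕ)
    (he : Function.Injective e) (x : V → ℝ) (N : ℤ) (hN : ∑ v, x v = N) :
    ∃ x' : V → ℤ, ∑ v, x' v = N ∧ 
      (∀ u v, e u ≤ e v → ∀ c : ℤ, (∑ w ∈ inr e u v, x w ≤ c → ∑ w ∈ inr e u v, x' w ≤ c) ∧
        ((c : ℝ) ≤ ∑ w ∈ inr e u v, x w → c ≤ ∑ w ∈ inr e u v, x' w)) ∧
      (∀ u v, e u < e v → ∀ c : ℤ, (∑ w ∈ otr e u v, x w ≤ c → ∑ w ∈ otr e u v, x' w ≤ c) ∧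
        ((c : ℝ) ≤ ∑ w ∈ otr e u v, x w → c ≤ ∑ w ∈ otr e u v, x' w)) := by
  obtain ⟨x', hx'⟩ := pre_round e he x
  have hs : ∑ v, x' v = N := by
    rw [← pre_big e, hx', pre_big, hN, Int.floor_intCast]
  refine ⟨x', hs, ?_, ?_⟩
  · intro u v h c
    rw [pre_inr e x u v h, pre_inr e x' u v h, hx', hx']
    exact floor_diff _ _ _
  · intro u v h c
    rw [pre_otr e x u v h, pre_otr e x' u v h, hx', hx', hN, hs]
    have := floor_diff (pre e x (e v)) (pre e x (e u + 1)) (N - c)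
    push_cast at this
    constructor
    · intro h; have := this.2 (by linarith); linarith
    · intro h; have := this.1 (by linarith); linarith

theorem color_part {V : Type*} [Fintype V] [DecidableEq V] (G : SimpleGraph V) (e : V → ℕ)
    (he : Function.Injective e) (X : Finset V) (m c : ℕ) (hX : X.card = m * c)
    (H : ∀ u v, e u < e v → G.Adj u v →
      (X ∩ inr e u v).card ≤ m ∨ (X ∩ otr e u v).card ≤ m) :
    ∃ col : V → ℕ, (∀ u ∈ X, col u < m) ∧ ∀ u ∈ X, ∀ v ∈ X, G.Adj u v → col u ≠ col v := by
  classical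
  rcases Nat.eq_zero_or_pos m with rfl | hm
  · have : X = ∅ := by simpa using hX
    subst this
    exact ⟨fun _ => 0, by simp, by simp⟩
  let rk : V → ℕ := fun v => (X.filter (fun w => e w < e v)).card
  have key : ∀ u ∈ X, ∀ v ∈ X, e u < e v → G.Adj u v → rk u % m ≠ rk v % m := by
    intro u hu v hv huv hadj hmod
    -- counts
    have h1 : rk u + (X ∩ inr e u v).card = rk v + 1 := by
      have : rk v + 1 = (insert v (X.filter (fun w => e w < e v))).card := by
        rw [Finset.card_insert_of_notMem (by simp)]
      rw [this, ← Finset.card_union_of_disjoint]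
      · congr 1
        ext w
        simp only [inr, Finset.mem_union, Finset.mem_filter, Finset.mem_inter, Finset.mem_univ,
          true_and, Finset.mem_insert]
        constructor
        · rintro (⟨a, b⟩ | ⟨a, b, d⟩)
          · right; exact ⟨a, by omega⟩
          · by_cases h2 : e w = e v
            · left; exact he h2
            · right; exact ⟨a, by omega⟩
        · rintro (rfl | ⟨a, b⟩)
          · right; exact ⟨hv, by omega, le_rfl⟩
          · by_cases h2 : e w < e u
            · left; exact ⟨a, h2⟩
            · right; exact ⟨a, by omega, by omega⟩
      · rw [Finset.disjoint_left]
        intro w; simp [inr]; omega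
    have h2 : (X ∩ inr e u v).card + (X ∩ otr e u v).card = X.card + 2 := by
      rw [← Finset.card_union_add_card_inter]
      have a1 : (X ∩ inr e u v) ∪ (X ∩ otr e u v) = X := by
        ext w; simp [inr, otr]; constructor
        · rintro (h | h) <;> exact h.1
        · intro h; simp [h]; omega
      have a2 : (X ∩ inr e u v) ∩ (X ∩ otr e u v) = {u, v} := by
        ext w; simp only [inr, otr, Finset.mem_inter, Finset.mem_filter, Finset.mem_univ, true_and,
          Finset.mem_insert, Finset.mem_singleton]
        constructor
        · rintro ⟨⟨a, b, d⟩, _, f⟩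
          rcases f with f | f
          · left; apply he; omega
          · right; apply he; omega
        · rintro (rfl | rfl)
          · exact ⟨⟨hu, by omega, by omega⟩, hu, by omega⟩
          · exact ⟨⟨hv, by omega, by omega⟩, hv, by omega⟩
      rw [a1, a2, Finset.card_pair]
      rintro rfl; omega
    have h3 : rk v < X.card := by
      apply Finset.card_lt_card
      rw [Finset.ssubset_iff_of_subset (Finset.filter_subset _ _)]
      exact ⟨v, hv, by simp⟩
    have h4 : 2 ≤ (X ∩ inr e u v).card := by
      have : ({u, v} : Finset V) ⊆ X ∩ inr e u v := by
        intro w; simp only [inr, Finset.mem_inter, Finset.mem_filter, Finset.mem_univ, true_and,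
          Finset.mem_insert, Finset.mem_singleton]
        rintro (rfl | rfl)
        · exact ⟨hu, by omega, by omega⟩
        · exact ⟨hv, by omega, by omega⟩
      have h5 := Finset.card_le_card this
      rwa [Finset.card_pair] at h5
      rintro rfl; omega
    have hlt : rk u < rk v := by omega
    have hd : m ∣ rk v - rk u := (Nat.modEq_iff_dvd' hlt.le).1 hmod
    rcases H u v huv hadj with h | h
    · have := Nat.le_of_dvd (by omega) hd
      omega
    · have hd2 : m ∣ X.card - (rk v - rk u) := Nat.dvd_sub (by rw [hX]; exact dvd_mul_right _ _) hd
      have := Nat.le_of_dvd (by omega) hd2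
      omega
  refine ⟨fun v => rk v % m, fun u _ => Nat.mod_lt _ hm, ?_⟩
  intro u hu v hv hadj
  rcases lt_trichotomy (e u) (e v) with h | h | h
  · exact key u hu v hv h hadj
  · exact absurd (he h) hadj.ne
  · exact (key v hv u hu h hadj.symm).symm

theorem theta {ι : Type*} [Fintype ι] (w : ι → ℝ) (hw : ∀ i, 0 ≤ w i) (d : ι → ℤ) (k s : ℝ)
    (hk : 0 < k) (hs : 0 ≤ s) (hsk : s ≤ k) (h1 : ∑ i, w i = k) (h2 : ∑ i, w i * d i = s) :
    ∃ θ : ι → ℝ, (∀ i, 0 ≤ θ i ∧ θ i ≤ 1) ∧ ∑ i, w i * θ i = k - s ∧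
      ∑ i, w i * θ i * d i = 0 := by
  classical
  have A : ∃ θ : ι → ℝ, (∀ i, 0 ≤ θ i ∧ θ i ≤ 1) ∧ ∑ i, w i * θ i = k - s ∧
      ∑ i, w i * θ i * d i ≤ 0 := by
    set WL := ∑ i, if d i ≤ 0 then w i else 0 with hWL
    have hWL0 : 0 ≤ WL := Finset.sum_nonneg (fun i _ => by split_ifs <;> simp [hw])
    rcases le_or_gt (k - s) WL with h | h
    · rcases hWL0.eq_or_lt with h0 | h0
      · refine ⟨fun _ => 0, by simp, ?_, by simp⟩
        simp; linarith
      · have hr : 0 ≤ (k - s) / WL := div_nonneg (by linarith) hWL0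
        refine ⟨fun i => if d i ≤ 0 then (k - s) / WL else 0, ?_, ?_, ?_⟩
        · intro i
          dsimp only
          split_ifs
          · exact ⟨hr, (div_le_one h0).2 h⟩
          · simp
        · have : ∀ i, w i * (if d i ≤ 0 then (k - s) / WL else 0) =
              (if d i ≤ 0 then w i else 0) * ((k - s) / WL) := by
            intro i; split_ifs <;> simp
          simp_rw [this]
          rw [← Finset.sum_mul, ← hWL]
          field_simp
        · apply Finset.sum_nonpos
          intro i _
          dsimp only
          split_ifs with hd
          · exact mul_nonpos_of_nonneg_of_nonpos (mul_nonneg (hw i) hr) (by exact_mod_cast hd)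
          · simp
    · have hU : 0 < k - WL := by linarith
      set τ := (k - s - WL) / (k - WL) with hτ
      have t0 : 0 ≤ τ := div_nonneg (by linarith) hU.le
      have t1 : τ ≤ 1 := (div_le_one hU).2 (by linarith)
      have t2 : τ * (k - WL) = k - s - WL := by rw [hτ]; field_simp
      refine ⟨fun i => if d i ≤ 0 then 1 else τ, ?_, ?_, ?_⟩
      · intro i; dsimp only; split_ifs
        · simp
        · exact ⟨t0, t1⟩
      · have : ∀ i, w i * (if d i ≤ 0 then 1 else τ) =
              (if d i ≤ 0 then w i else 0) * (1 - τ) + w i * τ := by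
            intro i; split_ifs <;> ring
        simp_rw [this]
        rw [Finset.sum_add_distrib, ← Finset.sum_mul, ← Finset.sum_mul, ← hWL, h1]
        linarith
      · have : ∀ i, w i * (if d i ≤ 0 then 1 else τ) * d i ≤
              w i * d i - (w i - (if d i ≤ 0 then w i else 0)) * (1 - τ) := by
          intro i; split_ifs with hd
          · simp
          · have : (1 : ℝ) ≤ d i := by exact_mod_cast (by omega : 1 ≤ d i)
            have := mul_nonneg (mul_nonneg (hw i) (sub_nonneg.2 t1)) (sub_nonneg.2 this)
            nlinarith
        refine (Finset.sum_le_sum (fun i _ => this i)).trans ?_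
        rw [Finset.sum_sub_distrib, ← Finset.sum_mul, Finset.sum_sub_distrib, ← hWL, h1, h2]
        linarith
  obtain ⟨θ, ha, hb, hc⟩ := A
  set α := ∑ i, w i * θ i * d i with hα
  set r := (k - s) / k with hr
  have hrk : r * k = k - s := by rw [hr]; field_simp
  have r0 : 0 ≤ r := div_nonneg (by linarith) hk.le
  have r1 : r ≤ 1 := (div_le_one hk).2 (by linarith)
  have hrs : 0 ≤ r * s := mul_nonneg r0 hs
  obtain ⟨t, t0, t1, ht⟩ : ∃ t : ℝ, 0 ≤ t ∧ t ≤ 1 ∧ (1 - t) * α + t * (r * s) = 0 := by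
    rcases hc.eq_or_lt with h | h
    · exact ⟨0, by simp, by simp, by simp [h]⟩
    · have : 0 < r * s - α := by linarith
      refine ⟨-α / (r * s - α), div_nonneg (by linarith) this.le,
        (div_le_one this).2 (by linarith), ?_⟩
      field_simp
      ring
  refine ⟨fun i => (1 - t) * θ i + t * r, ?_, ?_, ?_⟩
  · intro i
    obtain ⟨a, b⟩ := ha i
    constructor
    · have := mul_nonneg (sub_nonneg.2 t1) a
      have := mul_nonneg t0 r0
      linarith
    · have := mul_nonneg (sub_nonneg.2 t1) (sub_nonneg.2 b)
      have := mul_nonneg t0 (sub_nonneg.2 r1)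
      linarith
  · have : ∀ i, w i * ((1 - t) * θ i + t * r) = (1 - t) * (w i * θ i) + (t * r) * w i := by
      intro i; ring
    simp_rw [this]
    rw [Finset.sum_add_distrib, ← Finset.mul_sum, ← Finset.mul_sum, hb, h1, mul_assoc, hrk]
    ring
  · have : ∀ i, w i * ((1 - t) * θ i + t * r) * d i =
        (1 - t) * (w i * θ i * d i) + (t * r) * (w i * d i) := by
      intro i; ring
    simp_rw [this]
    rw [Finset.sum_add_distrib, ← Finset.mul_sum, ← Finset.mul_sum, ← hα, h2]
    linarith

/-- sum swap -/
theorem swap_sum {V : Type*} [Fintype V] [DecidableEq V] (g : Finset V → ℝ) (C : Finset V) :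
    ∑ v ∈ C, ∑ S ∈ Finset.univ.filter (fun S : Finset V => v ∈ S), g S =
      ∑ S : Finset V, g S * ((C ∩ S).card : ℝ) := by
  simp_rw [Finset.sum_filter]
  rw [Finset.sum_comm]
  refine Finset.sum_congr rfl fun S _ => ?_
  rw [← Finset.sum_filter, Finset.sum_const, nsmul_eq_mul, mul_comm, Finset.filter_mem_eq_inter]

theorem clique_bound {V : Type*} [Fintype V] [DecidableEq V] (G : SimpleGraph V)
    (g : Finset V → ℝ) (h0 : ∀ S, 0 ≤ g S)
    (hst : ∀ S : Finset V, g S ≠ 0 → ∀ u ∈ S, ∀ v ∈ S, ¬ G.Adj u v) (C : Finset V)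
    (hC : ∀ u ∈ C, ∀ v ∈ C, u ≠ v → G.Adj u v) :
    ∑ v ∈ C, ∑ S ∈ Finset.univ.filter (fun S : Finset V => v ∈ S), g S ≤ ∑ S, g S := by
  rw [swap_sum]
  refine Finset.sum_le_sum fun S _ => ?_
  by_cases h : g S = 0
  · simp [h]
  · have : (C ∩ S).card ≤ 1 := by
      rw [Finset.card_le_one]
      intro a ha b hb
      rw [Finset.mem_inter] at ha hb
      by_contra hab
      exact hst S h a ha.2 b hb.2 (hC a ha.1 b hb.1 hab)
    have : ((C ∩ S).card : ℝ) ≤ 1 := by exact_mod_cast this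
    nlinarith [h0 S]

theorem main_color {V : Type*} [Fintype V] [DecidableEq V] (G : SimpleGraph V) (e : V → ℕ)
    (he : Function.Injective e)
    (H : ∀ u v, e u < e v → G.Adj u v →
      (∀ a ∈ inr e u v, ∀ b ∈ inr e u v, a ≠ b → G.Adj a b) ∨
      (∀ a ∈ otr e u v, ∀ b ∈ otr e u v, a ≠ b → G.Adj a b))
    (w : Finset V → ℝ) (k : ℕ) (hk : 0 < k) (hw0 : ∀ S, 0 ≤ w S)
    (hst : ∀ S : Finset V, w S ≠ 0 → ∀ u ∈ S, ∀ v ∈ S, ¬ G.Adj u v)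
    (hsum : ∑ S, w S = k)
    (hv : ∀ v : V, ∑ S ∈ Finset.univ.filter (fun S : Finset V => v ∈ S), w S = 1) :
    G.Colorable k := by
  classical
  set n := Fintype.card V with hn
  set q := n / k with hq
  set s := n % k with hs
  have hnqs : k * q + s = n := Nat.div_add_mod n k
  have hsk : s < k := Nat.mod_lt _ hk
  have hnqsR : (k : ℝ) * q + s = n := by exact_mod_cast hnqs
  have hskR : (s : ℝ) ≤ k := by exact_mod_cast hsk.le
  have hsz : ∑ S, w S * (S.card : ℝ) = n := by
    have := swap_sum w Finset.univ
    simp only [hv, Finset.univ_inter] at this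
    rw [← this]; simp [hn]
  obtain ⟨θ, hθ, hθ1, hθ2⟩ := theta w hw0 (fun S => (S.card : ℤ) - q) k s (by exact_mod_cast hk)
    (by positivity) hskR hsum (by
      push_cast
      simp_rw [mul_sub]
      rw [Finset.sum_sub_distrib, hsz, ← Finset.sum_mul, hsum]; linarith)
  set x : V → ℝ := fun v => ∑ S ∈ Finset.univ.filter (fun S : Finset V => v ∈ S), w S * θ S with hx
  have hx1 : ∀ v, 1 - x v =
      ∑ S ∈ Finset.univ.filter (fun S : Finset V => v ∈ S), w S * (1 - θ S) := by
    intro v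
    rw [hx]
    simp only
    simp_rw [mul_sub, mul_one]
    rw [Finset.sum_sub_distrib, hv v]
  have hg1 : ∀ S, 0 ≤ w S * θ S := fun S => mul_nonneg (hw0 S) (hθ S).1
  have hg2 : ∀ S, 0 ≤ w S * (1 - θ S) := fun S => mul_nonneg (hw0 S) (sub_nonneg.2 (hθ S).2)
  have hx0 : ∀ v, 0 ≤ x v := fun v => Finset.sum_nonneg fun S _ => hg1 S
  have hxle : ∀ v, x v ≤ 1 := fun v => by
    have : 0 ≤ 1 - x v := by rw [hx1]; exact Finset.sum_nonneg fun S _ => hg2 S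
    linarith
  have hxs : ∑ v, x v = (((k - s) * q : ℤ) : ℝ) := by
    have := swap_sum (fun S => w S * θ S) Finset.univ
    rw [hx]
    simp only [Finset.univ_inter] at this ⊢
    rw [this]
    push_cast at hθ2 ⊢
    simp_rw [mul_sub] at hθ2
    rw [Finset.sum_sub_distrib, ← Finset.sum_mul, hθ1] at hθ2
    linarith
  have hc1 : ∀ C : Finset V, (∀ u ∈ C, ∀ v ∈ C, u ≠ v → G.Adj u v) →
      ∑ v ∈ C, x v ≤ ((k - s : ℤ) : ℝ) := by
    intro C hC
    push_cast
    rw [← hθ1]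
    exact clique_bound G (fun S => w S * θ S) hg1 (fun S h => hst S (left_ne_zero_of_mul h)) C hC
  have hc2 : ∀ C : Finset V, (∀ u ∈ C, ∀ v ∈ C, u ≠ v → G.Adj u v) →
      ((C.card - s : ℤ) : ℝ) ≤ ∑ v ∈ C, x v := by
    intro C hC
    push_cast
    have := clique_bound G (fun S => w S * (1 - θ S)) hg2
      (fun S h => hst S (left_ne_zero_of_mul h)) C hC
    simp_rw [← hx1, mul_sub, mul_one] at this
    rw [Finset.sum_sub_distrib, Finset.sum_sub_distrib, hθ1, hsum] at this
    simp at this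
    linarith
  obtain ⟨x', hs', hin, hout⟩ := rounding e he x _ hxs
  have hsing : ∀ v, inr e v v = {v} := by
    intro v; ext a
    simp only [inr, Finset.mem_filter, Finset.mem_univ, true_and, Finset.mem_singleton]
    constructor
    · intro h; apply he; omega
    · rintro rfl; simp
  have hx01 : ∀ v, x' v = 0 ∨ x' v = 1 := by
    intro v
    have h1 := (hin v v le_rfl 1).1
    have h0 := (hin v v le_rfl 0).2
    simp only [hsing, Finset.sum_singleton] at h0 h1
    have := h1 (by simpa using hxle v)
    have := h0 (by simpa using hx0 v)
    omega
  set X : Finset V := Finset.univ.filter (fun v => x' v = 1) with hX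
  have hxi : ∀ v, x' v = if v ∈ X then 1 else 0 := by
    intro v
    rcases hx01 v with h | h <;> simp [hX, h]
  have hcard : ∀ C : Finset V, ∑ v ∈ C, x' v = ((X ∩ C).card : ℤ) := by
    intro C
    simp_rw [hxi]
    rw [Finset.sum_ite_mem, Finset.inter_comm]; simp
  have hcard2 : ∀ C : Finset V, ((Xᶜ ∩ C).card : ℤ) = C.card - (X ∩ C).card := by
    intro C
    have := Finset.card_inter_add_card_sdiff C X
    have h2 : C \ X = Xᶜ ∩ C := by ext; simp; tauto
    rw [h2, Finset.inter_comm] at this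
    omega
  have hXc : (X.card : ℤ) = (k - s) * q := by
    have := hcard Finset.univ
    rw [hs', Finset.inter_univ] at this
    exact this.symm
  have hXcn : X.card = (k - s) * q := by
    zify [hsk.le]; exact hXc
  have hYc : Xᶜ.card = s * (q + 1) := by
    have := hcard2 Finset.univ
    rw [Finset.inter_univ, Finset.inter_univ, hXc, Finset.card_univ, ← hn, ← hnqs] at this
    zify; rw [this]; push_cast; ring
  obtain ⟨c1, h11, h12⟩ := color_part G e he X (k - s) q hXcn (by
    intro u v huv hadj
    rcases H u v huv hadj with h | h
    · left
      have := (hin u v huv.le _).1 (hc1 _ h)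
      rw [hcard] at this; omega
    · right
      have := (hout u v huv _).1 (hc1 _ h)
      rw [hcard] at this; omega)
  obtain ⟨c2, h21, h22⟩ := color_part G e he Xᶜ s (q + 1) hYc (by
    intro u v huv hadj
    rcases H u v huv hadj with h | h
    · left
      have := (hin u v huv.le _).2 (hc2 _ h)
      rw [hcard] at this
      have := hcard2 (inr e u v)
      omega
    · right
      have := (hout u v huv _).2 (hc2 _ h)
      rw [hcard] at this
      have := hcard2 (otr e u v)
      omega)
  have hmem : ∀ v, v ∉ X → v ∈ Xᶜ := fun v h => Finset.mem_compl.2 h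
  refine ⟨SimpleGraph.Coloring.mk
    (fun v => (⟨if v ∈ X then c1 v else (k - s) + c2 v, ?_⟩ : Fin k)) ?_⟩
  · split_ifs with h
    · have := h11 v h; omega
    · have := h21 v (hmem v h); omega
  · intro u v hadj heq
    rw [Fin.mk.injEq] at heq
    by_cases hu : u ∈ X <;> by_cases hv' : v ∈ X <;> simp only [hu, hv', if_true, if_false] at heq
    · exact h12 u hu v hv' hadj heq
    · have := h11 u hu; omega
    · have := h11 v hv'; omega
    · exact h22 u (hmem u hu) v (hmem v hv') hadj (by omega)

theorem circ_struct {V : Type*} [Fintype V] [DecidableEq V]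
    (G : SimpleGraph V) (hG : IsCircularIntervalGraph G) :
    ∃ e : V → ℕ, Function.Injective e ∧ ∀ u v, e u < e v → G.Adj u v →
      (∀ a ∈ inr e u v, ∀ b ∈ inr e u v, a ≠ b → G.Adj a b) ∨
      (∀ a ∈ otr e u v, ∀ b ∈ otr e u v, a ≠ b → G.Adj a b) := by
  classical
  obtain ⟨p, 𝓘, hp, hI, hadj⟩ := hG
  have hf : ∀ v, ∃ t : ℝ, 0 ≤ t ∧ t < 1 ∧ (t : AddCircle (1 : ℝ)) = p v := by
    intro v
    obtain ⟨y, hy⟩ := QuotientAddGroup.mk_surjective (p v)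
    refine ⟨Int.fract y, Int.fract_nonneg _, Int.fract_lt_one _, ?_⟩
    rw [← hy]
    have : Int.fract y = y - ⌊y⌋ := rfl
    rw [this]
    apply (QuotientAddGroup.eq).2
    rw [AddSubgroup.mem_zmultiples_iff]
    exact ⟨⌊y⌋, by simp only [zsmul_eq_mul, mul_one]; linarith⟩
  choose f f0 f1 fp using hf
  have finj : Function.Injective f := by
    intro u v h; apply hp; rw [← fp, ← fp, h]
  have hshift : ∀ (t : ℝ) (j : ℤ), ((t + j : ℝ) : AddCircle (1 : ℝ)) = (t : AddCircle (1 : ℝ)) := by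
    intro t j
    apply (QuotientAddGroup.eq).2
    rw [AddSubgroup.mem_zmultiples_iff]
    exact ⟨-j, by simp⟩
  have hlift : ∀ (t y : ℝ), (t : AddCircle (1 : ℝ)) = (y : AddCircle (1 : ℝ)) →
      ∃ j : ℤ, t = y + j := by
    intro t y h
    have := (QuotientAddGroup.eq).1 h
    rw [AddSubgroup.mem_zmultiples_iff] at this
    obtain ⟨j, hj⟩ := this
    refine ⟨-j, ?_⟩
    simp at hj
    push_cast
    linarith
  let e : V → ℕ := fun v => (Finset.univ.filter (fun w => f w < f v)).card
  have emono : ∀ u v, f u < f v → e u < e v := by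
    intro u v h
    apply Finset.card_lt_card
    rw [Finset.ssubset_iff_of_subset]
    · exact ⟨u, by simp [h], by simp⟩
    · intro a; simp; intro h'; linarith
  have ele : ∀ u v, e u ≤ e v → f u ≤ f v := by
    intro u v h; by_contra h'
    have := emono v u (not_le.1 h'); omega
  refine ⟨e, ?_, ?_⟩
  · intro u v h
    exact finj (le_antisymm (ele _ _ h.le) (ele _ _ h.ge))
  intro u v huv ha
  obtain ⟨I, hII, hu, hv⟩ := (hadj u v ha.ne).1 ha
  obtain ⟨a, b, rfl⟩ := hI I hII
  have mk : ∀ C : Finset V, (∀ c ∈ C, ∃ j : ℤ, a ≤ f c + j ∧ f c + j ≤ b) →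
      ∀ c ∈ C, ∀ d ∈ C, c ≠ d → G.Adj c d := by
    intro C hC c hc d hd hcd
    refine (hadj c d hcd).2 ⟨_, hII, ?_, ?_⟩
    · obtain ⟨j, h1, h2⟩ := hC c hc
      exact ⟨f c + j, ⟨h1, h2⟩, by simp only [hshift, fp]⟩
    · obtain ⟨j, h1, h2⟩ := hC d hd
      exact ⟨f d + j, ⟨h1, h2⟩, by simp only [hshift, fp]⟩
  obtain ⟨α, ⟨hα1, hα2⟩, hα⟩ := hu
  obtain ⟨β, ⟨hβ1, hβ2⟩, hβ⟩ := hv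
  simp only [← fp] at hα hβ
  obtain ⟨i, rfl⟩ := hlift _ _ hα
  obtain ⟨j, rfl⟩ := hlift _ _ hβ
  rcases le_or_gt i j with hij | hij
  · left
    have hij' : (i : ℝ) ≤ j := by exact_mod_cast hij
    apply mk
    intro c hc
    simp only [inr, Finset.mem_filter, Finset.mem_univ, true_and] at hc
    have h1 := ele _ _ hc.1
    have h2 := ele _ _ hc.2
    exact ⟨i, by linarith, by linarith⟩
  · right
    have hij' : (j : ℝ) + 1 ≤ i := by exact_mod_cast hij
    apply mk
    intro c hc
    simp only [otr, Finset.mem_filter, Finset.mem_univ, true_and] at hc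
    have := f0 c
    have := f1 c
    have := f0 u
    have := f1 v
    rcases hc with hc | hc
    · have h1 := ele _ _ hc
      exact ⟨i, by linarith, by linarith⟩
    · have h1 := ele _ _ hc
      exact ⟨j, by linarith, by linarith⟩

theorem frac_of_colorable {V : Type*} [Fintype V] [DecidableEq V]
    (G : SimpleGraph V) (k : ℕ) (h : G.Colorable k) :
    ∃ w : Finset V → ℝ, IsFractionalColoring G w k := by
  classical
  obtain ⟨c⟩ := h
  let cl : Fin k → Finset V := fun i => Finset.univ.filter (fun v => c v = i)
  refine ⟨fun S => ∑ i, if cl i = S then 1 else 0, ?_, ?_, ?_, ?_⟩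
  · intro S; exact Finset.sum_nonneg fun i _ => by split_ifs <;> simp
  · intro S hS u hu v hv hadj
    obtain ⟨i, _, hi⟩ := Finset.exists_ne_zero_of_sum_ne_zero hS
    have : cl i = S := by by_contra h; simp [h] at hi
    subst this
    simp [cl] at hu hv
    exact c.valid hadj (hu.trans hv.symm)
  · rw [Finset.sum_comm]; simp
  · intro v
    rw [Finset.sum_comm]
    simp [cl]

theorem frac_least {V : Type*} [Fintype V] [DecidableEq V] (G : SimpleGraph V) :
    IsLeast {c : ℝ | ∃ w : Finset V → ℝ, IsFractionalColoring G w c} (fracChromatic G) := by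
  classical
  obtain ⟨w1, hw1⟩ := frac_of_colorable G _ G.colorable_of_fintype
  set N : ℝ := ((Fintype.card V : ℕ) : ℝ) with hN
  let K : Set (Finset V → ℝ) := {w | IsFractionalColoring G w N}
  have hKc : IsClosed K := by
    have : K = (⋂ S, {w | 0 ≤ w S}) ∩ ((⋂ S : Finset V, ⋂ (_ : ¬ ∀ u ∈ S, ∀ v ∈ S, ¬ G.Adj u v),
        {w : Finset V → ℝ | w S = 0}) ∩ ({w | ∑ S, w S ≤ N} ∩
        ⋂ v : V, {w | ∑ S ∈ Finset.univ.filter (fun S : Finset V => v ∈ S), w S = 1})) := by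
      ext w
      simp only [K, IsFractionalColoring, Set.mem_setOf_eq, Set.mem_inter_iff, Set.mem_iInter]
      have : (∀ S : Finset V, w S ≠ 0 → ∀ u ∈ S, ∀ v ∈ S, ¬ G.Adj u v) ↔
        (∀ S : Finset V, (¬ ∀ u ∈ S, ∀ v ∈ S, ¬ G.Adj u v) → w S = 0) :=
        forall_congr' fun S => not_imp_comm
      rw [this]
    rw [this]
    refine IsClosed.inter (isClosed_iInter fun S => ?_) (IsClosed.inter
      (isClosed_iInter fun S => isClosed_iInter fun _ => ?_) (IsClosed.inter ?_
      (isClosed_iInter fun v => ?_)))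
    · exact isClosed_le (by fun_prop) (by fun_prop)
    · exact isClosed_eq (by fun_prop) (by fun_prop)
    · exact isClosed_le (by fun_prop) (by fun_prop)
    · exact isClosed_eq (by fun_prop) (by fun_prop)
  have hK : IsCompact K := by
    refine IsCompact.of_isClosed_subset (isCompact_Icc (a := (fun _ => 0 : Finset V → ℝ))
      (b := fun _ => N)) hKc ?_
    intro w hw
    refine ⟨fun S => hw.1 S, fun S => ?_⟩
    exact (Finset.single_le_sum (fun i _ => hw.1 i) (Finset.mem_univ S)).trans hw.2.2.1
  obtain ⟨w0, hw0, hmin⟩ := hK.exists_isMinOn ⟨w1, hw1⟩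
    (f := fun w => ∑ S, w S) (by fun_prop)
  have hl : IsLeast {c : ℝ | ∃ w : Finset V → ℝ, IsFractionalColoring G w c} (∑ S, w0 S) := by
    refine ⟨⟨w0, hw0.1, hw0.2.1, le_rfl, hw0.2.2.2⟩, ?_⟩
    rintro c ⟨w, hw⟩
    rcases le_or_gt (∑ S, w S) N with h | h
    · have : w ∈ K := ⟨hw.1, hw.2.1, h, hw.2.2.2⟩
      exact (isMinOn_iff.1 hmin w this).trans hw.2.2.1
    · exact hw0.2.2.1.trans (h.le.trans hw.2.2.1)
  have : fracChromatic G = ∑ S, w0 S := hl.csInf_eq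
  rw [this]; exact hl

theorem colorable_of_frac {V : Type*} [Fintype V] [DecidableEq V]
    (G : SimpleGraph V) (hG : IsCircularIntervalGraph G) (k : ℕ)
    (h : fracChromatic G ≤ k) : G.Colorable k := by
  classical
  obtain ⟨w, h0, hst, hs, hv⟩ := (frac_least G).1
  obtain ⟨e, he, H⟩ := circ_struct G hG
  rcases Nat.eq_zero_or_pos k with rfl | hk
  · have : IsEmpty V := by
      refine ⟨fun v => ?_⟩
      have h1 := hv v
      have h2 : ∑ S ∈ Finset.univ.filter (fun S : Finset V => v ∈ S), w S ≤ ∑ S, w S :=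
        Finset.sum_le_sum_of_subset_of_nonneg (Finset.filter_subset _ _) fun S _ _ => h0 S
      push_cast at h
      linarith
    exact ⟨SimpleGraph.Coloring.mk (fun v => isEmptyElim v) (fun {v} => isEmptyElim v)⟩
  set δ := (k : ℝ) - ∑ S, w S with hδ
  have hδ0 : 0 ≤ δ := by linarith
  refine main_color G e he H (fun S => w S + if S = ∅ then δ else 0) k hk ?_ ?_ ?_ ?_
  · intro S
    have := h0 S
    split_ifs <;> linarith
  · intro S hS u hu v hv'
    have : S ≠ ∅ := Finset.ne_empty_of_mem hu
    simp only [this, if_false, add_zero] at hS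
    exact hst S hS u hu v hv'
  · rw [Finset.sum_add_distrib]; simp [hδ]
  · intro v
    rw [← hv v]
    refine Finset.sum_congr rfl fun S hS => ?_
    have : S ≠ ∅ := Finset.ne_empty_of_mem (Finset.mem_filter.1 hS).2
    simp [this]

/-- For any finite circular interval graph `G`, `χ(G) = ⌈χ_f(G)⌉`. -/
theorem circularInterval_chromatic_eq_ceil_frac {V : Type*} [Fintype V] [DecidableEq V]
    (G : SimpleGraph V) (hG : IsCircularIntervalGraph G) :
    G.chromaticNumber = (⌈fracChromatic G⌉₊ : ℕ∞) := by
  apply le_antisymm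
  · exact (colorable_of_frac G hG _ (Nat.le_ceil _)).chromaticNumber_le
  · rw [SimpleGraph.le_chromaticNumber_iff_colorable]
    intro m hm
    exact Nat.ceil_le.2 ((frac_least G).2 (frac_of_colorable G m hm))
end

section
/- Let c ≥ 1 be a real number and let G' be a finite simple graph that is the line graph of a multigraph. If χ_f(G') ≤ c + (1/3)·√c, then χ(G') ≤ ⌊c + 3·√c⌋. -/
section Core

set_option linter.unusedSectionVars false

open Finset

variable {E W : Type*} [Fintype W] [DecidableEq W] [DecidableEq E] {N : ℕ}

/-- proper colouring on the edges in `F` -/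
def PC (f : E → Sym2 W) (F : Finset E) (φ : E → Fin N) : Prop :=
  ∀ e ∈ F, ∀ e' ∈ F, ∀ w, w ∈ f e → w ∈ f e' → φ e = φ e' → e = e'

/-- colour `c` is missing at `w` -/
def Miss (f : E → Sym2 W) (F : Finset E) (φ : E → Fin N) (w : W) (c : Fin N) : Prop :=
  ∀ e ∈ F, w ∈ f e → φ e ≠ c

/-- closed under two colours -/
def KClosed (f : E → Sym2 W) (F : Finset E) (φ : E → Fin N) (K : Set W) (a b : Fin N) : Prop :=
  ∀ e ∈ F, (φ e = a ∨ φ e = b) → ∀ w ∈ f e, ∀ w' ∈ f e, w ∈ K → w' ∈ K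

open Classical in
/-- Kempe swap on `K` -/
noncomputable def kswap (f : E → Sym2 W) (K : Set W) (a b : Fin N) (φ : E → Fin N) : E → Fin N :=
  fun e => if ∃ w ∈ f e, w ∈ K then Equiv.swap a b (φ e) else φ e

lemma kswap_of_ne (f : E → Sym2 W) (K : Set W) (a b : Fin N) (φ : E → Fin N) (e : E)
    (h1 : φ e ≠ a) (h2 : φ e ≠ b) : kswap f K a b φ e = φ e := by
  unfold kswap
  split_ifs
  · exact Equiv.swap_apply_of_ne_of_ne h1 h2
  · rfl

lemma kswap_mem (f : E → Sym2 W) (K : Set W) (a b : Fin N) (φ : E → Fin N) (e : E)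
    (h : φ e = a ∨ φ e = b) : kswap f K a b φ e = a ∨ kswap f K a b φ e = b := by
  unfold kswap
  split_ifs
  · rcases h with h | h <;> simp [h]
  · exact h

lemma kswap_in (f : E → Sym2 W) (K : Set W) (a b : Fin N) (φ : E → Fin N) (e : E) (w : W)
    (hw : w ∈ f e) (hK : w ∈ K) : kswap f K a b φ e = Equiv.swap a b (φ e) := by
  unfold kswap
  rw [if_pos ⟨w, hw, hK⟩]

lemma kswap_out {f : E → Sym2 W} {F : Finset E} {φ : E → Fin N} {K : Set W} {a b : Fin N}
    (hK : KClosed f F φ K a b) (e : E) (he : e ∈ F) (w : W)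
    (hw : w ∈ f e) (hwK : w ∉ K) : kswap f K a b φ e = φ e := by
  unfold kswap
  split_ifs with h
  · obtain ⟨v, hv, hvK⟩ := h
    by_cases h1 : φ e = a ∨ φ e = b
    · exact absurd (hK e he h1 v hv w hw hvK) hwK
    · push Not at h1
      exact Equiv.swap_apply_of_ne_of_ne h1.1 h1.2
  · rfl

lemma kswap_PC {f : E → Sym2 W} {F : Finset E} {φ : E → Fin N} {K : Set W} {a b : Fin N}
    (hφ : PC f F φ) (hK : KClosed f F φ K a b) : PC f F (kswap f K a b φ) := by
  intro e he e' he' w hw hw' h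
  apply hφ e he e' he' w hw hw'
  by_cases hwK : w ∈ K
  · rw [kswap_in f K a b φ e w hw hwK, kswap_in f K a b φ e' w hw' hwK] at h
    exact (Equiv.swap a b).injective h
  · rwa [kswap_out hK e he w hw hwK, kswap_out hK e' he' w hw' hwK] at h

lemma kswap_miss_in {f : E → Sym2 W} {F : Finset E} {φ : E → Fin N} {K : Set W} {a b : Fin N}
    (w : W) (hwK : w ∈ K) (c : Fin N) :
    Miss f F (kswap f K a b φ) w (Equiv.swap a b c) ↔ Miss f F φ w c := by
  unfold Miss
  refine forall₃_congr fun e he hw => ?_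
  rw [kswap_in f K a b φ e w hw hwK]
  simp

lemma kswap_miss_out {f : E → Sym2 W} {F : Finset E} {φ : E → Fin N} {K : Set W} {a b : Fin N}
    (hK : KClosed f F φ K a b) (w : W) (hwK : w ∉ K) (c : Fin N) :
    Miss f F (kswap f K a b φ) w c ↔ Miss f F φ w c := by
  unfold Miss
  refine forall₃_congr fun e he hw => ?_
  rw [kswap_out hK e he w hw hwK]

lemma kswap_miss_ne {f : E → Sym2 W} {F : Finset E} {φ : E → Fin N} {K : Set W} {a b : Fin N}
    (hK : KClosed f F φ K a b) (w : W) (c : Fin N) (h1 : c ≠ a) (h2 : c ≠ b) :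
    Miss f F (kswap f K a b φ) w c ↔ Miss f F φ w c := by
  by_cases hwK : w ∈ K
  · have := kswap_miss_in (f := f) (F := F) (φ := φ) (a := a) (b := b) w hwK c
    rwa [Equiv.swap_apply_of_ne_of_ne h1 h2] at this
  · exact kswap_miss_out hK w hwK c

/-- graph of the two colours outside `X` -/
def KG (f : E → Sym2 W) (F : Finset E) (φ : E → Fin N) (X : Finset W) (a b : Fin N) :
    SimpleGraph W where
  Adj w w' := w ≠ w' ∧ w ∉ X ∧ w' ∉ X ∧ ∃ e ∈ F, f e = s(w, w') ∧ (φ e = a ∨ φ e = b)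
  symm := ⟨by
    rintro w w' ⟨h1, h2, h3, e, he, h4, h5⟩
    exact ⟨h1.symm, h3, h2, e, he, by rw [h4, Sym2.eq_swap], h5⟩⟩
  loopless := ⟨fun w h => h.1 rfl⟩

lemma KClosed_comp (f : E → Sym2 W) (F : Finset E) (φ : E → Fin N) (a b : Fin N) (x : W) :
    KClosed f F φ {w | (KG f F φ ∅ a b).Reachable x w} a b := by
  intro e he hc w hw w' hw' hx
  by_cases h : w = w'
  · exact h ▸ hx
  · refine SimpleGraph.Reachable.trans hx (SimpleGraph.Adj.reachable ?_)
    exact ⟨h, by simp, by simp, e, he, (Sym2.mem_and_mem_iff h).1 ⟨hw, hw'⟩, hc⟩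

open Classical in
lemma degree_le_of_colors {f : E → Sym2 W} {F : Finset E} {φ : E → Fin N} (hφ : PC f F φ)
    (G : SimpleGraph W) (w : W) (C : Finset (Fin N))
    (h : ∀ w', G.Adj w w' → ∃ e ∈ F, f e = s(w, w') ∧ φ e ∈ C) : G.degree w ≤ C.card := by
  rw [← SimpleGraph.card_neighborFinset_eq_degree]
  rcases (G.neighborFinset w).eq_empty_or_nonempty with h0 | ⟨v0, hv0⟩
  · simp [h0]
  obtain ⟨e0, -, -⟩ := h v0 (by simpa using hv0)
  have h' : ∀ w' : W, ∃ c : Fin N, G.Adj w w' → (c ∈ C ∧ ∃ e ∈ F, f e = s(w, w') ∧ φ e = c) := by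
    intro w'
    by_cases hw : G.Adj w w'
    · obtain ⟨e, he, h1, h2⟩ := h w' hw
      exact ⟨φ e, fun _ => ⟨h2, e, he, h1, rfl⟩⟩
    · exact ⟨φ e0, fun h => absurd h hw⟩
  choose g hg using h'
  apply Finset.card_le_card_of_injOn g
  · intro w' hw'
    exact (hg w' (by simpa using hw')).1
  · intro w1 h1 w2 h2 h12
    obtain ⟨-, e1, he1, hf1, hc1⟩ := hg w1 (by simpa using h1)
    obtain ⟨-, e2, he2, hf2, hc2⟩ := hg w2 (by simpa using h2)
    have : e1 = e2 := hφ e1 he1 e2 he2 w (by simp [hf1]) (by simp [hf2]) (by rw [hc1, hc2, h12])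
    subst this
    rw [hf1] at hf2
    exact Sym2.congr_right.1 hf2

open Classical in
lemma three_ends (G : SimpleGraph W) (h2 : ∀ w, G.degree w ≤ 2) (x y z : W) (hxy : x ≠ y)
    (hxz : x ≠ z) (hyz : y ≠ z) (hx : G.degree x ≤ 1) (hy : G.degree y ≤ 1) (hz : G.degree z ≤ 1)
    (rxy : G.Reachable x y) (rxz : G.Reachable x z) : False := by
  set c := G.connectedComponentMk x with hc
  have hconn := c.connected_toSimpleGraph
  have hcard := hconn.card_vert_le_card_edgeSet_add_one
  set H := c.toSimpleGraph with hH
  have hdeg : ∀ v : c, H.degree v ≤ G.degree v.1 := by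
    intro v
    rw [← SimpleGraph.card_neighborFinset_eq_degree, ← SimpleGraph.card_neighborFinset_eq_degree]
    apply Finset.card_le_card_of_injOn (fun u => u.1)
    · intro u hu
      have hu' : H.Adj v u := by simpa using hu
      have : G.Adj v.1 u.1 := hu'
      simpa using this
    · intro u _ u' _ h
      exact Subtype.ext h
  have hsum := H.sum_degrees_eq_twice_card_edges
  have hx' : x ∈ c := rfl
  have hy' : y ∈ c := by
    change _ ∈ c.supp
    rw [SimpleGraph.ConnectedComponent.mem_supp_iff, hc, SimpleGraph.ConnectedComponent.eq]
    exact rxy.symm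
  have hz' : z ∈ c := by
    change _ ∈ c.supp
    rw [SimpleGraph.ConnectedComponent.mem_supp_iff, hc, SimpleGraph.ConnectedComponent.eq]
    exact rxz.symm
  have key : ∑ v : c, (H.degree v + if v ∈ ({⟨x, hx'⟩, ⟨y, hy'⟩, ⟨z, hz'⟩} : Finset c)
      then 1 else 0) ≤ ∑ v : c, 2 := by
    apply Finset.sum_le_sum
    intro v _
    split_ifs with hv
    · have h1 := hdeg v
      simp only [Finset.mem_insert, Finset.mem_singleton] at hv
      rcases hv with rfl | rfl | rfl
      · simp only at h1; omega
      · simp only at h1; omega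
      · simp only at h1; omega
    · exact (hdeg v).trans (h2 v.1)
  rw [Finset.sum_add_distrib, hsum] at key
  simp only [Finset.sum_const, Finset.sum_ite_mem, Finset.univ_inter, Finset.card_univ,
    smul_eq_mul] at key
  have h3 : ({⟨x, hx'⟩, ⟨y, hy'⟩, ⟨z, hz'⟩} : Finset c).card = 3 :=
    Finset.card_eq_three.2 ⟨_, _, _, by simpa using hxy, by simpa using hxz, by simpa using hyz, rfl⟩
  rw [h3] at key
  have h4 : Nat.card H.edgeSet = H.edgeFinset.card := by
    rw [Nat.card_eq_fintype_card, SimpleGraph.edgeFinset_card]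
  rw [h4, Nat.card_eq_fintype_card] at hcard
  omega

open Classical in
lemma KG_degree_two {f : E → Sym2 W} {F : Finset E} {φ : E → Fin N} (hφ : PC f F φ)
    (X : Finset W) (a b : Fin N) (w : W) : (KG f F φ X a b).degree w ≤ 2 := by
  refine (degree_le_of_colors hφ _ w {a, b} ?_).trans Finset.card_le_two
  rintro w' ⟨-, -, -, e, he, h1, h2⟩
  exact ⟨e, he, h1, by simpa using h2⟩

open Classical in
lemma KG_degree_one {f : E → Sym2 W} {F : Finset E} {φ : E → Fin N} (hφ : PC f F φ)
    (X : Finset W) (a b : Fin N) (w : W) (h : Miss f F φ w a ∨ Miss f F φ w b) :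
    (KG f F φ X a b).degree w ≤ 1 := by
  rcases h with h | h
  · refine (degree_le_of_colors hφ _ w {b} ?_).trans (by simp)
    rintro w' ⟨-, -, -, e, he, h1, h2⟩
    have := h e he (by simp [h1])
    exact ⟨e, he, h1, by simpa using h2.resolve_left this⟩
  · refine (degree_le_of_colors hφ _ w {a} ?_).trans (by simp)
    rintro w' ⟨-, -, -, e, he, h1, h2⟩
    have := h e he (by simp [h1])
    exact ⟨e, he, h1, by simpa using h2.resolve_right this⟩

end Core
section Tash

set_option linter.unusedSectionVars false

open Finset

variable {E W : Type*} [Fintype W] [DecidableEq W] [DecidableEq E] {N : ℕ}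

/-- vertices of the tree given by a list of (edge, new vertex), most recent first -/
def tverts (a b : W) : List (E × W) → Finset W
  | [] => {a, b}
  | p :: L => insert p.2 (tverts a b L)

/-- Tashkinov trees -/
def TT (f : E → Sym2 W) (F : Finset E) (a b : W) (φ : E → Fin N) : List (E × W) → Prop
  | [] => True
  | p :: L => TT f F a b φ L ∧ p.1 ∈ F ∧ p.2 ∉ tverts a b L ∧
      (∃ x ∈ tverts a b L, f p.1 = s(x, p.2)) ∧ ∃ v ∈ tverts a b L, Miss f F φ v (φ p.1)

/-- elementary sets -/
def Elem (f : E → Sym2 W) (F : Finset E) (φ : E → Fin N) (T : Finset W) : Prop :=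
  ∀ x ∈ T, ∀ y ∈ T, ∀ c, Miss f F φ x c → Miss f F φ y c → x = y

lemma tverts_append (a b : W) (L1 L2 : List (E × W)) : tverts a b L2 ⊆ tverts a b (L1 ++ L2) := by
  induction L1 with
  | nil => simp
  | cons p L ih => exact ih.trans (Finset.subset_insert _ _)

lemma tverts_card {f : E → Sym2 W} {F : Finset E} {a b : W} {φ : E → Fin N} (hab : a ≠ b)
    (L : List (E × W)) (h : TT f F a b φ L) : (tverts a b L).card = L.length + 2 := by
  induction L with
  | nil => simp [tverts, hab]
  | cons p L ih =>
    obtain ⟨h1, h2, h3, h4, h5⟩ := h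
    simp only [tverts, List.length_cons]
    rw [Finset.card_insert_of_notMem h3, ih h1]

lemma TT_append {f : E → Sym2 W} {F : Finset E} {a b : W} {φ : E → Fin N}
    (L1 L2 : List (E × W)) (h : TT f F a b φ (L1 ++ L2)) : TT f F a b φ L2 := by
  induction L1 with
  | nil => simpa using h
  | cons p L ih => exact ih h.1

lemma TT_edge {f : E → Sym2 W} {F : Finset E} {a b : W} {φ : E → Fin N}
    (L : List (E × W)) (h : TT f F a b φ L) (p : E × W) (hp : p ∈ L) :
    p.1 ∈ F ∧ (∀ w ∈ f p.1, w ∈ tverts a b L) ∧ ∃ v ∈ tverts a b L, Miss f F φ v (φ p.1) := by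
  induction L with
  | nil => simp at hp
  | cons q L ih =>
    obtain ⟨h1, h2, h3, ⟨x, hx, hf⟩, v, hv, hm⟩ := h
    rcases List.mem_cons.1 hp with rfl | hp
    · refine ⟨h2, ?_, v, Finset.mem_insert_of_mem hv, hm⟩
      intro w hw
      rw [hf, Sym2.mem_iff] at hw
      rcases hw with rfl | rfl
      · exact Finset.mem_insert_of_mem hx
      · exact Finset.mem_insert_self _ _
    · obtain ⟨i1, i2, v, hv, hm⟩ := ih h1 hp
      exact ⟨i1, fun w hw => Finset.mem_insert_of_mem (i2 w hw), v, Finset.mem_insert_of_mem hv, hm⟩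

lemma TT_mono {f : E → Sym2 W} {F : Finset E} {a b : W} {φ φ' : E → Fin N}
    (L : List (E × W)) (h : TT f F a b φ L) (h1 : ∀ p ∈ L, φ' p.1 = φ p.1)
    (h2 : ∀ v ∈ tverts a b L, ∀ p ∈ L, Miss f F φ v (φ p.1) → Miss f F φ' v (φ p.1)) :
    TT f F a b φ' L := by
  induction L with
  | nil => trivial
  | cons q L ih =>
    obtain ⟨i1, i2, i3, i4, v, hv, hm⟩ := h
    refine ⟨ih i1 (fun p hp => h1 p (List.mem_cons_of_mem _ hp)) ?_, i2, i3, i4, v, hv, ?_⟩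
    · intro v hv p hp
      exact h2 v (Finset.mem_insert_of_mem hv) p (List.mem_cons_of_mem _ hp)
    · rw [h1 q List.mem_cons_self]
      exact h2 v (Finset.mem_insert_of_mem hv) q List.mem_cons_self hm

lemma TT_unused {f : E → Sym2 W} {F : Finset E} {a b : W} {φ : E → Fin N} {K : Set W}
    {α δ : Fin N} (hK : KClosed f F φ K α δ)
    (L : List (E × W)) (h : TT f F a b φ L) (h1 : ∀ p ∈ L, φ p.1 ≠ α) (h2 : ∀ p ∈ L, φ p.1 ≠ δ) :
    TT f F a b (kswap f K α δ φ) L := by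
  refine TT_mono L h (fun p hp => kswap_of_ne f K α δ φ p.1 (h1 p hp) (h2 p hp)) ?_
  intro v hv p hp hm
  exact (kswap_miss_ne hK v _ (h1 p hp) (h2 p hp)).2 hm

lemma TT_swap {f : E → Sym2 W} {F : Finset E} {a b : W} {φ : E → Fin N} {K : Set W}
    {α δ : Fin N} (hK : KClosed f F φ K α δ)
    (L1 L2 : List (E × W)) (h : TT f F a b φ (L1 ++ L2))
    (h2 : TT f F a b (kswap f K α δ φ) L2)
    (hα : ∃ v ∈ tverts a b L2, Miss f F (kswap f K α δ φ) v α)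
    (hδ : ∃ v ∈ tverts a b L2, Miss f F (kswap f K α δ φ) v δ) :
    TT f F a b (kswap f K α δ φ) (L1 ++ L2) := by
  induction L1 with
  | nil => simpa using h2
  | cons q L ih =>
    obtain ⟨i1, i2, i3, i4, v, hv, hm⟩ := h
    refine ⟨ih i1, i2, i3, i4, ?_⟩
    by_cases hc : φ q.1 = α ∨ φ q.1 = δ
    · rcases kswap_mem f K α δ φ q.1 hc with h | h
      · obtain ⟨v, hv, hm⟩ := hα
        exact ⟨v, tverts_append a b L L2 hv, by rw [h]; exact hm⟩
      · obtain ⟨v, hv, hm⟩ := hδ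
        exact ⟨v, tverts_append a b L L2 hv, by rw [h]; exact hm⟩
    · push Not at hc
      rw [kswap_of_ne f K α δ φ q.1 hc.1 hc.2]
      exact ⟨v, hv, (kswap_miss_ne hK v _ hc.1 hc.2).2 hm⟩

open Classical in
lemma miss_card {f : E → Sym2 W} {F : Finset E} {t : ℕ}
    (hdeg : ∀ w, (F.filter (fun e => w ∈ f e)).card + t ≤ N) (φ : E → Fin N) (w : W) :
    t ≤ ((univ : Finset (Fin N)).filter (fun c => Miss f F φ w c)).card := by
  have h1 := Finset.card_filter_add_card_filter_not (s := (univ : Finset (Fin N)))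
    (fun c => Miss f F φ w c)
  rw [Finset.card_univ, Fintype.card_fin] at h1
  have h2 : ((univ : Finset (Fin N)).filter (fun c => ¬ Miss f F φ w c)).card ≤
      (F.filter (fun e => w ∈ f e)).card := by
    refine (Finset.card_le_card ?_).trans
      (Finset.card_image_le (s := F.filter (fun e => w ∈ f e)) (f := φ))
    intro c hc
    have hc := (Finset.mem_filter.1 hc).2
    unfold Miss at hc
    push Not at hc
    obtain ⟨e, he, hw, h⟩ := hc
    exact Finset.mem_image.2 ⟨e, Finset.mem_filter.2 ⟨he, hw⟩, h⟩
  have := hdeg w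
  omega

open Classical in
lemma elem_card {f : E → Sym2 W} {F : Finset E} {t : ℕ}
    (hdeg : ∀ w, (F.filter (fun e => w ∈ f e)).card + t ≤ N) (hN : N < t * (t + 1))
    (φ : E → Fin N) (T : Finset W) (hT : Elem f F φ T) : T.card ≤ t := by
  have h1 : (T.biUnion (fun w => (univ : Finset (Fin N)).filter (fun c => Miss f F φ w c))).card
      ≤ N := (Finset.card_le_univ _).trans (by simp)
  rw [Finset.card_biUnion] at h1
  · have h2 : T.card * t ≤ N := by
      refine le_trans ?_ h1
      rw [← smul_eq_mul]
      exact Finset.card_nsmul_le_sum _ _ _ (fun w _ => miss_card hdeg φ w)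
    by_contra h
    push Not at h
    nlinarith
  · intro x hx y hy hxy
    rw [Function.onFun, Finset.disjoint_left]
    intro c hc hc'
    simp only [Finset.mem_filter, Finset.mem_univ, true_and] at hc hc'
    exact hxy (hT x hx y hy c hc hc')

lemma exists_unused {f : E → Sym2 W} {F : Finset E} {t : ℕ}
    (hdeg : ∀ w, (F.filter (fun e => w ∈ f e)).card + t ≤ N) (φ : E → Fin N)
    (L : List (E × W)) (hL : L.length < t) (w : W) :
    ∃ c, Miss f F φ w c ∧ ∀ p ∈ L, φ p.1 ≠ c := by
  classical
  have h1 := miss_card hdeg φ w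
  have h2 : ((L.map (fun p => φ p.1)).toFinset).card ≤ L.length := by
    simpa using List.toFinset_card_le (L.map (fun p => φ p.1))
  obtain ⟨c, hc, hc'⟩ := Finset.exists_mem_notMem_of_card_lt_card (h2.trans_lt (hL.trans_le h1))
  refine ⟨c, by simpa using hc, fun p hp h => hc' ?_⟩
  rw [List.mem_toFinset]
  exact List.mem_map.2 ⟨p, hp, h⟩

/-- In a two-coloured component: three vertices each missing one of the colours. -/
lemma not_three {f : E → Sym2 W} {F : Finset E} {φ : E → Fin N} (hφ : PC f F φ) {α δ : Fin N}
    {x y z : W} (hxy : x ≠ y) (hxz : x ≠ z) (hyz : y ≠ z)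
    (hx : Miss f F φ x α ∨ Miss f F φ x δ) (hy : Miss f F φ y α ∨ Miss f F φ y δ)
    (hz : Miss f F φ z α ∨ Miss f F φ z δ)
    (rxy : (KG f F φ ∅ α δ).Reachable x y) : ¬ (KG f F φ ∅ α δ).Reachable x z := by
  classical
  intro rxz
  exact three_ends _ (KG_degree_two hφ ∅ α δ) x y z hxy hxz hyz (KG_degree_one hφ ∅ α δ x hx)
    (KG_degree_one hφ ∅ α δ y hy) (KG_degree_one hφ ∅ α δ z hz) rxy rxz

/-- Given elementary small trees: move colour `α` from `x` to `p` by swapping. -/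
lemma link {f : E → Sym2 W} {F : Finset E} {a b : W} {φ : E → Fin N} (hφ : PC f F φ)
    (L2 : List (E × W)) (hT : TT f F a b φ L2)
    (hel : ∀ φ' : E → Fin N, PC f F φ' → TT f F a b φ' L2 → Elem f F φ' (tverts a b L2))
    {α δ : Fin N} (hα : ∀ p ∈ L2, φ p.1 ≠ α) (hδ : ∀ p ∈ L2, φ p.1 ≠ δ)
    {x p : W} (hx : x ∈ tverts a b L2) (hp : p ∈ tverts a b L2) (hxp : x ≠ p)
    (hxα : Miss f F φ x α) (hpδ : Miss f F φ p δ) :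
    (KG f F φ ∅ α δ).Reachable p x := by
  by_contra hr
  have hK := KClosed_comp f F φ α δ p
  set K : Set W := {w | (KG f F φ ∅ α δ).Reachable p w}
  have h1 := hel _ (kswap_PC hφ hK) (TT_unused hK L2 hT hα hδ)
  refine hxp (h1 x hx p hp α ((kswap_miss_out hK x hr α).2 hxα) ?_)
  have := (kswap_miss_in (f := f) (F := F) (φ := φ) (K := K) (a := α) (b := δ) p
    (SimpleGraph.Reachable.refl p) δ).2 hpδ
  rwa [Equiv.swap_apply_right] at this

end Tash
section Main1

set_option linter.unusedSectionVars false

open Finset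

variable {E W : Type*} [Fintype W] [DecidableEq W] [DecidableEq E] {N : ℕ}

lemma split_first {P : E × W → Prop} (L : List (E × W)) (h : ∃ p ∈ L, P p) :
    ∃ L1 p L2, L = L1 ++ p :: L2 ∧ P p ∧ ∀ q ∈ L2, ¬ P q := by
  induction L with
  | nil => simp at h
  | cons q L ih =>
    by_cases hL : ∃ p ∈ L, P p
    · obtain ⟨L1, p, L2, h1, h2, h3⟩ := ih hL
      exact ⟨q :: L1, p, L2, by simp [h1], h2, h3⟩
    · obtain ⟨p, hp, hP⟩ := h
      rcases List.mem_cons.1 hp with rfl | hp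
      · exact ⟨[], p, L, rfl, hP, fun q hq hPq => hL ⟨q, hq, hPq⟩⟩
      · exact absurd ⟨p, hp, hP⟩ hL

/-- Step B: make the common colour unused. -/
lemma stepB {f : E → Sym2 W} {F : Finset E} {a b : W} {t : ℕ}
    (hdeg : ∀ w, (F.filter (fun e => w ∈ f e)).card + t ≤ N)
    (e : E) (y : W) (L' : List (E × W)) (hlen : L'.length + 1 < t)
    (hel : ∀ L : List (E × W), L.length ≤ L'.length → ∀ φ : E → Fin N, PC f F φ →
      TT f F a b φ L → Elem f F φ (tverts a b L))
    (α : Fin N) : ∀ (n : ℕ) (φ : E → Fin N), PC f F φ → TT f F a b φ ((e, y) :: L') →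
      (((e, y) :: L').countP (fun p => decide (φ p.1 = α))) ≤ n →
      Miss f F φ y α → (∃ x ∈ tverts a b L', Miss f F φ x α) →
      ∃ φ' : E → Fin N, PC f F φ' ∧ TT f F a b φ' ((e, y) :: L') ∧ Miss f F φ' y α ∧
        (∃ x ∈ tverts a b L', Miss f F φ' x α) ∧ ∀ p ∈ ((e, y) :: L'), φ' p.1 ≠ α := by
  intro n
  induction n with
  | zero =>
    intro φ hφ hT hn hy hx
    refine ⟨φ, hφ, hT, hy, hx, ?_⟩
    have := List.countP_eq_zero.1 (Nat.le_zero.1 hn)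
    intro p hp
    simpa using this p hp
  | succ n ih =>
    intro φ hφ hT hn hy hx
    by_cases hu : ∀ p ∈ ((e, y) :: L'), φ p.1 ≠ α
    · exact ⟨φ, hφ, hT, hy, hx, hu⟩
    push Not at hu
    obtain ⟨L1, q, L2, hL, hqα, hL2⟩ := split_first (P := fun p => φ p.1 = α) _ hu
    have hT1 : TT f F a b φ (q :: L2) := by
      rw [hL] at hT
      exact TT_append L1 _ hT
    obtain ⟨hT2, hqF, hq2, ⟨p, hp, hfp⟩, v, hv, hvm⟩ := hT1
    rw [hqα] at hvm
    -- `q` is not the head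
    have hL1 : ∃ L1', L1 = (e, y) :: L1' ∧ L' = L1' ++ q :: L2 := by
      cases L1 with
      | nil =>
        exfalso
        simp only [List.nil_append, List.cons.injEq] at hL
        obtain ⟨hq, -⟩ := hL
        rw [← hq] at hqα hqF hfp
        exact hy e hqF (by simp [hfp]) hqα
      | cons r L1' =>
        simp only [List.cons_append, List.cons.injEq] at hL
        exact ⟨L1', by rw [hL.1], hL.2⟩
    obtain ⟨L1', hL1, hL'⟩ := hL1
    have hpv : v ≠ p := by
      rintro rfl
      exact hvm q.1 hqF (by simp [hfp]) hqα
    obtain ⟨δ, hδm, hδu⟩ := exists_unused hdeg φ ((e, y) :: L') (by simpa using hlen) p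
    have hsub : tverts a b L2 ⊆ tverts a b L' := by
      rw [hL', show L1' ++ q :: L2 = (L1' ++ [q]) ++ L2 by simp]
      exact tverts_append a b _ L2
    have hyL' : y ∉ tverts a b L' := hT.2.2.1
    have hlen2 : L2.length ≤ L'.length := by rw [hL']; simp; omega
    have hδ2 : ∀ r ∈ L2, φ r.1 ≠ δ := fun r hr => hδu r (by rw [hL]; simp [hr])
    have hr := link hφ L2 hT2 (hel L2 hlen2) (α := α) (δ := δ) hL2 hδ2 hv hp hpv hvm hδm
    have hny := not_three hφ (α := α) (δ := δ) hpv.symm (x := p) (y := v) (z := y)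
      (by rintro rfl; exact hyL' (hsub hp)) (by rintro rfl; exact hyL' (hsub hv))
      (Or.inr hδm) (Or.inl hvm) (Or.inl hy) hr
    have hK := KClosed_comp f F φ α δ p
    set K : Set W := {w | (KG f F φ ∅ α δ).Reachable p w} with hKdef
    have hpK : p ∈ K := SimpleGraph.Reachable.refl p
    have hvK : v ∈ K := hr
    have hp' : Miss f F (kswap f K α δ φ) p α := by
      have := (kswap_miss_in (f := f) (F := F) (φ := φ) (K := K) (a := α) (b := δ) p hpK δ).2 hδm
      rwa [Equiv.swap_apply_right] at this
    have hv' : Miss f F (kswap f K α δ φ) v δ := by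
      have := (kswap_miss_in (f := f) (F := F) (φ := φ) (K := K) (a := α) (b := δ) v hvK α).2 hvm
      rwa [Equiv.swap_apply_left] at this
    have hαδ : α ≠ δ := by
      rintro rfl
      exact hδm q.1 hqF (by simp [hfp]) hqα
    apply ih (kswap f K α δ φ) (kswap_PC hφ hK)
    · have h3 := TT_unused hK L2 hT2 hL2 hδ2
      have h4 := TT_swap hK (L1 ++ [q]) L2 (by rw [hL] at hT; simpa using hT) h3 ⟨p, hp, hp'⟩
        ⟨v, hv, hv'⟩
      rw [hL]; simpa using h4
    · have hmono : ∀ L : List (E × W), (∀ r ∈ L, φ r.1 ≠ δ) →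
          L.countP (fun p => decide (kswap f K α δ φ p.1 = α)) ≤
          L.countP (fun p => decide (φ p.1 = α)) := by
        intro L hLδ
        apply List.countP_mono_left
        intro r hr h
        simp only [decide_eq_true_eq] at h ⊢
        by_contra hne
        rw [kswap_of_ne f K α δ φ r.1 hne (hLδ r hr)] at h
        exact hne h
      have hqq : kswap f K α δ φ q.1 = δ := by
        rw [kswap_in f K α δ φ q.1 p (by simp [hfp]) hpK, hqα, Equiv.swap_apply_left]
      rw [hL] at hn hδu ⊢
      rw [List.countP_append, List.countP_cons] at hn ⊢
      have m1 := hmono L1 (fun r hr => hδu r (by simp [hr]))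
      have m2 := hmono L2 (fun r hr => hδu r (by simp [hr]))
      simp only [hqα, hqq, hαδ.symm, decide_true, decide_false, if_true] at hn ⊢
      simp only [Bool.false_eq_true, if_false]
      omega
    · exact (kswap_miss_out hK y hny α).2 hy
    · exact ⟨p, hsub hp, hp'⟩

/-- Rich Tashkinov theorem. -/
lemma tash {f : E → Sym2 W} {F : Finset E} {a b : W} {t : ℕ} {e0 : E} (he0 : e0 ∉ F)
    (hab : a ≠ b) (hf0 : f e0 = s(a, b))
    (hbad : ¬ ∃ φ : E → Fin N, PC f (insert e0 F) φ)
    (hdeg : ∀ w, (F.filter (fun e => w ∈ f e)).card + t ≤ N) (hN : N < t * (t + 1)) :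
    ∀ (n : ℕ) (L : List (E × W)), L.length ≤ n → ∀ φ : E → Fin N, PC f F φ →
      TT f F a b φ L → Elem f F φ (tverts a b L) := by
  intro n
  induction n with
  | zero =>
    intro L hL φ hφ hT
    have : L = [] := List.eq_nil_of_length_eq_zero (Nat.le_zero.1 hL)
    subst this
    intro x hx y hy c hxc hyc
    by_contra hxy
    apply hbad
    have hall : ∀ w ∈ f e0, Miss f F φ w c := by
      intro w hw
      rw [hf0, Sym2.mem_iff] at hw
      simp only [tverts, Finset.mem_insert, Finset.mem_singleton] at hx hy
      rcases hx with rfl | rfl <;> rcases hy with rfl | rfl <;> rcases hw with rfl | rfl <;>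
        first | assumption | exact absurd rfl hxy
    refine ⟨Function.update φ e0 c, ?_⟩
    intro e he e' he' w hw hw' h
    rcases Finset.mem_insert.1 he with rfl | h1 <;> rcases Finset.mem_insert.1 he' with rfl | h2
    · rfl
    · rw [Function.update_self, Function.update_of_ne (by rintro rfl; exact he0 h2)] at h
      exact absurd h.symm (hall w hw e' h2 hw')
    · rw [Function.update_self, Function.update_of_ne (by rintro rfl; exact he0 h1)] at h
      exact absurd h (hall w hw' e h1 hw)
    · rw [Function.update_of_ne (by rintro rfl; exact he0 h1),
        Function.update_of_ne (by rintro rfl; exact he0 h2)] at h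
      exact hφ e h1 e' h2 w hw hw' h
  | succ n ih =>
    intro L hL φ hφ hT
    cases L with
    | nil => exact ih [] (by simp) φ hφ hT
    | cons q L' =>
    obtain ⟨e, y⟩ := q
    have hL'n : L'.length ≤ n := by simpa using hL
    have hel : ∀ L : List (E × W), L.length ≤ L'.length → ∀ φ : E → Fin N, PC f F φ →
      TT f F a b φ L → Elem f F φ (tverts a b L) := fun L h => ih L (h.trans hL'n)
    have hlen : L'.length + 1 < t := by
      have h1 := elem_card hdeg hN φ _ (hel L' le_rfl φ hφ hT.1)
      rw [tverts_card hab L' hT.1] at h1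
      omega
    -- main claim
    have claim : ∀ α x, x ∈ tverts a b L' → Miss f F φ x α → Miss f F φ y α → False := by
      intro α x hx hxα hyα
      obtain ⟨φ1, hφ1, hT1, hy1, ⟨x1, hx1, hx1α⟩, hu1⟩ :=
        stepB hdeg e y L' hlen hel α _ φ hφ hT le_rfl hyα ⟨x, hx, hxα⟩
      -- move to the parent
      have : ∃ φ2 : E → Fin N, PC f F φ2 ∧ TT f F a b φ2 ((e, y) :: L') ∧ Miss f F φ2 y α ∧
          (∃ p ∈ tverts a b L', f e = s(p, y) ∧ Miss f F φ2 p α) ∧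
          ∀ p ∈ ((e, y) :: L'), φ2 p.1 ≠ α := by
        obtain ⟨hT1', heF, hyL, ⟨p, hp, hfp⟩, hv⟩ := id hT1
        simp only at heF hyL hfp
        by_cases hpx : x1 = p
        · exact ⟨φ1, hφ1, hT1, hy1, ⟨p, hp, hfp, hpx ▸ hx1α⟩, hu1⟩
        obtain ⟨β, hβm, hβu⟩ := exists_unused hdeg φ1 ((e, y) :: L') (by simpa using hlen) p
        have hr := link hφ1 L' hT1' (hel L' le_rfl) (α := α) (δ := β)
          (fun r hr => hu1 r (List.mem_cons_of_mem _ hr))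
          (fun r hr => hβu r (List.mem_cons_of_mem _ hr)) hx1 hp hpx hx1α hβm
        have hny := not_three hφ1 (α := α) (δ := β) (x := p) (y := x1) (z := y) (Ne.symm hpx)
          (by rintro rfl; exact hyL hp) (by rintro rfl; exact hyL hx1)
          (Or.inr hβm) (Or.inl hx1α) (Or.inl hy1) hr
        have hK := KClosed_comp f F φ1 α β p
        set K : Set W := {w | (KG f F φ1 ∅ α β).Reachable p w} with hKdef
        have hpK : p ∈ K := SimpleGraph.Reachable.refl p
        refine ⟨kswap f K α β φ1, kswap_PC hφ1 hK, TT_unused hK _ hT1 hu1 hβu,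
          (kswap_miss_out hK y hny α).2 hy1, ⟨p, hp, hfp, ?_⟩, ?_⟩
        · have := (kswap_miss_in (f := f) (F := F) (φ := φ1) (K := K) (a := α) (b := β) p hpK β).2
            hβm
          rwa [Equiv.swap_apply_right] at this
        · intro r hr
          rw [kswap_of_ne f K α β φ1 r.1 (hu1 r hr) (hβu r hr)]
          exact hu1 r hr
      obtain ⟨φ2, hφ2, hT2, hy2, ⟨p, hp, hfp, hpα⟩, hu2⟩ := this
      obtain ⟨hT2', heF, hyL, -, v, hv, hvm⟩ := id hT2
      simp only at heF hyL hvm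
      have hvp : v ≠ p := by
        rintro rfl
        exact hvm e heF (by simp [hfp]) rfl
      have hvy : v ≠ y := by rintro rfl; exact hyL hv
      have heα : φ2 e ≠ α := hu2 (e, y) List.mem_cons_self
      have hall : ∀ w ∈ f e, Miss f F φ2 w α := by
        intro w hw
        rw [hfp, Sym2.mem_iff] at hw
        rcases hw with rfl | rfl
        · exact hpα
        · exact hy2
      have hPC : PC f F (Function.update φ2 e α) := by
        intro e1 he1 e2 he2 w hw1 hw2 h
        by_cases h1 : e1 = e <;> by_cases h2 : e2 = e
        · rw [h1, h2]
        · subst h1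
          rw [Function.update_self, Function.update_of_ne h2] at h
          exact absurd h.symm (hall w hw1 e2 he2 hw2)
        · subst h2
          rw [Function.update_self, Function.update_of_ne h1] at h
          exact absurd h (hall w hw2 e1 he1 hw1)
        · rw [Function.update_of_ne h1, Function.update_of_ne h2] at h
          exact hφ2 e1 he1 e2 he2 w hw1 hw2 h
      have hmiss : ∀ w c, c ≠ α → Miss f F φ2 w c → Miss f F (Function.update φ2 e α) w c := by
        intro w c hc hm e1 he1 hw
        by_cases h1 : e1 = e
        · subst h1; rw [Function.update_self]; exact hc.symm
        · rw [Function.update_of_ne h1]; exact hm e1 he1 hw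
      have hTT : TT f F a b (Function.update φ2 e α) L' := by
        refine TT_mono L' hT2' ?_ ?_
        · intro r hr
          apply Function.update_of_ne
          intro h
          have := (TT_edge L' hT2' r hr).2.1 y (by rw [h, hfp]; simp)
          exact hyL this
        · intro w hw r hr hm
          exact hmiss w _ (hu2 r (List.mem_cons_of_mem _ hr)) hm
      refine hvp (hel L' le_rfl _ hPC hTT v hv p hp (φ2 e) (hmiss v _ heα hvm) ?_)
      intro e1 he1 hw
      by_cases h1 : e1 = e
      · subst h1; rw [Function.update_self]; exact heα.symm
      · rw [Function.update_of_ne h1]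
        intro h
        exact h1 (hφ2 e1 he1 e heF p hw (by simp [hfp]) h)
    intro x hx z hz c hxc hzc
    simp only [tverts, Finset.mem_insert] at hx hz
    rcases hx with rfl | hx <;> rcases hz with rfl | hz
    · rfl
    · exact (claim c z hz hzc hxc).elim
    · exact (claim c x hx hxc hzc).elim
    · exact hel L' le_rfl φ hφ hT.1 x hx z hz c hxc hzc

end Main1
section Fin

set_option linter.unusedSectionVars false

open Finset

variable {E W : Type*} [Fintype W] [DecidableEq W] [DecidableEq E] {N : ℕ}

lemma closed_ext {f : E → Sym2 W} {F : Finset E} {a b : W} {n : ℕ}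
    (hmax : ∀ (φ : E → Fin N) (L : List (E × W)), PC f F φ → TT f F a b φ L → L.length ≤ n)
    {φ : E → Fin N} {L : List (E × W)} (hφ : PC f F φ) (hT : TT f F a b φ L) (hL : L.length = n)
    {v : W} (hv : v ∈ tverts a b L) {e : E} (he : e ∈ F) (hm : Miss f F φ v (φ e))
    {p z : W} (hp : p ∈ tverts a b L) (hf : f e = s(p, z)) : z ∈ tverts a b L := by
  by_contra hz
  have := hmax φ ((e, z) :: L) hφ ⟨hT, he, hz, ⟨p, hp, hf⟩, v, hv, hm⟩
  simp at this
  omega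

open Classical in
lemma colour_count {f : E → Sym2 W} {F : Finset E} {φ : E → Fin N} (hφ : PC f F φ)
    (hloop : ∀ e, ¬ (f e).IsDiag) (T : Finset W) (c : Fin N) :
    (T.filter (fun v => ¬ Miss f F φ v c)).card =
      2 * (F.filter (fun e => φ e = c ∧ ∀ w ∈ f e, w ∈ T)).card +
      (F.filter (fun e => φ e = c ∧ ∃ y z, y ∈ T ∧ z ∉ T ∧ f e = s(y, z))).card := by
  have h1 : T.filter (fun v => ¬ Miss f F φ v c) =
      (F.filter (fun e => φ e = c)).biUnion (fun e => T.filter (fun v => v ∈ f e)) := by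
    ext v
    rw [Finset.mem_filter, Finset.mem_biUnion]
    constructor
    · rintro ⟨hv, h⟩
      unfold Miss at h
      push Not at h
      obtain ⟨e, he, h1, h2⟩ := h
      exact ⟨e, Finset.mem_filter.2 ⟨he, h2⟩, Finset.mem_filter.2 ⟨hv, h1⟩⟩
    · rintro ⟨e, he, hv⟩
      have he := Finset.mem_filter.1 he
      have hv := Finset.mem_filter.1 hv
      exact ⟨hv.1, fun h => h e he.1 hv.2 he.2⟩
  rw [h1, Finset.card_biUnion]
  · rw [← Finset.filter_filter, ← Finset.filter_filter, Finset.card_filter, Finset.card_filter,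
      Finset.mul_sum, ← Finset.sum_add_distrib]
    refine Finset.sum_congr rfl fun e _ => ?_
    have hl := hloop e
    induction hfe : f e using Sym2.ind with
    | _ x y =>
      rw [hfe, Sym2.mk_isDiag_iff] at hl
      have h3 : T.filter (fun v => v ∈ s(x, y)) = ({x, y} : Finset W).filter (fun v => v ∈ T) := by
        ext v
        simp only [Sym2.mem_iff, mem_filter, mem_insert, mem_singleton]
        tauto
      rw [h3]
      by_cases hx : x ∈ T <;> by_cases hy : y ∈ T
      · rw [if_pos (by simp [hx, hy]), if_neg, Finset.filter_true_of_mem (by simp [hx, hy]),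
          Finset.card_pair hl]
        · rfl
        rintro ⟨p, q, hp, hq, h⟩
        rcases Sym2.eq_iff.1 h with ⟨rfl, rfl⟩ | ⟨rfl, rfl⟩ <;> contradiction
      · rw [if_neg (by simp [hy]), if_pos ⟨x, y, hx, hy, rfl⟩]
        rw [Finset.filter_insert, if_pos hx, Finset.filter_singleton, if_neg hy]; simp
      · rw [if_neg (by simp [hx]), if_pos ⟨y, x, hy, hx, Sym2.eq_swap⟩]
        rw [Finset.filter_insert, if_neg hx, Finset.filter_singleton, if_pos hy]; simp
      · rw [if_neg (by simp [hx]), if_neg, Finset.filter_false_of_mem (by simp [hx, hy])]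
        · simp
        rintro ⟨p, q, hp, hq, h⟩
        rcases Sym2.eq_iff.1 h with ⟨rfl, rfl⟩ | ⟨rfl, rfl⟩ <;> contradiction
  · intro e he e' he' hne
    rw [Function.onFun, Finset.disjoint_left]
    intro v hv hv'
    simp only [coe_filter, Set.mem_ofPred_eq, mem_filter] at he he' hv hv'
    exact hne (hφ e he.1 e' he'.1 v hv.2 hv'.2 (he.2.trans he'.2.symm))

open Classical in
lemma even_ends (D : SimpleGraph W) (h2 : ∀ w, D.degree w ≤ 2) (Z : Finset W)
    (h1 : ∀ z ∈ Z, D.degree z ≤ 1) (hp : ∀ z ∈ Z, ∃ z' ∈ Z, z' ≠ z ∧ D.Reachable z z') :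
    Even Z.card := by
  rw [Finset.card_eq_sum_card_image (fun z => D.connectedComponentMk z) Z]
  rw [Finset.sum_congr rfl (g := fun _ => 2)]
  · simp
  intro k hk
  obtain ⟨z, hz, rfl⟩ := Finset.mem_image.1 hk
  obtain ⟨z', hz', hne, hr⟩ := hp z hz
  rw [Finset.card_eq_two]
  refine ⟨z, z', hne.symm, ?_⟩
  ext x
  simp only [mem_filter, mem_insert, mem_singleton, SimpleGraph.ConnectedComponent.eq]
  constructor
  · rintro ⟨hx, hxz⟩
    by_contra hcon
    push Not at hcon
    exact three_ends D h2 z z' x hne.symm hcon.1.symm hcon.2.symm (h1 z hz) (h1 z' hz') (h1 x hx)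
      hr hxz.symm
  · rintro (rfl | rfl)
    · exact ⟨hz, SimpleGraph.Reachable.refl _⟩
    · exact ⟨hz', hr.symm⟩

lemma partner {f : E → Sym2 W} {F : Finset E} {a b : W} {n t : ℕ}
    (hmax : ∀ (φ : E → Fin N) (L : List (E × W)), PC f F φ → TT f F a b φ L → L.length ≤ n)
    (hdeg : ∀ w, (F.filter (fun e => w ∈ f e)).card + t ≤ N)
    {φ : E → Fin N} {L : List (E × W)} (hφ : PC f F φ) (hT : TT f F a b φ L) (hL : L.length = n)
    (hLt : L.length < t)
    {α γ : Fin N} (hα : ∀ v ∈ tverts a b L, ¬ Miss f F φ v α)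
    {u : W} (hu : u ∈ tverts a b L) (huγ : Miss f F φ u γ) (hγ : ∀ p ∈ L, φ p.1 ≠ γ)
    {o : E} (ho : o ∈ F) (hoα : φ o = α) {y z : W} (hy : y ∈ tverts a b L)
    (hz : z ∉ tverts a b L) (hfo : f o = s(y, z))
    {o2 : E} (ho2 : o2 ∈ F) (hoα2 : φ o2 = α) {y2 z2 : W} (hy2 : y2 ∈ tverts a b L)
    (hz2 : z2 ∉ tverts a b L) (hfo2 : f o2 = s(y2, z2)) (hne : o2 ≠ o) :
    ∃ o' ∈ F, φ o' = α ∧ ∃ y' z', y' ∈ tverts a b L ∧ z' ∉ tverts a b L ∧ f o' = s(y', z') ∧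
      z' ≠ z ∧ (KG f F φ (tverts a b L) α γ).Reachable z z' := by
  by_contra hcon
  push Not at hcon
  obtain ⟨δ, hyδ, hδ⟩ := exists_unused hdeg φ L hLt y
  have hδα : δ ≠ α := by rintro rfl; exact hα y hy hyδ
  have hγα : γ ≠ α := by rintro rfl; exact hα u hu huγ
  set T := tverts a b L with hTdef
  have hLα : ∀ p ∈ L, φ p.1 ≠ α := by
    intro p hp h
    obtain ⟨-, -, v, hv, hm⟩ := TT_edge L hT p hp
    exact hα v hv (h ▸ hm)
  -- first exchange
  have hK0 : KClosed f F φ {w | w ∉ T} γ δ := by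
    intro e he hc w hw w' hw' hwT
    by_cases hww : w = w'
    · exact hww ▸ hwT
    intro hw'T
    have hf : f e = s(w', w) := (Sym2.mem_and_mem_iff (Ne.symm hww)).1 ⟨hw', hw⟩
    apply hwT
    rcases hc with hc | hc
    · exact closed_ext hmax hφ hT hL hu he (hc ▸ huγ) hw'T hf
    · exact closed_ext hmax hφ hT hL hy he (hc ▸ hyδ) hw'T hf
  set φ1 := kswap f {w | w ∉ T} γ δ φ with hφ1
  have hPC1 : PC f F φ1 := kswap_PC hφ hK0
  have hin : ∀ e ∈ F, ∀ w ∈ f e, w ∈ T → φ1 e = φ e := by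
    intro e he w hw hwT
    exact kswap_out hK0 e he w hw (by simpa using hwT)
  have hmin : ∀ v ∈ T, ∀ c, Miss f F φ1 v c ↔ Miss f F φ v c := by
    intro v hv c
    exact kswap_miss_out hK0 v (by simpa using hv) c
  have hLin : ∀ p ∈ L, φ1 p.1 = φ p.1 := by
    intro p hp
    obtain ⟨h1, h2, -⟩ := TT_edge L hT p hp
    have : (f p.1).out.1 ∈ f p.1 := Sym2.out_fst_mem _
    exact hin p.1 h1 _ this (h2 _ this)
  have hT1 : TT f F a b φ1 L := TT_mono L hT hLin (fun v hv p hp hm => (hmin v hv _).2 hm)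
  -- second exchange
  have hK1 : KClosed f F φ1
      {w | w = y ∨ (w ∉ T ∧ (KG f F φ T α γ).Reachable z w)} α δ := by
    intro e he hc w hw w' hw' hwK
    by_cases hww : w = w'
    · exact hww ▸ hwK
    have hf : f e = s(w, w') := (Sym2.mem_and_mem_iff hww).1 ⟨hw, hw'⟩
    rcases hwK with rfl | ⟨hwT, hr⟩
    · rw [hin e he w hw hy] at hc
      have hc := hc.resolve_right (hyδ e he hw)
      have : e = o := hφ e he o ho w hw (by simp [hfo]) (hc.trans hoα.symm)
      subst this
      rw [hfo] at hf
      have : z = w' := Sym2.congr_right.1 hf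
      subst this
      exact Or.inr ⟨hz, SimpleGraph.Reachable.refl _⟩
    · by_cases hw'T : w' ∈ T
      · have hf' : f e = s(w', w) := by rw [hf, Sym2.eq_swap]
        rw [hin e he w' hw' hw'T] at hc
        rcases hc with hc | hc
        · by_cases hwz : w = z
          · subst hwz
            have : e = o := hφ e he o ho w hw (by simp [hfo]) (hc.trans hoα.symm)
            subst this
            rw [hfo, Sym2.mem_iff] at hw'
            rcases hw' with rfl | rfl
            · exact Or.inl rfl
            · exact absurd hw'T hwT
          · exact absurd hr (hcon e he hc w' w hw'T hwT hf' hwz)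
        · exact absurd (closed_ext hmax hφ hT hL hy he (hc ▸ hyδ) hw'T hf') hwT
      · have hsw : φ1 e = Equiv.swap γ δ (φ e) := kswap_in f _ γ δ φ e w hw hwT
        refine Or.inr ⟨hw'T, hr.trans (SimpleGraph.Adj.reachable ?_)⟩
        refine ⟨hww, hwT, hw'T, e, he, hf, ?_⟩
        rw [hsw] at hc
        rcases hc with hc | hc
        · left
          have := congrArg (Equiv.swap γ δ) hc
          rwa [Equiv.swap_apply_self, Equiv.swap_apply_of_ne_of_ne hγα.symm hδα.symm] at this
        · right
          have := congrArg (Equiv.swap γ δ) hc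
          rwa [Equiv.swap_apply_self, Equiv.swap_apply_right] at this
  set K1 : Set W := {w | w = y ∨ (w ∉ T ∧ (KG f F φ T α γ).Reachable z w)} with hK1def
  have hPC2 := kswap_PC hPC1 hK1
  have hT2 := TT_unused hK1 L hT1 (fun p hp => by rw [hLin p hp]; exact hLα p hp)
    (fun p hp => by rw [hLin p hp]; exact hδ p hp)
  have hy2α : Miss f F (kswap f K1 α δ φ1) y α := by
    have := (kswap_miss_in (f := f) (F := F) (φ := φ1) (K := K1) (a := α) (b := δ) y
      (Or.inl rfl) δ).2 ((hmin y hy δ).2 hyδ)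
    rwa [Equiv.swap_apply_right] at this
  have hyy : y2 ≠ y := by
    rintro rfl
    exact hne (hφ o2 ho2 o ho y2 (by simp [hfo2]) (by simp [hfo]) (hoα2.trans hoα.symm))
  have ho2c : kswap f K1 α δ φ1 o2 = α := by
    rw [kswap_out hK1 o2 ho2 y2 (by simp [hfo2]), hin o2 ho2 y2 (by simp [hfo2]) hy2, hoα2]
    rintro (h | h)
    · exact hyy h
    · exact h.1 hy2
  exact hz2 (closed_ext hmax hPC2 hT2 hL hy ho2 (ho2c.symm ▸ hy2α) hy2 hfo2)

open Classical in
lemma one_out {f : E → Sym2 W} {F : Finset E} {a b : W} {n t : ℕ}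
    (hmax : ∀ (φ : E → Fin N) (L : List (E × W)), PC f F φ → TT f F a b φ L → L.length ≤ n)
    (hdeg : ∀ w, (F.filter (fun e => w ∈ f e)).card + t ≤ N)
    {φ : E → Fin N} {L : List (E × W)} (hφ : PC f F φ) (hT : TT f F a b φ L) (hL : L.length = n)
    (hLt : L.length < t)
    {α γ : Fin N} (hα : ∀ v ∈ tverts a b L, ¬ Miss f F φ v α)
    {u : W} (hu : u ∈ tverts a b L) (huγ : Miss f F φ u γ) (hγ : ∀ p ∈ L, φ p.1 ≠ γ)
    (hodd : Odd (F.filter (fun e => φ e = α ∧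
      ∃ y z, y ∈ tverts a b L ∧ z ∉ tverts a b L ∧ f e = s(y, z))).card) :
    (F.filter (fun e => φ e = α ∧
      ∃ y z, y ∈ tverts a b L ∧ z ∉ tverts a b L ∧ f e = s(y, z))).card = 1 := by
  set O := F.filter (fun e => φ e = α ∧
      ∃ y z, y ∈ tverts a b L ∧ z ∉ tverts a b L ∧ f e = s(y, z)) with hO
  set T := tverts a b L with hTdef
  by_contra hne
  have h2 : 1 < O.card := by
    have := hodd.pos
    omega
  have hex : ∀ e : E, ∃ z : W, e ∈ O → z ∉ T ∧ ∃ y ∈ T, f e = s(y, z) := by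
    intro e
    by_cases he : e ∈ O
    · obtain ⟨-, -, y, z, hy, hz, hf⟩ := Finset.mem_filter.1 he
      exact ⟨z, fun _ => ⟨hz, y, hy, hf⟩⟩
    · exact ⟨a, fun h => absurd h he⟩
  choose g hg using hex
  have hinj : Set.InjOn g O := by
    intro e he e' he' h
    obtain ⟨h1, y, hy, hf⟩ := hg e he
    obtain ⟨h1', y', hy', hf'⟩ := hg e' he'
    have m1 := Finset.mem_filter.1 he
    have m2 := Finset.mem_filter.1 he'
    exact hφ e m1.1 e' m2.1 (g e) (by simp [hf]) (by simp [hf', h]) (m1.2.1.trans m2.2.1.symm)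
  have hev : Even (O.image g).card := by
    refine even_ends (KG f F φ T α γ) (KG_degree_two hφ T α γ) _ ?_ ?_
    · intro z hz
      obtain ⟨e, he, rfl⟩ := Finset.mem_image.1 hz
      obtain ⟨h1, y, hy, hf⟩ := hg e he
      have m1 := Finset.mem_filter.1 he
      refine (degree_le_of_colors hφ _ (g e) {γ} ?_).trans (by simp)
      rintro w' ⟨-, -, hw', e', he', hf', hc⟩
      refine ⟨e', he', hf', ?_⟩
      rcases hc with hc | hc
      · exfalso
        have : e' = e := hφ e' he' e m1.1 (g e) (by simp [hf']) (by simp [hf]) (hc.trans m1.2.1.symm)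
        subst this
        rw [hf'] at hf
        have : y ∈ s(g e', w') := by rw [hf]; simp
        rcases Sym2.mem_iff.1 this with h | h
        · exact h1 (h ▸ hy)
        · exact hw' (h ▸ hy)
      · simpa using hc
    · intro z hz
      obtain ⟨e, he, rfl⟩ := Finset.mem_image.1 hz
      obtain ⟨h1, y, hy, hf⟩ := hg e he
      have m1 := Finset.mem_filter.1 he
      obtain ⟨e2, he2, hne2⟩ := Finset.exists_mem_ne h2 e
      obtain ⟨h12, y2, hy2, hf2⟩ := hg e2 he2
      have m2 := Finset.mem_filter.1 he2
      obtain ⟨o', ho', hoα', y', z', hy', hz', hf', hne', hr⟩ :=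
        partner hmax hdeg hφ hT hL hLt hα hu huγ hγ m1.1 m1.2.1 hy h1 hf m2.1 m2.2.1 hy2 h12 hf2
          hne2
      have hoO : o' ∈ O := Finset.mem_filter.2 ⟨ho', hoα', y', z', hy', hz', hf'⟩
      obtain ⟨h3, y3, hy3, hf3⟩ := hg o' hoO
      have hgz : g o' = z' := by
        rw [hf'] at hf3
        rcases Sym2.eq_iff.1 hf3 with ⟨-, h⟩ | ⟨h, -⟩
        · exact h.symm
        · exact absurd (h ▸ hy') h3
      exact ⟨z', Finset.mem_image.2 ⟨o', hoO, hgz⟩, hne', hr⟩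
  rw [Finset.card_image_of_injOn hinj] at hev
  exact (Nat.not_even_iff_odd.2 hodd) hev

open Classical in
lemma step {f : E → Sym2 W} {F : Finset E} {t : ℕ} (hloop : ∀ e, ¬ (f e).IsDiag)
    {e0 : E} (he0 : e0 ∉ F) (ht : 1 ≤ t)
    (hdeg : ∀ w, (F.filter (fun e => w ∈ f e)).card + t ≤ N) (hN : N < t * (t + 1))
    (hodd : ∀ S : Finset W, Odd S.card →
      2 * ((insert e0 F).filter (fun e => ∀ w ∈ f e, w ∈ S)).card ≤ N * (S.card - 1))
    (h0 : ∃ φ : E → Fin N, PC f F φ) : ∃ φ : E → Fin N, PC f (insert e0 F) φ := by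
  by_contra hbad
  obtain ⟨φ0, hφ0⟩ := h0
  obtain ⟨a, b, hf0⟩ : ∃ a b, f e0 = s(a, b) := by
    induction h : f e0 using Sym2.ind with
    | _ x y => exact ⟨x, y, rfl⟩
  have hab : a ≠ b := by
    have := hloop e0
    rwa [hf0, Sym2.mk_isDiag_iff] at this
  let P : ℕ → Prop := fun n => ∃ (φ : E → Fin N) (L : List (E × W)), PC f F φ ∧ TT f F a b φ L ∧
    L.length = n
  have hb : ∀ n, P n → n ≤ Fintype.card W := by
    rintro n ⟨φ, L, h1, h2, h3⟩
    have h4 := tverts_card hab L h2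
    have h5 := Finset.card_le_univ (tverts a b L)
    omega
  have hP0 : P 0 := ⟨φ0, [], hφ0, trivial, rfl⟩
  obtain ⟨φ, L, hφ, hT, hL⟩ := Nat.findGreatest_spec (P := P) (Nat.zero_le (Fintype.card W)) hP0
  set n := Nat.findGreatest P (Fintype.card W) with hn
  have hmax : ∀ (φ : E → Fin N) (L : List (E × W)), PC f F φ → TT f F a b φ L → L.length ≤ n := by
    intro φ' L' h1 h2
    have : P L'.length := ⟨φ', L', h1, h2, rfl⟩
    exact Nat.le_findGreatest (hb _ this) this
  have hel : Elem f F φ (tverts a b L) := tash he0 hab hf0 hbad hdeg hN L.length L le_rfl φ hφ hT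
  have hcard := tverts_card hab L hT
  have hle := elem_card hdeg hN φ _ hel
  have hLt : L.length < t := by omega
  have haT : a ∈ tverts a b L := by
    have := tverts_append (E := E) a b L []
    rw [List.append_nil] at this
    exact this (by simp [tverts])
  have hbT : b ∈ tverts a b L := by
    have := tverts_append (E := E) a b L []
    rw [List.append_nil] at this
    exact this (by simp [tverts])
  obtain ⟨γ, haγ, hγ⟩ := exists_unused hdeg φ L hLt a
  set T := tverts a b L with hTdef
  have hmissing : ∀ v ∈ T, ∀ c, Miss f F φ v c →
      2 * (F.filter (fun e => φ e = c ∧ ∀ w ∈ f e, w ∈ T)).card + 1 = T.card := by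
    intro v hv c hm
    have h1 := colour_count hφ hloop T c
    have h2 : (F.filter (fun e => φ e = c ∧ ∃ y z, y ∈ T ∧ z ∉ T ∧ f e = s(y, z))) = ∅ := by
      rw [Finset.filter_eq_empty_iff]
      rintro e he ⟨hc, y, z, hy, hz, hf⟩
      exact hz (closed_ext hmax hφ hT hL hv he (hc ▸ hm) hy hf)
    have h3 : T.filter (fun v => ¬ Miss f F φ v c) = T.erase v := by
      ext x
      simp only [mem_filter, mem_erase]
      constructor
      · rintro ⟨hx, h⟩
        exact ⟨by rintro rfl; exact h hm, hx⟩
      · rintro ⟨h, hx⟩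
        exact ⟨hx, fun hm' => h (hel x hx v hv c hm' hm)⟩
    rw [h2, h3, Finset.card_erase_of_mem hv] at h1
    simp at h1
    have : 0 < T.card := Finset.card_pos.2 ⟨v, hv⟩
    omega
  have hTodd : Odd T.card := ⟨_, (hmissing a haT γ haγ).symm⟩
  have hall : ∀ c, 2 * (F.filter (fun e => φ e = c ∧ ∀ w ∈ f e, w ∈ T)).card + 1 = T.card := by
    intro c
    by_cases h : ∃ v ∈ T, Miss f F φ v c
    · obtain ⟨v, hv, hm⟩ := h
      exact hmissing v hv c hm
    · push Not at h
      have h1 := colour_count hφ hloop T c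
      rw [Finset.filter_true_of_mem h] at h1
      have h2 : (F.filter (fun e => φ e = c ∧ ∃ y z, y ∈ T ∧ z ∉ T ∧ f e = s(y, z))).card = 1 :=
        one_out hmax hdeg hφ hT hL hLt h haT haγ hγ (by
        rw [← Nat.not_even_iff_odd]
        intro hev
        apply Nat.not_even_iff_odd.2 hTodd
        rw [h1]
        exact (even_two_mul _).add hev)
      omega
  have hsum : 2 * (F.filter (fun e => ∀ w ∈ f e, w ∈ T)).card = N * (T.card - 1) := by
    rw [Finset.card_eq_sum_card_fiberwise (f := φ) (t := univ) (by intro x _; simp), Finset.mul_sum]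
    rw [Finset.sum_congr rfl (g := fun _ => T.card - 1)]
    · simp
    · intro c _
      rw [← hall c, Finset.filter_filter]
      simp only [and_comm, Nat.add_sub_cancel]
  have h1 := hodd T hTodd
  rw [Finset.filter_insert, if_pos (by
    intro w hw
    rw [hf0, Sym2.mem_iff] at hw
    rcases hw with rfl | rfl <;> assumption), Finset.card_insert_of_notMem (by simp [he0])] at h1
  omega

open Classical in
theorem core [Fintype E] {f : E → Sym2 W} {t : ℕ} (hloop : ∀ e, ¬ (f e).IsDiag)
    (ht : 1 ≤ t) (hN0 : 0 < N)
    (hdeg : ∀ w, ((univ : Finset E).filter (fun e => w ∈ f e)).card + t ≤ N)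
    (hN : N < t * (t + 1))
    (hodd : ∀ S : Finset W, Odd S.card →
      2 * ((univ : Finset E).filter (fun e => ∀ w ∈ f e, w ∈ S)).card ≤ N * (S.card - 1)) :
    ∃ φ : E → Fin N, PC f univ φ := by
  have : ∀ F : Finset E, ∃ φ : E → Fin N, PC f F φ := by
    intro F
    induction F using Finset.induction_on with
    | empty => exact ⟨fun _ => ⟨0, hN0⟩, by intro e he; simp at he⟩
    | insert e0 F he0 ih =>
      refine step hloop he0 ht ?_ hN ?_ ih
      · intro w
        refine le_trans (Nat.add_le_add_right (Finset.card_le_card ?_) t) (hdeg w)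
        intro e he
        simp only [mem_filter, mem_univ, true_and] at he ⊢
        exact he.2
      · intro S hS
        refine le_trans (Nat.mul_le_mul_left 2 (Finset.card_le_card ?_)) (hodd S hS)
        exact Finset.filter_subset_filter _ (Finset.subset_univ _)
  exact this univ

end Fin
section Frac

open Finset

lemma frac_nonempty {V : Type*} [Fintype V] [DecidableEq V] (G : SimpleGraph V) :
    {c : ℝ | ∃ w : Finset V → ℝ, IsFractionalColoring G w c}.Nonempty := by
  refine ⟨_, fun S => if S.card = 1 then 1 else 0, ?_, ?_, le_rfl, ?_⟩
  · intro S
    dsimp only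
    split_ifs <;> norm_num
  · intro S hS u hu v hv h
    have h1 : S.card = 1 := by
      by_contra h1
      exact hS (if_neg h1)
    have := Finset.card_le_one.1 h1.le u hu v hv
    exact G.ne_of_adj h this
  · intro v
    rw [← Finset.sum_filter, Finset.filter_filter]
    have : (univ : Finset (Finset V)).filter (fun S => v ∈ S ∧ S.card = 1) = {{v}} := by
      ext S
      rw [Finset.mem_filter, Finset.mem_singleton]
      constructor
      · rintro ⟨-, hv, h1⟩
        obtain ⟨x, rfl⟩ := Finset.card_eq_one.1 h1
        rw [Finset.mem_singleton.1 hv]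
      · rintro rfl
        simp
    rw [this]
    simp

lemma frac_bound {V : Type*} [Fintype V] [DecidableEq V] (G : SimpleGraph V) (A : Finset V)
    (b : ℝ) (hb : 0 ≤ b)
    (h : ∀ S : Finset V, (∀ u ∈ S, ∀ v ∈ S, ¬ G.Adj u v) → ((S ∩ A).card : ℝ) ≤ b) :
    (A.card : ℝ) ≤ b * fracChromatic G := by
  have key : ∀ c ∈ {c : ℝ | ∃ w : Finset V → ℝ, IsFractionalColoring G w c},
      (A.card : ℝ) ≤ b * c := by
    rintro c ⟨w, h0, hs, hc, h1⟩
    have e1 : (A.card : ℝ) = ∑ S : Finset V, w S * ((S ∩ A).card : ℝ) := by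
      calc (A.card : ℝ) = ∑ v ∈ A, (1 : ℝ) := by simp
        _ = ∑ v ∈ A, ∑ S : Finset V, (if v ∈ S then w S else 0) := by
            refine Finset.sum_congr rfl fun v _ => ?_
            rw [← h1 v, Finset.sum_filter]
        _ = ∑ S : Finset V, ∑ v ∈ A, (if v ∈ S then w S else 0) := Finset.sum_comm
        _ = ∑ S : Finset V, w S * ((S ∩ A).card : ℝ) := by
            refine Finset.sum_congr rfl fun S _ => ?_
            rw [← Finset.sum_filter, Finset.filter_mem_eq_inter, Finset.sum_const, nsmul_eq_mul,
              mul_comm, Finset.inter_comm]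
    rw [e1]
    calc ∑ S : Finset V, w S * ((S ∩ A).card : ℝ) ≤ ∑ S : Finset V, w S * b := by
          refine Finset.sum_le_sum fun S _ => ?_
          by_cases hw : w S = 0
          · simp [hw]
          · exact mul_le_mul_of_nonneg_left (h S (hs S hw)) (h0 S)
      _ = b * ∑ S : Finset V, w S := by rw [← Finset.sum_mul, mul_comm]
      _ ≤ b * c := mul_le_mul_of_nonneg_left hc hb
  rcases hb.eq_or_lt with hb0 | hb0
  · obtain ⟨c, hc⟩ := frac_nonempty G
    have := key c hc
    rw [← hb0] at this ⊢
    simpa using this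
  · have : (A.card : ℝ) / b ≤ fracChromatic G := by
      refine le_csInf (frac_nonempty G) fun c hc => ?_
      rw [div_le_iff₀ hb0, mul_comm]
      exact key c hc
    rwa [div_le_iff₀ hb0, mul_comm] at this

theorem frac_main {V W : Type*} [Fintype V] [DecidableEq V] [Fintype W] [DecidableEq W]
    (c : ℝ) (hc : 1 ≤ c) (G : SimpleGraph V) (f : V → Sym2 W) (hloop : ∀ e, ¬ (f e).IsDiag)
    (hadj : ∀ u v : V, u ≠ v → (G.Adj u v ↔ ∃ x : W, x ∈ f u ∧ x ∈ f v))
    (hfrac : fracChromatic G ≤ c + (1 / 3) * Real.sqrt c) :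
    G.Colorable ⌊c + 3 * Real.sqrt c⌋₊ := by
  classical
  set k := Real.sqrt c with hk
  have hk1 : 1 ≤ k := Real.one_le_sqrt.2 hc
  have hkc : k * k = c := Real.mul_self_sqrt (by linarith)
  set N := ⌊c + 3 * k⌋₊ with hN
  set D := ⌊c + (1 / 3) * k⌋₊ with hD
  have hN1 : (N : ℝ) ≤ c + 3 * k := Nat.floor_le (by linarith)
  have hN2 : c + 3 * k < N + 1 := Nat.lt_floor_add_one _
  have hD1 : (D : ℝ) ≤ c + (1 / 3) * k := Nat.floor_le (by linarith)
  have hDN : D ≤ N := by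
    have : (D : ℝ) ≤ N := by linarith
    exact_mod_cast this
  obtain ⟨t, ht⟩ := Nat.exists_eq_add_of_le hDN
  have htr : (N : ℝ) = D + t := by exact_mod_cast ht
  have ht1 : (8 / 3) * k - 1 < t := by linarith
  have htN : N < t * (t + 1) := by
    have : (N : ℝ) < t * (t + 1) := by nlinarith
    exact_mod_cast this
  have ht0 : 1 ≤ t := by
    have : (0 : ℝ) < t := by linarith
    have : 0 < t := by exact_mod_cast this
    exact this
  obtain ⟨φ, hφ⟩ := core (N := N) (t := t) hloop ht0 (by omega) (by
    intro w
    have h1 := frac_bound G ((univ : Finset V).filter (fun e => w ∈ f e)) 1 zero_le_one (by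
      intro S hS
      have : (S ∩ (univ : Finset V).filter (fun e => w ∈ f e)).card ≤ 1 := by
        rw [Finset.card_le_one]
        intro u hu v hv
        by_contra hne
        have hu := Finset.mem_inter.1 hu
        have hv := Finset.mem_inter.1 hv
        exact hS u hu.1 v hv.1 ((hadj u v hne).2 ⟨w, (Finset.mem_filter.1 hu.2).2,
          (Finset.mem_filter.1 hv.2).2⟩)
      exact_mod_cast this)
    have h2 : ((univ : Finset V).filter (fun e => w ∈ f e)).card ≤ D := Nat.le_floor (by linarith)
    omega) htN (by
    rintro S ⟨j, hj⟩
    have h1 := frac_bound G ((univ : Finset V).filter (fun e => ∀ w ∈ f e, w ∈ S)) j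
      (Nat.cast_nonneg j) (by
      intro M hM
      have h3 : ((M ∩ (univ : Finset V).filter (fun e => ∀ w ∈ f e, w ∈ S)).biUnion
        (fun e => S.filter (fun v => v ∈ f e))).card ≤ S.card := by
        refine Finset.card_le_card (Finset.biUnion_subset.2 fun e _ => Finset.filter_subset _ _)
      rw [Finset.card_biUnion] at h3
      · have h4 : (M ∩ (univ : Finset V).filter (fun e => ∀ w ∈ f e, w ∈ S)).card * 2 ≤ S.card := by
          refine le_trans ?_ h3
          rw [← smul_eq_mul]
          refine Finset.card_nsmul_le_sum _ _ _ fun e he => ?_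
          have he := (Finset.mem_filter.1 (Finset.mem_inter.1 he).2).2
          have hl := hloop e
          induction hfe : f e using Sym2.ind with
          | _ x y =>
            rw [hfe, Sym2.mk_isDiag_iff] at hl
            rw [hfe] at he
            rw [← Finset.card_pair hl]
            refine Finset.card_le_card ?_
            intro v hv
            have hv' : v ∈ s(x, y) := by simpa using hv
            exact Finset.mem_filter.2 ⟨he v hv', hv'⟩
        have : (M ∩ (univ : Finset V).filter (fun e => ∀ w ∈ f e, w ∈ S)).card ≤ j := by omega
        exact_mod_cast this
      · intro u hu v hv hne
        rw [Function.onFun, Finset.disjoint_left]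
        intro x hx hx'
        have hu := Finset.mem_inter.1 hu
        have hv := Finset.mem_inter.1 hv
        exact hM u hu.1 v hv.1 ((hadj u v hne).2 ⟨x, (Finset.mem_filter.1 hx).2,
          (Finset.mem_filter.1 hx').2⟩))
    have h2 : (((univ : Finset V).filter (fun e => ∀ w ∈ f e, w ∈ S)).card : ℝ) ≤ j * N :=
      h1.trans (mul_le_mul_of_nonneg_left (by linarith) (Nat.cast_nonneg j))
    have h3 : ((univ : Finset V).filter (fun e => ∀ w ∈ f e, w ∈ S)).card ≤ j * N := by
      exact_mod_cast h2
    rw [hj, Nat.add_sub_cancel]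
    nlinarith)
  refine ⟨SimpleGraph.Coloring.mk φ ?_⟩
  intro u v huv heq
  have hne := G.ne_of_adj huv
  obtain ⟨x, hx, hx'⟩ := (hadj u v hne).1 huv
  exact hne (hφ u (mem_univ _) v (mem_univ _) x hx hx' heq)

open Classical in
lemma rep_aux {V W : Type*} {u v : V} (huv : u ≠ v) (a b x y : W) :
    (a = x ∨ a = y ∨ b = x ∨ b = y) ↔
    ((Sum.inl a : W ⊕ V) = Sum.inl x ∨ (Sum.inl a : W ⊕ V) = (if x = y then Sum.inr v else Sum.inl y)
    ∨ (if a = b then Sum.inr u else Sum.inl b : W ⊕ V) = Sum.inl x ∨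
    (if a = b then Sum.inr u else Sum.inl b : W ⊕ V) = (if x = y then Sum.inr v else Sum.inl y)) := by
  by_cases h1 : a = b
  · subst h1
    by_cases h2 : x = y
    · subst h2
      simp [huv]
    · simp only [if_neg h2, if_true, Sum.inl.injEq, reduceCtorEq, false_or, or_false]
      tauto
  · by_cases h2 : x = y
    · subst h2
      simp only [if_neg h1, if_true, Sum.inl.injEq, reduceCtorEq, false_or, or_false]
      tauto
    · simp only [if_neg h1, if_neg h2, Sum.inl.injEq]

end Frac

/-- If `c ≥ 1` and `G'` is a finite line graph of a multigraph with
`χ_f(G') ≤ c + (1/3)√c`, then `χ(G') ≤ ⌊c + 3√c⌋`. -/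
theorem lineGraph_chromatic_le_floor {V : Type*} [Fintype V] [DecidableEq V]
    (c : ℝ) (hc : 1 ≤ c) (G' : SimpleGraph V)
    (hline : IsLineGraphOfMultigraph G')
    (hfrac : fracChromatic G' ≤ c + (1 / 3) * Real.sqrt c) :
    G'.chromaticNumber ≤ (⌊c + 3 * Real.sqrt c⌋₊ : ℕ∞) := by
  classical
  obtain ⟨W, f, hf⟩ := hline
  have hex : ∀ v, ∃ p : W × W, f v = s(p.1, p.2) := by
    intro v
    induction h : f v using Sym2.ind with
    | _ x y => exact ⟨(x, y), rfl⟩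
  choose p hp using hex
  let a' : V → W ⊕ V := fun v => Sum.inl (p v).1
  let b' : V → W ⊕ V := fun v => if (p v).1 = (p v).2 then Sum.inr v else Sum.inl (p v).2
  let X : Set (W ⊕ V) := Set.range (Sum.elim a' b')
  have hX : X.Finite := Set.finite_range _
  have : Fintype X := hX.fintype
  let g : V → Sym2 X := fun v => s(⟨a' v, Sum.inl v, rfl⟩, ⟨b' v, Sum.inr v, rfl⟩)
  have hab : ∀ v, a' v ≠ b' v := by
    intro v
    simp only [a', b']
    split_ifs with h
    · simp
    · simpa using h
  apply SimpleGraph.Colorable.chromaticNumber_le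
  refine frac_main c hc G' g ?_ ?_ hfrac
  · intro v h
    have h' : (⟨a' v, Sum.inl v, rfl⟩ : X) = ⟨b' v, Sum.inr v, rfl⟩ := h
    exact hab v (congrArg Subtype.val h')
  · intro u v huv
    rw [hf u v huv]
    have h1 : (∃ x, x ∈ f u ∧ x ∈ f v) ↔ ((p u).1 = (p v).1 ∨ (p u).1 = (p v).2 ∨
        (p u).2 = (p v).1 ∨ (p u).2 = (p v).2) := by
      rw [hp u, hp v]
      simp only [Sym2.mem_iff]
      constructor
      · rintro ⟨x, rfl | rfl, h | h⟩ <;> simp [h]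
      · rintro (h | h | h | h)
        · exact ⟨_, Or.inl rfl, Or.inl h⟩
        · exact ⟨_, Or.inl rfl, Or.inr h⟩
        · exact ⟨_, Or.inr rfl, Or.inl h⟩
        · exact ⟨_, Or.inr rfl, Or.inr h⟩
    have h2 : (∃ x, x ∈ g u ∧ x ∈ g v) ↔ (a' u = a' v ∨ a' u = b' v ∨
        b' u = a' v ∨ b' u = b' v) := by
      simp only [g, Sym2.mem_iff]
      constructor
      · rintro ⟨x, rfl | rfl, h | h⟩ 
        · exact Or.inl (Subtype.ext_iff.1 h)
        · exact Or.inr (Or.inl (Subtype.ext_iff.1 h))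
        · exact Or.inr (Or.inr (Or.inl (Subtype.ext_iff.1 h)))
        · exact Or.inr (Or.inr (Or.inr (Subtype.ext_iff.1 h)))
      · rintro (h | h | h | h)
        · exact ⟨_, Or.inl rfl, Or.inl (Subtype.ext h)⟩
        · exact ⟨_, Or.inl rfl, Or.inr (Subtype.ext h)⟩
        · exact ⟨_, Or.inr rfl, Or.inl (Subtype.ext h)⟩
        · exact ⟨_, Or.inr rfl, Or.inr (Subtype.ext h)⟩
    rw [h1, h2]
    exact rep_aux huv _ _ _ _
end

section
/- Let G be a finite simple graph and let (A, B) be a homogeneous pair of cliques in G. Then the subgraph of G induced on A ∪ B contains an induced cycle of length 4 if and only if the subgraph of G induced on A ∪ B is not a linear interval graph. -/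
/-- `S` is a linear interval graph: it admits a linear interval representation. -/
def IsLinearIntervalGraph {V : Type*} (S : SimpleGraph V) : Prop :=
  ∃ (p : V → ℝ) (𝓘 : Set (Set ℝ)), IsLinearIntervalRep S p 𝓘

/-- `(A, B)` is a homogeneous pair of cliques in `G`: `A` and `B` are disjoint nonempty
cliques with `|A ∪ B| ≥ 3`, and every vertex outside `A ∪ B` sees all or none of `A`
and all or none of `B`. -/
def IsHomogeneousPairOfCliques {V : Type*} (G : SimpleGraph V) (A B : Set V) : Prop :=
  Disjoint A B ∧ A.Nonempty ∧ B.Nonempty ∧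
  G.IsClique A ∧ G.IsClique B ∧ 3 ≤ (A ∪ B).ncard ∧
  (∀ v ∉ A ∪ B,
    ((∀ a ∈ A, G.Adj v a) ∨ (∀ a ∈ A, ¬ G.Adj v a)) ∧
    ((∀ b ∈ B, G.Adj v b) ∨ (∀ b ∈ B, ¬ G.Adj v b)))

theorem aux_order {V : Type*} [Fintype V] (d : V → ℕ) :
    ∃ f : V → ℕ, Function.Injective f ∧ (∀ v, 0 < f v) ∧ ∀ u v, f u ≤ f v → d v ≤ d u := by
  classical
  let e := Fintype.equivFin V
  set n := Fintype.card V with hn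
  set K := ∑ v, d v with hK
  have hd : ∀ v, d v ≤ K := fun v =>
    Finset.single_le_sum (f := d) (fun _ _ => Nat.zero_le _) (Finset.mem_univ v)
  have key : ∀ u v, n * (K - d u) + (e u : ℕ) + 1 ≤ n * (K - d v) + (e v : ℕ) + 1 →
      d v ≤ d u := by
    intro u v h
    by_contra hlt
    have h1 : K - d v + 1 ≤ K - d u := by have := hd v; omega
    have h2 := Nat.mul_le_mul_left n h1
    have h3 := (e v).2
    rw [Nat.mul_add] at h2
    omega
  refine ⟨fun v => n * (K - d v) + (e v : ℕ) + 1, ?_, fun v => Nat.succ_pos _, key⟩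
  intro u v h
  have h1 := key u v (le_of_eq h)
  have h2 := key v u (le_of_eq h.symm)
  have h3 : d u = d v := le_antisymm h2 h1
  simp only [h3] at h
  exact e.injective (Fin.ext (by omega))

theorem aux_nested {V : Type*} [Fintype V] (G : SimpleGraph V) (X Y : Set V)
    (hC : ∀ a ∈ X, ∀ a' ∈ X, ∀ b ∈ Y, ∀ b' ∈ Y,
      G.Adj a b → ¬ G.Adj a b' → G.Adj a' b' → G.Adj a' b)
    (a a' : V) (ha : a ∈ X) (ha' : a' ∈ X)
    (h : {y | y ∈ Y ∧ G.Adj a y}.ncard ≤ {y | y ∈ Y ∧ G.Adj a' y}.ncard)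
    (b : V) (hb : b ∈ Y) (hab : G.Adj a b) : G.Adj a' b := by
  by_contra hn
  have hsub : {y | y ∈ Y ∧ G.Adj a' y} ⊆ {y | y ∈ Y ∧ G.Adj a y} := by
    rintro y ⟨hy, hay⟩
    refine ⟨hy, ?_⟩
    by_contra h'
    exact hn (hC a ha a' ha' b hb y hy hab h' hay)
  have := Set.eq_of_subset_of_ncard_le hsub h (Set.toFinite _)
  have hmem : b ∈ {y | y ∈ Y ∧ G.Adj a y} := ⟨hb, hab⟩
  rw [← this] at hmem
  exact hn hmem.2

theorem aux_umbrella {V : Type*} (S : SimpleGraph V) (p : V → ℝ) (hp : Function.Injective p)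
    (h : ∀ u v x y, S.Adj u v → p u ≤ p x → p x < p y → p y ≤ p v → S.Adj x y) :
    IsLinearIntervalGraph S := by
  refine ⟨p, {I | ∃ u v, S.Adj u v ∧ I = Set.Icc (p u) (p v)}, hp, ?_, ?_⟩
  · rintro I ⟨u, v, -, rfl⟩
    exact ⟨_, _, rfl⟩
  · intro x y hxy
    constructor
    · intro hadj
      rcases le_total (p x) (p y) with hle | hle
      · exact ⟨_, ⟨x, y, hadj, rfl⟩, ⟨le_rfl, hle⟩, ⟨hle, le_rfl⟩⟩
      · exact ⟨_, ⟨y, x, hadj.symm, rfl⟩, ⟨hle, le_rfl⟩, ⟨le_rfl, hle⟩⟩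
    · rintro ⟨I, ⟨u, v, huv, rfl⟩, hx, hy⟩
      rcases lt_or_gt_of_ne (fun h => hxy (hp h)) with hlt | hlt
      · exact h u v x y huv hx.1 hlt hy.2
      · exact (h u v y x huv hy.1 hlt hx.2).symm

theorem aux_noC4 {V : Type*} (S : SimpleGraph V) (hS : IsLinearIntervalGraph S)
    (a b c d : V) (h1 : S.Adj a b) (h2 : S.Adj b c) (h3 : S.Adj c d) (h4 : S.Adj d a)
    (hac : a ≠ c) (hbd : b ≠ d) (n1 : ¬ S.Adj a c) (n2 : ¬ S.Adj b d) : False := by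
  obtain ⟨p, I, hp, hI, hadj⟩ := hS
  have um : ∀ u v x, S.Adj u v → p u ≤ p x → p x ≤ p v → x ≠ v → S.Adj x v := by
    intro u v x huv h1 h2 hne
    obtain ⟨J, hJ, hu, hv⟩ := (hadj u v huv.ne).1 huv
    refine (hadj x v hne).2 ⟨J, hJ, ?_, hv⟩
    obtain ⟨s, t, rfl⟩ := hI J hJ
    exact ⟨hu.1.trans h1, h2.trans hv.2⟩
  have key : ∀ u x y, S.Adj u x → S.Adj u y → x ≠ y → ¬ S.Adj x y →
      p u ≤ p x → p u ≤ p y → False := by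
    intro u x y hx hy hne hn h1 h2
    rcases le_total (p x) (p y) with h | h
    · exact hn (um u y x hy h1 h hne)
    · exact hn (um u x y hx h2 h hne.symm).symm
  have ka := key a b d h1 h4.symm hbd n2
  have kb := key b a c h1.symm h2 hac n1
  have kc := key c b d h2.symm h3 hbd n2
  have kd := key d a c h4 h3.symm hac n1
  grind

/-- For a homogeneous pair of cliques `(A, B)` in a finite graph `G`, the subgraph
induced on `A ∪ B` contains an induced 4-cycle iff it is not a linear interval graph. -/
theorem homogeneousPair_inducedC4_iff_not_linearInterval {V : Type*} [Fintype V]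
    (G : SimpleGraph V) (A B : Set V)
    (hAB : IsHomogeneousPairOfCliques G A B) :
    (∃ v₁ v₂ v₃ v₄ : V, v₁ ∈ A ∪ B ∧ v₂ ∈ A ∪ B ∧ v₃ ∈ A ∪ B ∧ v₄ ∈ A ∪ B ∧
      v₁ ≠ v₂ ∧ v₁ ≠ v₃ ∧ v₁ ≠ v₄ ∧ v₂ ≠ v₃ ∧ v₂ ≠ v₄ ∧ v₃ ≠ v₄ ∧
      G.Adj v₁ v₂ ∧ G.Adj v₂ v₃ ∧ G.Adj v₃ v₄ ∧ G.Adj v₄ v₁ ∧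
      ¬ G.Adj v₁ v₃ ∧ ¬ G.Adj v₂ v₄) ↔
    ¬ IsLinearIntervalGraph (G.induce (A ∪ B)) := by
  classical
  obtain ⟨hdis, -, -, hA, hB, -, -⟩ := hAB
  constructor
  · rintro ⟨a, b, c, d, ha, hb, hc, hd, -, hac, -, -, hbd, -, h1, h2, h3, h4, n1, n2⟩ hS
    exact aux_noC4 _ hS ⟨a, ha⟩ ⟨b, hb⟩ ⟨c, hc⟩ ⟨d, hd⟩ h1 h2 h3 h4
      (fun h => hac (congrArg Subtype.val h)) (fun h => hbd (congrArg Subtype.val h)) n1 n2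
  · intro hn
    by_contra hno
    apply hn
    have hd : ∀ x, x ∈ A → x ∈ B → False := fun x h1 h2 => Set.disjoint_left.1 hdis h1 h2
    have hC : ∀ a ∈ A, ∀ a' ∈ A, ∀ b ∈ B, ∀ b' ∈ B,
        G.Adj a b → ¬ G.Adj a b' → G.Adj a' b' → G.Adj a' b := by
      intro a ha a' ha' b hb b' hb' h1 h2 h3
      by_contra h4
      have haa : a ≠ a' := by rintro rfl; exact h4 h1
      have hbb : b ≠ b' := by rintro rfl; exact h2 h1
      exact hno ⟨a, b, b', a', Or.inl ha, Or.inr hb, Or.inr hb', Or.inl ha', h1.ne,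
        fun h => hd a ha (h ▸ hb'), haa, hbb, fun h => hd a' ha' (h ▸ hb), h3.ne.symm,
        h1, hB hb hb' hbb, h3.symm, hA ha' ha haa.symm, h2, fun h => h4 h.symm⟩
    have hC' : ∀ a ∈ B, ∀ a' ∈ B, ∀ b ∈ A, ∀ b' ∈ A,
        G.Adj a b → ¬ G.Adj a b' → G.Adj a' b' → G.Adj a' b := by
      intro a ha a' ha' b hb b' hb' h1 h2 h3
      exact (hC b' hb' b hb a' ha' a ha h3.symm (fun h => h2 h.symm) h1.symm).symm
    obtain ⟨f, fi, fp, fd⟩ := aux_order (fun v => {y | y ∈ B ∧ G.Adj v y}.ncard)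
    obtain ⟨g, gi, gp, gd⟩ := aux_order (fun v => {y | y ∈ A ∧ G.Adj v y}.ncard)
    let q : V → ℝ := fun v => if v ∈ A then -(f v : ℝ) else (g v : ℝ)
    have qA : ∀ v ∈ A, q v = -(f v : ℝ) := fun v hv => if_pos hv
    have qB : ∀ v ∈ B, q v = (g v : ℝ) := fun v hv => if_neg (fun h => hd v h hv)
    have qAn : ∀ v ∈ A, q v < 0 := fun v hv => by
      rw [qA v hv]; have : (0 : ℝ) < f v := by exact_mod_cast fp v
      linarith
    have qBp : ∀ v ∈ B, 0 < q v := fun v hv => by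
      rw [qB v hv]; exact_mod_cast gp v
    have sA : ∀ a ∈ A, ∀ x ∈ A, q a ≤ q x → ∀ b ∈ B, G.Adj a b → G.Adj x b := by
      intro a ha x hx h b hb hab
      rw [qA a ha, qA x hx, neg_le_neg_iff] at h
      exact aux_nested G A B hC a x ha hx (fd x a (by exact_mod_cast h)) b hb hab
    have sB : ∀ b ∈ B, ∀ y ∈ B, q y ≤ q b → ∀ a ∈ A, G.Adj b a → G.Adj y a := by
      intro b hb y hy h a ha hab
      rw [qB b hb, qB y hy] at h
      exact aux_nested G B A hC' b y hb hy (gd y b (by exact_mod_cast h)) a ha hab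
    refine aux_umbrella _ (fun v => q v.1) ?_ ?_
    · rintro ⟨u, hu⟩ ⟨v, hv⟩ h
      simp only at h
      apply Subtype.ext
      show u = v
      rcases hu with hu | hu <;> rcases hv with hv | hv
      · rw [qA u hu, qA v hv, neg_inj] at h
        exact fi (by exact_mod_cast h)
      · linarith [qAn u hu, qBp v hv]
      · linarith [qAn v hv, qBp u hu]
      · rw [qB u hu, qB v hv] at h
        exact gi (by exact_mod_cast h)
    · rintro ⟨u, hu⟩ ⟨v, hv⟩ ⟨x, hx⟩ ⟨y, hy⟩ huv h1 h2 h3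
      simp only [SimpleGraph.comap_adj, Function.Embedding.subtype_apply] at huv h1 h2 h3 ⊢
      have hne : x ≠ y := by rintro rfl; exact lt_irrefl _ h2
      rcases hx with hx | hx <;> rcases hy with hy | hy
      · exact hA hx hy hne
      · have hu' : u ∈ A := hu.resolve_right fun h => by linarith [qAn x hx, qBp u h]
        have hv' : v ∈ B := hv.resolve_left fun h => by linarith [qAn v h, qBp y hy]
        have e1 := sA u hu' x hx h1 v hv' huv
        exact (sB v hv' y hy h3 x hx e1.symm).symm
      · linarith [qAn y hy, qBp x hx]
      · exact hB hx hy hne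
end
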